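/- Assume the Riemann Hypothesis. Then, as N → ∞, Σ_{n=N+1}^{N+H} r''_{1,2}(n) = H N^{1/2} + O( H²/N^{1/2} + N^{3/4} (log N)³ + H N^{1/3} (log N)² ), uniformly for H in the range N^{1/4}(log N)³ = o(H) and H = o(N). -/

import Mathlib

open Finset Filter Asymptotics

/-- `r''_{1,2}(n) = ∑_{p₁ + p₂² = n} log p₁ log p₂`, the sum running over pairs of primes,
counting weighted representations of `n` as a prime plus a prime square. -/
noncomputable def r12 (n : ℕ) : ℝ :=
  ∑ p1 ∈ Finset.range (n + 1), ∑ p2 ∈ Finset.range (n + 1),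
    if p1.Prime ∧ p2.Prime ∧ p1 + p2 ^ 2 = n then Real.log p1 * Real.log p2 else 0

/-- The entire function `(s - 1) ζ(s)`. -/
noncomputable def zetaReg : ℂ → ℂ := Function.update (fun s => (s - 1) * riemannZeta s) 1 1

lemma zetaReg_of_ne {s : ℂ} (hs : s ≠ 1) : zetaReg s = (s - 1) * riemannZeta s := by
  simp [zetaReg, Function.update_of_ne hs]

lemma zetaReg_one : zetaReg 1 = 1 := by simp [zetaReg]

lemma differentiable_zetaReg : Differentiable ℂ zetaReg := by
  have h : DifferentiableOn ℂ zetaReg Set.univ := by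
    rw [← Complex.differentiableOn_compl_singleton_and_continuousAt_iff (c := 1) Filter.univ_mem]
    constructor
    · have : DifferentiableOn ℂ (fun s => (s - 1) * riemannZeta s) (Set.univ \ {1}) := by
        intro s hs
        have hs1 : s ≠ 1 := by simpa using hs
        exact ((differentiableAt_id.sub_const 1).mul
          (differentiableAt_riemannZeta hs1)).differentiableWithinAt
      refine this.congr ?_
      intro s hs
      exact zetaReg_of_ne (by simpa using hs)
    · rw [zetaReg, continuousAt_update_same]
      exact riemannZeta_residue_one
  exact differentiableOn_univ.mp h

noncomputable def fractTail (x : ℝ) : ℂ := Set.indicator (Set.Ioi 1) (fun t : ℝ => ((Int.fract t : ℝ) : ℂ)) x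

lemma fractTail_norm_le (x : ℝ) : ‖fractTail x‖ ≤ 1 := by
  unfold fractTail
  by_cases h : x ∈ Set.Ioi (1:ℝ)
  · rw [Set.indicator_of_mem h]
    rw [Complex.norm_real, Real.norm_eq_abs, abs_of_nonneg (Int.fract_nonneg _)]
    exact (Int.fract_lt_one _).le
  · rw [Set.indicator_of_notMem h]; simp

lemma measurable_fractTail : Measurable fractTail := by
  unfold fractTail
  exact (Complex.measurable_ofReal.comp measurable_fract).indicator measurableSet_Ioi

lemma fractTail_loc : MeasureTheory.LocallyIntegrableOn fractTail (Set.Ioi 0) := by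
  have : MeasureTheory.LocallyIntegrable fractTail := by
    refine (MeasureTheory.locallyIntegrable_const (1:ℝ)).mono measurable_fractTail.aestronglyMeasurable ?_
    filter_upwards with x
    simpa using fractTail_norm_le x
  exact this.locallyIntegrableOn _

lemma fractTail_top : fractTail =O[atTop] fun x : ℝ => x ^ (-(0:ℝ)) := by
  simp only [neg_zero, Real.rpow_zero]
  exact isBigO_of_le _ (fun x => by simpa using fractTail_norm_le x)

lemma fractTail_bot (b : ℝ) : fractTail =O[nhdsWithin 0 (Set.Ioi 0)] fun x : ℝ => x ^ (-b) := by
  have : fractTail =ᶠ[nhdsWithin 0 (Set.Ioi 0)] 0 := by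
    have h : Set.Iio (1:ℝ) ∈ nhdsWithin (0:ℝ) (Set.Ioi 0) :=
      mem_nhdsWithin_of_mem_nhds (Iio_mem_nhds one_pos)
    filter_upwards [h] with x hx
    simp only [fractTail, Pi.zero_apply]
    exact Set.indicator_of_notMem (by simp at hx ⊢; exact hx.le) _
  exact this.trans_isBigO (isBigO_zero _ _)

lemma mellin_fractTail_differentiableAt {s : ℂ} (hs : 0 < s.re) :
    DifferentiableAt ℂ (fun s => mellin fractTail (-s)) s := by
  have := mellin_differentiableAt_of_isBigO_rpow (s := -s) fractTail_loc fractTail_top (by simpa using hs)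
    (fractTail_bot (-s.re - 1)) (by simp)
  exact this.comp s differentiable_neg.differentiableAt

lemma mellin_fractTail_norm_le {s : ℂ} (hs : 1/10 ≤ s.re) : ‖mellin fractTail (-s)‖ ≤ 10 := by
  have e : mellin fractTail (-s) = ∫ t in Set.Ioi (1:ℝ), (t:ℂ)^(-s-1) * ((Int.fract t : ℝ) : ℂ) := by
    unfold mellin
    have : ∀ t : ℝ, (t:ℂ)^(-s-1) • fractTail t =
        (Set.Ioi (1:ℝ)).indicator (fun t : ℝ => (t:ℂ)^(-s-1) * ((Int.fract t : ℝ) : ℂ)) t := by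
      intro t
      unfold fractTail
      by_cases h : t ∈ Set.Ioi (1:ℝ)
      · rw [Set.indicator_of_mem h, Set.indicator_of_mem h]; rfl
      · rw [Set.indicator_of_notMem h, Set.indicator_of_notMem h]; simp
    simp_rw [this]
    rw [MeasureTheory.setIntegral_indicator measurableSet_Ioi]
    congr 2
    ext t; simp only [Set.mem_inter_iff, Set.mem_Ioi]; constructor
    · exact fun h => h.2
    · exact fun h => ⟨by linarith, h⟩
  rw [e]
  have hi : MeasureTheory.IntegrableOn (fun t : ℝ => t ^ (-(1/10:ℝ)-1)) (Set.Ioi 1) :=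
    integrableOn_Ioi_rpow_of_lt (by norm_num) one_pos
  refine (MeasureTheory.norm_integral_le_of_norm_le hi ?_).trans ?_
  · rw [MeasureTheory.ae_restrict_iff' measurableSet_Ioi]
    filter_upwards with t ht
    have ht0 : (0:ℝ) < t := lt_trans one_pos ht
    rw [norm_mul, Complex.norm_cpow_eq_rpow_re_of_pos ht0, Complex.norm_real, Real.norm_eq_abs,
      abs_of_nonneg (Int.fract_nonneg _)]
    calc t ^ (-s-1).re * Int.fract t ≤ t ^ (-s-1).re * 1 := by
          gcongr; exact (Int.fract_lt_one _).le
      _ ≤ t ^ (-(1/10:ℝ)-1) := by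
          rw [mul_one]
          apply Real.rpow_le_rpow_of_exponent_le (le_of_lt ht)
          simp; linarith
  · rw [integral_Ioi_rpow_of_lt (by norm_num) one_pos]
    norm_num

lemma zetaReg_eq_of_one_lt {s : ℂ} (hs : 1 < s.re) :
    zetaReg s = s - s * (s - 1) * mellin fractTail (-s) := by
  have hs1 : s ≠ 1 := by rintro rfl; simp at hs
  have h0 : s ≠ 0 := by rintro rfl; simp at hs; linarith
  have hs1' : s - 1 ≠ 0 := sub_ne_zero.mpr hs1
  have h1 : riemannZeta s = s * ∫ t in Set.Ioi (1 : ℝ), (⌊t⌋₊ : ℂ) * t ^ (-(s + 1)) := by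
    rw [← LSeries_one_eq_riemannZeta hs]
    rw [LSeries_eq_mul_integral' 1 zero_le_one hs]
    · simp
    · simp only [Pi.one_apply, norm_one, sum_const, Nat.card_Icc, add_tsub_cancel_right, nsmul_eq_mul, mul_one]
      simp only [Real.rpow_one]
      exact isBigO_refl _ _
  have h2 : ∫ t in Set.Ioi (1 : ℝ), (t:ℂ) ^ (-s) = 1 / (s - 1) := by
    rw [integral_Ioi_cpow_of_lt (by simpa using hs) one_pos]
    simp
    rw [← neg_sub, inv_neg]
    have : -s + 1 = -(s-1) := by ring
    field_simp
    rw [this]; field_simp; ring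
  have e : mellin fractTail (-s) = ∫ t in Set.Ioi (1:ℝ), ((t:ℂ)^(-s) - (⌊t⌋₊ : ℂ) * t ^ (-(s + 1))) := by
    unfold mellin
    have : ∀ t : ℝ, (t:ℂ)^(-s-1) • fractTail t =
        (Set.Ioi (1:ℝ)).indicator (fun t : ℝ => (t:ℂ)^(-s) - (⌊t⌋₊ : ℂ) * t ^ (-(s + 1))) t := by
      intro t
      unfold fractTail
      by_cases h : t ∈ Set.Ioi (1:ℝ)
      · have ht0 : (0:ℝ) < t := lt_trans one_pos h
        have ht0' : (t:ℂ) ≠ 0 := by exact_mod_cast ht0.ne'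
        rw [Set.indicator_of_mem h, Set.indicator_of_mem h]
        have : (t:ℂ)^(-s) = (t:ℂ)^(-s-1) * t := by
          nth_rewrite 3 [← Complex.cpow_one (t:ℂ)]
          rw [← Complex.cpow_add _ _ ht0']; congr 1; ring
        rw [this, smul_eq_mul, neg_add', Int.fract]
        have : ((⌊t⌋₊ : ℕ) : ℂ) = ((⌊t⌋ : ℤ) : ℂ) := by
          have := natCast_floor_eq_intCast_floor (R := ℝ) ht0.le
          exact_mod_cast this
        rw [this]
        push_cast
        ring
      · rw [Set.indicator_of_notMem h, Set.indicator_of_notMem h]; simp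
    simp_rw [this]
    rw [MeasureTheory.setIntegral_indicator measurableSet_Ioi]
    congr 2
    ext t; simp only [Set.mem_inter_iff, Set.mem_Ioi]; constructor
    · exact fun h => h.2
    · exact fun h => ⟨by linarith, h⟩
  have i1 : MeasureTheory.IntegrableOn (fun t : ℝ => (t:ℂ) ^ (-s)) (Set.Ioi 1) :=
    integrableOn_Ioi_cpow_of_lt (by simpa using hs) one_pos
  have i2 : MeasureTheory.IntegrableOn (fun t : ℝ => (⌊t⌋₊ : ℂ) * (t:ℂ) ^ (-(s + 1))) (Set.Ioi 1) := by
    refine i1.norm.mono' ?_ ?_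
    · refine MeasureTheory.AEStronglyMeasurable.mul ?_ ?_
      · exact (Measurable.comp (g := fun n : ℕ => (n:ℂ)) (measurable_from_nat) Nat.measurable_floor).aestronglyMeasurable
      · refine Measurable.aestronglyMeasurable ?_
        fun_prop
    · rw [MeasureTheory.ae_restrict_iff' measurableSet_Ioi]
      filter_upwards with t ht
      have ht0 : (0:ℝ) < t := lt_trans one_pos ht
      rw [norm_mul, Complex.norm_cpow_eq_rpow_re_of_pos ht0, Complex.norm_cpow_eq_rpow_re_of_pos ht0, Complex.norm_natCast]
      calc (⌊t⌋₊:ℝ) * t ^ (-(s+1)).re ≤ t * t ^ (-(s+1)).re := by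
            gcongr; exact Nat.floor_le ht0.le
        _ = t ^ (-s).re := by
            nth_rewrite 1 [← Real.rpow_one t]
            rw [← Real.rpow_add ht0]; congr 1; simp
  rw [MeasureTheory.integral_sub i1 i2, h2] at e
  rw [zetaReg_of_ne hs1, e, h1]
  field_simp
  ring

lemma zetaReg_eq {s : ℂ} (hs : 0 < s.re) :
    zetaReg s = s - s * (s - 1) * mellin fractTail (-s) := by
  have hU : IsOpen {s : ℂ | 0 < s.re} := isOpen_lt continuous_const Complex.continuous_re
  have hc : IsPreconnected {s : ℂ | 0 < s.re} := (convex_halfSpace_re_gt 0).isPreconnected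
  have hf : AnalyticOnNhd ℂ zetaReg {s : ℂ | 0 < s.re} :=
    differentiable_zetaReg.differentiableOn.analyticOnNhd hU
  have hg : AnalyticOnNhd ℂ (fun s => s - s * (s - 1) * mellin fractTail (-s)) {s : ℂ | 0 < s.re} := by
    refine DifferentiableOn.analyticOnNhd ?_ hU
    intro z hz
    refine DifferentiableAt.differentiableWithinAt ?_
    have := mellin_fractTail_differentiableAt (s := z) hz
    fun_prop
  refine hf.eqOn_of_preconnected_of_eventuallyEq hg hc (z₀ := 2) (by simp) ?_ hs
  have : {s : ℂ | 1 < s.re} ∈ nhds (2:ℂ) :=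
    (isOpen_lt continuous_const Complex.continuous_re).mem_nhds (by simp)
  filter_upwards [this] with z hz
  exact zetaReg_eq_of_one_lt hz

lemma norm_zetaReg_le {s : ℂ} (hs : 1/10 ≤ s.re) : ‖zetaReg s‖ ≤ 11 * (1 + ‖s‖)^2 := by
  rw [zetaReg_eq (by linarith)]
  have h1 := mellin_fractTail_norm_le hs
  calc ‖s - s * (s - 1) * mellin fractTail (-s)‖ ≤ ‖s‖ + ‖s‖ * ‖s - 1‖ * ‖mellin fractTail (-s)‖ := by
        refine (norm_sub_le _ _).trans ?_
        rw [norm_mul, norm_mul]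
    _ ≤ ‖s‖ + ‖s‖ * (‖s‖ + 1) * 10 := by
        gcongr
        exact (norm_sub_le _ _).trans (by simp)
    _ ≤ _ := by nlinarith [norm_nonneg s]

lemma norm_logDeriv_le_of_ne_zero {f : ℂ → ℂ} {M A r r' : ℝ} (hf : Differentiable ℂ f)
    (hr' : 0 < r') (hr : r' < r) (hM : ∀ z, ‖z‖ < r → ‖f z‖ ≤ M) (hA : 0 < A)
    (hMA : M ≤ ‖f 0‖ * Real.exp A) (h0 : ∀ z, ‖z‖ ≤ r → f z ≠ 0) {z : ℂ} (hz : ‖z‖ ≤ r') :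
    ‖deriv f z / f z‖ ≤ 8 * r / (r - r')^2 * A := by
  have hr0 : 0 < r := hr'.trans hr
  have hq : DifferentiableOn ℂ (fun z => deriv f z / f z) (Metric.ball 0 r) := by
    intro w hw
    have hw' : f w ≠ 0 := h0 w (mem_ball_zero_iff.mp hw).le
    exact ((hf.deriv w).div (hf w) hw').differentiableWithinAt
  obtain ⟨h₁, hh₁⟩ := hq.isExactOn_ball
  set h : ℂ → ℂ := fun z => h₁ z - h₁ 0 with hh
  have hd : ∀ w ∈ Metric.ball (0:ℂ) r, HasDerivAt h (deriv f w / f w) w := fun w hw =>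
    (hh₁ w hw).sub_const _
  have hfe : ∀ w ∈ Metric.ball (0:ℂ) r, f w = f 0 * Complex.exp (h w) := by
    intro w hw
    have hconst : ∀ x ∈ Metric.ball (0:ℂ) r,
        HasDerivAt (fun w => f w * Complex.exp (-h w)) 0 x := by
      intro x hx
      have hx' : f x ≠ 0 := h0 x (mem_ball_zero_iff.mp hx).le
      have := (hf x).hasDerivAt.mul (hd x hx).neg.cexp
      refine this.congr_deriv ?_
      field_simp
      ring
    have hc := (convex_ball (0:ℂ) r).is_const_of_fderivWithin_eq_zero (𝕜 := ℂ)
      (f := fun w => f w * Complex.exp (-h w))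
      (fun x hx => (hconst x hx).differentiableAt.differentiableWithinAt)
      (fun x hx => by
        rw [fderivWithin_of_isOpen Metric.isOpen_ball hx]
        ext
        simp [(hconst x hx).hasFDerivAt.fderiv]) hw (Metric.mem_ball_self hr0)
    have e0 : h 0 = 0 := by simp [hh]
    simp only [e0, neg_zero, Complex.exp_zero, mul_one] at hc
    rw [← hc, mul_assoc, ← Complex.exp_add]; simp
  have hre : ∀ w ∈ Metric.ball (0:ℂ) r, (h w).re ≤ A := by
    intro w hw
    have h1 := hM w (by simpa using hw)
    rw [hfe w hw, norm_mul, Complex.norm_exp] at h1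
    have hf0 : 0 < ‖f 0‖ := norm_pos_iff.mpr (h0 0 (by simpa using hr0.le))
    have := le_of_mul_le_mul_left (h1.trans hMA) hf0
    exact Real.exp_le_exp.mp this
  have hb : ∀ w, ‖w‖ ≤ (r + r')/2 → ‖h w‖ ≤ 4 * A * r / (r - r') := by
    intro w hw
    have hwr : ‖w‖ < r := by linarith
    have := Complex.borelCaratheodory_zero hA
      (fun x hx => (hd x hx).differentiableAt.differentiableWithinAt) (fun x hx => hre x hx) hr0
      (z := w) (by simpa using hwr) (by simp [hh])
    refine this.trans ?_
    rw [div_le_div_iff₀ (by linarith) (by linarith)]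
    nlinarith [norm_nonneg w, mul_pos hA hr0, mul_nonneg hA.le (sub_nonneg.mpr hwr.le), mul_nonneg (mul_pos hA hr0).le (sub_nonneg.mpr hw), mul_nonneg (mul_nonneg hA.le (norm_nonneg w)) (sub_pos.mpr hr).le, mul_nonneg (mul_nonneg hA.le (sub_pos.mpr hr).le) (sub_nonneg.mpr hwr.le)]
  have hzr : z ∈ Metric.ball (0:ℂ) r := by simp; linarith
  have hsub : Metric.closedBall z ((r - r')/2) ⊆ Metric.ball 0 r := by
    intro w hw
    rw [mem_closedBall_iff_norm] at hw
    have : ‖w‖ ≤ ‖w - z‖ + ‖z‖ := by simpa using norm_add_le (w - z) z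
    simp; linarith
  have hdc : DiffContOnCl ℂ h (Metric.ball z ((r - r')/2)) := by
    apply DifferentiableOn.diffContOnCl
    rw [closure_ball _ (by linarith)]
    exact fun x hx => (hd x (hsub hx)).differentiableAt.differentiableWithinAt
  have := Complex.norm_deriv_le_of_forall_mem_sphere_norm_le (by linarith : 0 < (r - r')/2) hdc
    (C := 4 * A * r / (r - r')) (fun w hw => hb w (by
      rw [mem_sphere_iff_norm] at hw
      have : ‖w‖ ≤ ‖w - z‖ + ‖z‖ := by simpa using norm_add_le (w - z) z
      linarith))
  rw [(hd z hzr).deriv] at this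
  refine this.trans (le_of_eq ?_)
  have : r - r' ≠ 0 := by linarith
  field_simp
  ring

lemma norm_sub_eq_of_norm_eq {ρ z : ℂ} {R : ℝ} (hR : 0 < R) (hz : ‖z‖ = R) :
    ‖(R:ℂ)^2 - (starRingEnd ℂ) ρ * z‖ / R = ‖z - ρ‖ := by
  have h1 : (R:ℂ)^2 = (starRingEnd ℂ) z * z := by
    rw [← hz, mul_comm, Complex.mul_conj, Complex.normSq_eq_norm_sq]; push_cast; rfl
  rw [h1, ← sub_mul, ← map_sub, norm_mul, Complex.norm_conj, hz]
  field_simp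

lemma exists_zeros_logDeriv {R r r' M A : ℝ} (hr' : 0 < r') (hr : r' < r) (hR : r < R) (hA : 0 < A)
    (k : ℕ) : ∀ f : ℂ → ℂ, Differentiable ℂ f → (∀ z, ‖z‖ ≤ R → ‖f z‖ ≤ M) → f 0 ≠ 0 →
      M ≤ ‖f 0‖ * Real.exp A → M ≤ ‖f 0‖ * (R / r) ^ k →
      ∃ n : ℕ, n ≤ k ∧ ∃ ρ : Fin n → ℂ, (∀ i, f (ρ i) = 0 ∧ ‖ρ i‖ ≤ r) ∧
        ∀ z, ‖z‖ ≤ r' → f z ≠ 0 →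
          ‖deriv f z / f z - ∑ i, 1 / (z - ρ i)‖ ≤ 8 * r / (r - r')^2 * A + k * (1 / (R - r)) := by
  have hr0 : 0 < r := hr'.trans hr
  have hR0 : 0 < R := hr0.trans hR
  have hRr : 1 < R / r := (one_lt_div hr0).mpr hR
  have base : ∀ k : ℕ, ∀ f : ℂ → ℂ, Differentiable ℂ f → (∀ z, ‖z‖ ≤ R → ‖f z‖ ≤ M) →
      M ≤ ‖f 0‖ * Real.exp A → (∀ z, ‖z‖ ≤ r → f z ≠ 0) →
      ∃ n : ℕ, n ≤ k ∧ ∃ ρ : Fin n → ℂ, (∀ i, f (ρ i) = 0 ∧ ‖ρ i‖ ≤ r) ∧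
        ∀ z, ‖z‖ ≤ r' → f z ≠ 0 →
          ‖deriv f z / f z - ∑ i, 1 / (z - ρ i)‖ ≤ 8 * r / (r - r')^2 * A + k * (1 / (R - r)) := by
    intro k f hf hM hMA h0
    refine ⟨0, Nat.zero_le _, Fin.elim0, fun i => i.elim0, fun z hz _ => ?_⟩
    have := norm_logDeriv_le_of_ne_zero hf hr' hr (fun z hz => hM z (by linarith)) hA hMA h0 hz
    simp only [Finset.univ_eq_empty, Finset.sum_empty, sub_zero]
    have : 0 ≤ (k:ℝ) * (1 / (R - r)) := by
      have : 0 < R - r := by linarith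
      positivity
    linarith
  have step : ∀ f : ℂ → ℂ, Differentiable ℂ f → (∀ z, ‖z‖ ≤ R → ‖f z‖ ≤ M) → f 0 ≠ 0 →
      ∀ ρ, ‖ρ‖ ≤ r → f ρ = 0 → ∃ g : ℂ → ℂ, Differentiable ℂ g ∧ (∀ z, ‖z‖ ≤ R → ‖g z‖ ≤ M) ∧
        ‖f 0‖ * (R / r) ≤ ‖g 0‖ ∧
        ∀ z, f z * ((R:ℂ)^2 - (starRingEnd ℂ) ρ * z) = R * (z - ρ) * g z := by
    intro f hf hM hf0 ρ hρ hfρ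
    have hρ0 : ρ ≠ 0 := by rintro rfl; exact hf0 hfρ
    have hRc : (R:ℂ) ≠ 0 := by exact_mod_cast hR0.ne'
    have hds : Differentiable ℂ (dslope f ρ) := by
      rw [← differentiableOn_univ]
      exact (Complex.differentiableOn_dslope Filter.univ_mem).mpr hf.differentiableOn
    have hfd : ∀ z, f z = (z - ρ) * dslope f ρ z := by
      intro z
      have := sub_smul_dslope f ρ z
      rw [hfρ, sub_zero, smul_eq_mul] at this
      exact this.symm
    set g : ℂ → ℂ := fun z => dslope f ρ z * (((R:ℂ)^2 - (starRingEnd ℂ) ρ * z) / R) with hg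
    have hgd : Differentiable ℂ g := by
      rw [hg]; fun_prop
    refine ⟨g, hgd, ?_, ?_, ?_⟩
    · intro z hz
      refine Complex.norm_le_of_forall_mem_frontier_norm_le (U := Metric.ball 0 R)
        Metric.isBounded_ball hgd.diffContOnCl ?_ ?_
      · intro w hw
        rw [frontier_ball _ hR0.ne', mem_sphere_zero_iff_norm] at hw
        have : ‖g w‖ = ‖f w‖ := by
          rw [hfd w, hg]
          simp only [norm_mul, norm_div, Complex.norm_real, Real.norm_eq_abs, abs_of_pos hR0]
          rw [norm_sub_eq_of_norm_eq hR0 hw, mul_comm]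
        rw [this]; exact hM w hw.le
      · rw [closure_ball _ hR0.ne']; simpa using hz
    · have : ‖f 0‖ = ‖ρ‖ * ‖dslope f ρ 0‖ := by rw [hfd 0]; simp
      rw [this, hg]
      simp only [norm_mul, norm_div, Complex.norm_real, Real.norm_eq_abs, abs_of_pos hR0, mul_zero, sub_zero, norm_pow]
      rw [div_eq_mul_inv, show R ^ 2 / R = R by field_simp]
      have : ‖ρ‖ * r⁻¹ ≤ 1 := by rw [← div_eq_mul_inv]; exact (div_le_one hr0).mpr hρ
      have h2 : 0 ≤ ‖dslope f ρ 0‖ * R := by positivity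
      nlinarith
    · intro z
      rw [hfd z, hg]
      field_simp
  induction k with
  | zero =>
    intro f hf hM hf0 hMA hMk
    refine base 0 f hf hM hMA ?_
    intro ρ hρ hfρ
    obtain ⟨g, -, hg, hg0, -⟩ := step f hf hM hf0 ρ hρ hfρ
    have h1 := hg 0 (by simpa using hR0.le)
    have : 0 < ‖f 0‖ := norm_pos_iff.mpr hf0
    simp at hMk
    nlinarith
  | succ k ih =>
    intro f hf hM hf0 hMA hMk
    by_cases h : ∀ z, ‖z‖ ≤ r → f z ≠ 0
    · exact base _ f hf hM hMA h
    push Not at h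
    obtain ⟨ρ₀, hρ₀, hfρ₀⟩ := h
    obtain ⟨g, hgd, hg, hg0, hfg⟩ := step f hf hM hf0 ρ₀ hρ₀ hfρ₀
    have hf0' : 0 < ‖f 0‖ := norm_pos_iff.mpr hf0
    have hg0' : ‖f 0‖ ≤ ‖g 0‖ := by nlinarith
    have hRc : (R:ℂ) ≠ 0 := by exact_mod_cast hR0.ne'
    have hne : ∀ z, ‖z‖ ≤ r → R * (R - r) ≤ ‖(R:ℂ)^2 - (starRingEnd ℂ) ρ₀ * z‖ := by
      intro z hz
      have h1 := norm_sub_norm_le ((R:ℂ)^2) ((starRingEnd ℂ) ρ₀ * z)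
      simp only [norm_mul, norm_pow, Complex.norm_real, Real.norm_eq_abs, abs_of_pos hR0, Complex.norm_conj] at h1
      have : ‖ρ₀‖ * ‖z‖ ≤ R * r := mul_le_mul (by linarith) hz (norm_nonneg _) hR0.le
      nlinarith
    have hne' : ∀ z, ‖z‖ ≤ r → (R:ℂ)^2 - (starRingEnd ℂ) ρ₀ * z ≠ 0 := by
      intro z hz
      have := hne z hz
      rw [← norm_pos_iff]
      have : 0 < R * (R - r) := mul_pos hR0 (by linarith)
      linarith
    obtain ⟨n, hn, ρ, hρ, hb⟩ := ih g hgd hg (norm_pos_iff.mp (by linarith))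
      (hMA.trans (by gcongr)) (hMk.trans (by
        rw [pow_succ']
        have : 0 ≤ (R / r)^k := by positivity
        nlinarith))
    refine ⟨n + 1, by omega, Fin.cons ρ₀ ρ, ?_, ?_⟩
    · intro i
      refine Fin.cases ⟨by simpa using hfρ₀, by simpa using hρ₀⟩ (fun j => ?_) i
      simp only [Fin.cons_succ]
      refine ⟨?_, (hρ j).2⟩
      have := hfg (ρ j)
      rw [(hρ j).1, mul_zero] at this
      exact (mul_eq_zero.mp this).resolve_right (hne' _ (hρ j).2)
    · intro z hz hfz
      have hzr : ‖z‖ ≤ r := by linarith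
      have hB := hne' z hzr
      have e := hfg z
      have hzρ : z - ρ₀ ≠ 0 := by
        intro h; rw [sub_eq_zero] at h; rw [h] at hfz; exact hfz hfρ₀
      have hgz : g z ≠ 0 := by
        intro h; rw [h, mul_zero] at e
        exact (mul_ne_zero hfz hB) e
      have hder : deriv f z * ((R:ℂ)^2 - (starRingEnd ℂ) ρ₀ * z) + f z * (- (starRingEnd ℂ) ρ₀)
          = R * g z + R * (z - ρ₀) * deriv g z := by
        have d1 : HasDerivAt (fun z => f z * ((R:ℂ)^2 - (starRingEnd ℂ) ρ₀ * z))
            (deriv f z * ((R:ℂ)^2 - (starRingEnd ℂ) ρ₀ * z) + f z * (- (starRingEnd ℂ) ρ₀)) z := by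
          refine (hf z).hasDerivAt.mul ?_
          simpa using ((hasDerivAt_id z).const_mul ((starRingEnd ℂ) ρ₀)).const_sub ((R:ℂ)^2)
        have d2 : HasDerivAt (fun z => (R:ℂ) * (z - ρ₀) * g z)
            (R * g z + R * (z - ρ₀) * deriv g z) z := by
          refine HasDerivAt.mul ?_ (hgd z).hasDerivAt
          simpa using ((hasDerivAt_id z).sub_const ρ₀).const_mul (R:ℂ)
        rw [funext hfg] at d1
        exact d1.unique d2
      have key : deriv f z / f z = deriv g z / g z + 1 / (z - ρ₀) +
          (starRingEnd ℂ) ρ₀ / ((R:ℂ)^2 - (starRingEnd ℂ) ρ₀ * z) := by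
        have hfz' : f z = R * (z - ρ₀) * g z / ((R:ℂ)^2 - (starRingEnd ℂ) ρ₀ * z) := by
          rw [← e]; field_simp
        have : deriv f z = (R * g z + R * (z - ρ₀) * deriv g z + f z * (starRingEnd ℂ) ρ₀) / ((R:ℂ)^2 - (starRingEnd ℂ) ρ₀ * z) := by
          rw [← hder]; field_simp; ring
        have h3 : deriv f z / f z = (R * g z + R * (z - ρ₀) * deriv g z) / (f z * ((R:ℂ)^2 - (starRingEnd ℂ) ρ₀ * z)) + (starRingEnd ℂ) ρ₀ / ((R:ℂ)^2 - (starRingEnd ℂ) ρ₀ * z) := by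
          rw [this]; field_simp
        rw [h3, e]
        congr 1
        field_simp
        ring
      rw [Fin.sum_univ_succ, key]
      simp only [Fin.cons_zero, Fin.cons_succ]
      have hlast : ‖(starRingEnd ℂ) ρ₀ / ((R:ℂ)^2 - (starRingEnd ℂ) ρ₀ * z)‖ ≤ 1 / (R - r) := by
        rw [norm_div, Complex.norm_conj]
        have : 0 < R - r := by linarith
        calc ‖ρ₀‖ / ‖(R:ℂ)^2 - (starRingEnd ℂ) ρ₀ * z‖ ≤ R / (R * (R - r)) := by
              gcongr
              · linarith
              · exact hne z hzr
          _ = 1 / (R - r) := by field_simp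
      have hbz := hb z hz hgz
      calc _ = ‖(deriv g z / g z - ∑ i, 1 / (z - ρ i)) + (starRingEnd ℂ) ρ₀ / ((R:ℂ)^2 - (starRingEnd ℂ) ρ₀ * z)‖ := by
            congr 1; ring
        _ ≤ _ := (norm_add_le _ _).trans (add_le_add hbz hlast)
        _ = _ := by push_cast; ring

lemma norm_zetaReg_two_add (t : ℝ) : 1/3 ≤ ‖zetaReg (2 + t * Complex.I)‖ := by
  set s : ℂ := 2 + t * Complex.I with hs
  have hre : s.re = 2 := by simp [hs]
  have hs1 : s ≠ 1 := by intro h; rw [h] at hre; simp at hre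
  have h1 : 1 ≤ ‖s - 1‖ := by
    have := Complex.abs_re_le_norm (s - 1)
    rw [Complex.sub_re, hre] at this
    norm_num at this; exact this
  have hz : ‖riemannZeta s - 1‖ ≤ Real.pi^2/6 - 1 := by
    have e1 := zeta_eq_tsum_one_div_nat_add_one_cpow (s := s) (by rw [hre]; norm_num)
    have hsum : HasSum (fun n : ℕ => 1 / ((n:ℝ)+1)^2) (Real.pi^2/6) := by
      have := (hasSum_nat_add_iff' (f := fun n : ℕ => 1 / (n:ℝ)^2) 1).mpr hasSum_zeta_two
      simpa using this
    have hsum' : HasSum (fun n : ℕ => 1 / ((n:ℝ)+1+1)^2) (Real.pi^2/6 - 1) := by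
      have := (hasSum_nat_add_iff' (f := fun n : ℕ => 1 / ((n:ℝ)+1)^2) 1).mpr hsum
      simpa using this
    have hn : ∀ n : ℕ, ‖1 / ((n:ℂ) + 1)^s‖ = 1 / ((n:ℝ)+1)^2 := by
      intro n
      have : ((n:ℂ) + 1) = ((n + 1 : ℕ) : ℂ) := by push_cast; rfl
      rw [norm_div, this, Complex.norm_natCast_cpow_of_pos (by omega), hre]
      norm_num
    have hS : Summable (fun n : ℕ => 1 / ((n:ℂ) + 1)^s) := by
      apply Summable.of_norm
      simp_rw [hn]; exact hsum.summable
    rw [e1, hS.tsum_eq_zero_add]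
    simp only [Nat.cast_zero, zero_add, Complex.one_cpow, div_one, add_sub_cancel_left]
    have := tsum_of_norm_bounded (f := fun n : ℕ => 1 / (((n + 1 : ℕ):ℂ) + 1)^s) hsum' (fun n => by
      rw [hn]; push_cast; rfl)
    exact this
  have h2 : 1/3 ≤ ‖riemannZeta s‖ := by
    have h3 := norm_sub_norm_le 1 (1 - riemannZeta s)
    rw [norm_sub_rev 1 (riemannZeta s)] at h3
    simp only [norm_one, sub_sub_cancel] at h3
    have : Real.pi ^ 2 < 10 := by nlinarith [Real.pi_lt_d2, Real.pi_pos]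
    linarith
  rw [zetaReg_of_ne hs1, norm_mul]
  nlinarith [norm_nonneg (riemannZeta s)]

/-- The logarithmic size `log (|t| + 5)`. -/
noncomputable def ell (t : ℝ) : ℝ := Real.log (|t| + 5)

lemma one_le_ell (t : ℝ) : 1 ≤ ell t := by
  unfold ell
  rw [Real.le_log_iff_exp_le (by positivity)]
  have := Real.exp_one_lt_d9
  have := abs_nonneg t
  linarith

lemma exists_local_zeros : ∃ C : ℝ, 0 < C ∧ ∀ t : ℝ, ∃ n : ℕ, n ≤ C * ell t ∧ ∃ ρ : Fin n → ℂ,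
    (∀ i, zetaReg (ρ i) = 0 ∧ ‖ρ i - (2 + t * Complex.I)‖ ≤ 1.7) ∧
    ∀ s : ℂ, ‖s - (2 + t * Complex.I)‖ ≤ 1.6 → zetaReg s ≠ 0 →
      ‖deriv zetaReg s / zetaReg s - ∑ i, 1 / (s - ρ i)‖ ≤ C * ell t := by
  have hlog : 0 < Real.log (1.9/1.7) := Real.log_pos (by norm_num)
  set K : ℝ := 6 / Real.log (1.9/1.7) + 1 with hK
  have hK0 : 0 < K := by positivity
  refine ⟨K + 8 * 1.7 / (1.7 - 1.6)^2 * 6 + K * (1 / (1.9 - 1.7)), by norm_num; positivity, fun t => ?_⟩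
  have hl := one_le_ell t
  set k : ℕ := ⌈6 * ell t / Real.log (1.9/1.7)⌉₊ with hk
  have hkK : (k:ℝ) ≤ K * ell t := by
    have := Nat.ceil_lt_add_one (a := 6 * ell t / Real.log (1.9/1.7)) (by positivity)
    rw [← hk] at this
    rw [hK, add_mul, one_mul, div_mul_eq_mul_div]
    linarith
  set f : ℂ → ℂ := fun w => zetaReg (2 + t * Complex.I + w) with hf
  have hfd : Differentiable ℂ f := differentiable_zetaReg.comp (by fun_prop)
  have hexp : Real.exp (6 * ell t) = (|t| + 5)^6 := by
    rw [mul_comm, Real.exp_mul, ell, Real.exp_log (by positivity)]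
    norm_cast
  have h0 : 1/3 ≤ ‖f 0‖ := by simpa [hf] using norm_zetaReg_two_add t
  have hM : ∀ z, ‖z‖ ≤ 1.9 → ‖f z‖ ≤ 11 * (|t| + 5)^2 := by
    intro z hz
    have h1 := (abs_le.mp ((Complex.abs_re_le_norm z).trans hz)).1
    refine (norm_zetaReg_le (by simp; linarith)).trans ?_
    have : ‖2 + t * Complex.I + z‖ ≤ 2 + |t| + 1.9 := by
      refine (norm_add_le _ _).trans (add_le_add ((norm_add_le _ _).trans (by simp)) hz)
    have h2 : 1 + ‖2 + t * Complex.I + z‖ ≤ |t| + 5 := by linarith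
    gcongr
  have hbig : 11 * (|t| + 5)^2 ≤ ‖f 0‖ * Real.exp (6 * ell t) := by
    rw [hexp]
    have : (625:ℝ) ≤ (|t|+5)^4 := by
      have : (5:ℝ)^4 ≤ (|t|+5)^4 := by gcongr; linarith [abs_nonneg t]
      linarith
    have h2 : (|t|+5)^6 = (|t|+5)^4 * (|t|+5)^2 := by ring
    have h3 : 0 ≤ (|t|+5)^2 := by positivity
    nlinarith [mul_nonneg (sub_nonneg.mpr this) h3, mul_nonneg (sub_nonneg.mpr h0) (show 0 ≤ (|t|+5)^6 by positivity)]
  have hpow : 11 * (|t| + 5)^2 ≤ ‖f 0‖ * (1.9/1.7)^k := by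
    refine hbig.trans ?_
    gcongr
    rw [← Real.exp_log (show (0:ℝ) < 1.9/1.7 by norm_num), ← Real.exp_nat_mul, Real.exp_le_exp]
    have := Nat.le_ceil (6 * ell t / Real.log (1.9/1.7))
    rw [div_le_iff₀ hlog] at this
    rw [hk]; simpa using this
  obtain ⟨n, hn, ρ, hρ, hb⟩ := exists_zeros_logDeriv (R := 1.9) (r := 1.7) (r' := 1.6) (A := 6 * ell t)
    (by norm_num) (by norm_num) (by norm_num) (by positivity) k f hfd hM
    (norm_pos_iff.mp (by linarith)) hbig hpow
  refine ⟨n, ?_, fun i => 2 + t * Complex.I + ρ i, fun i => ⟨(hρ i).1, by simpa using (hρ i).2⟩, ?_⟩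
  · have : (n:ℝ) ≤ k := by exact_mod_cast hn
    have h2 : 0 ≤ (8 * 1.7 / (1.7 - 1.6)^2 * 6 + K * (1 / (1.9 - 1.7))) * ell t := by
      norm_num; positivity
    linarith
  · intro s hs hz
    have := hb (s - (2 + t * Complex.I)) hs (by simpa [hf] using hz)
    have hder : deriv f (s - (2 + t * Complex.I)) = deriv zetaReg s := by
      rw [hf, deriv_comp_const_add]; simp
    rw [hder] at this
    simp only [hf, add_sub_cancel] at this
    have e : ∀ i, s - (2 + t * Complex.I) - ρ i = s - (2 + t * Complex.I + ρ i) := fun i => by ring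
    simp_rw [e] at this
    refine this.trans ?_
    have h5 : (k:ℝ) * (1 / (1.9 - 1.7)) ≤ K * ell t * (1 / (1.9 - 1.7)) := by gcongr
    nlinarith [mul_pos hK0 (show 0 < ell t by linarith)]

lemma re_of_zetaReg_eq_zero (hRH : RiemannHypothesis) {s : ℂ} (h : zetaReg s = 0) (hs : 0 < s.re) :
    s.re = 1/2 := by
  have h1 : s ≠ 1 := by rintro rfl; rw [zetaReg_one] at h; exact one_ne_zero h
  rw [zetaReg_of_ne h1] at h
  refine hRH s ((mul_eq_zero.mp h).resolve_left (sub_ne_zero.mpr h1)) ?_ h1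
  rintro ⟨n, hn⟩
  rw [hn] at hs
  have : ((-2 * (n + 1) : ℂ)).re = -2 * (n+1) := by
    have : (-2 * (n + 1) : ℂ) = ((-2 * (n+1) : ℝ) : ℂ) := by push_cast; rfl
    rw [this, Complex.ofReal_re]
  rw [this] at hs
  have : (0:ℝ) ≤ n := Nat.cast_nonneg n
  linarith

lemma zetaReg_ne_zero (hRH : RiemannHypothesis) {s : ℂ} (hs : 1/2 < s.re) : zetaReg s ≠ 0 := by
  intro h
  have := re_of_zetaReg_eq_zero hRH h (by linarith)
  linarith

/-- `-ζ'/ζ(s) - 1/(s-1)`. -/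
noncomputable def zetaF (s : ℂ) : ℂ := - (deriv zetaReg s / zetaReg s)

lemma differentiableAt_zetaF (hRH : RiemannHypothesis) {s : ℂ} (hs : 1/2 < s.re) :
    DifferentiableAt ℂ zetaF s :=
  ((differentiable_zetaReg.deriv s).div (differentiable_zetaReg s) (zetaReg_ne_zero hRH hs)).neg

lemma exists_norm_zetaF_le (hRH : RiemannHypothesis) : ∃ C : ℝ, 0 < C ∧ ∀ δ : ℝ, 0 < δ → δ ≤ 1 →
    ∀ s : ℂ, 1/2 + δ ≤ s.re → s.re ≤ 2 → ‖zetaF s‖ ≤ C * ell s.im / δ := by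
  obtain ⟨C, hC, h⟩ := exists_local_zeros
  refine ⟨2 * C, by positivity, fun δ hδ hδ1 s hs hs2 => ?_⟩
  obtain ⟨n, hn, ρ, hρ, hb⟩ := h s.im
  have e : s - (2 + s.im * Complex.I) = ((s.re - 2 : ℝ) : ℂ) := by
    apply Complex.ext <;> simp
  have hb' := hb s (by
    rw [e, Complex.norm_real, Real.norm_eq_abs, abs_le]; constructor <;> linarith) (zetaReg_ne_zero hRH (by linarith))
  have hsum : ‖∑ i, 1 / (s - ρ i)‖ ≤ n * (1/δ) := by
    refine (norm_sum_le _ _).trans ?_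
    refine (Finset.sum_le_card_nsmul _ _ (1/δ) (fun i _ => ?_)).trans (by simp)
    rw [norm_div, norm_one]
    have h1 : (ρ i).re = 1/2 := by
      refine re_of_zetaReg_eq_zero hRH (hρ i).1 ?_
      have := (abs_le.mp ((Complex.abs_re_le_norm _).trans (hρ i).2)).1
      simp at this; linarith
    have h2 := Complex.abs_re_le_norm (s - ρ i)
    rw [Complex.sub_re, h1] at h2
    have := le_abs_self (s.re - 1/2)
    gcongr
    linarith
  have : ‖zetaF s‖ ≤ C * ell s.im + n * (1/δ) := by
    rw [zetaF, norm_neg]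
    calc _ = ‖(deriv zetaReg s / zetaReg s - ∑ i, 1 / (s - ρ i)) + ∑ i, 1 / (s - ρ i)‖ := by ring_nf
      _ ≤ _ := (norm_add_le _ _).trans (add_le_add hb' hsum)
  have hl := one_le_ell s.im
  have h3 : (n:ℝ) * (1/δ) ≤ C * ell s.im * (1/δ) := by gcongr
  have h4 : 1 ≤ 1/δ := by rw [le_div_iff₀ hδ]; linarith
  have h5 : C * ell s.im ≤ C * ell s.im * (1/δ) := le_mul_of_one_le_right (by positivity) h4
  calc _ ≤ _ := this
    _ ≤ C * ell s.im * (1/δ) + C * ell s.im * (1/δ) := by linarith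
    _ = _ := by ring

/-- Absolute value of the real part of `zetaF` on the line `Re s = 1/2 + δ`. -/
noncomputable def absReF (δ τ : ℝ) : ℝ := |(zetaF (1/2 + δ + τ * Complex.I)).re|

lemma absReF_nonneg (δ τ : ℝ) : 0 ≤ absReF δ τ := abs_nonneg _

lemma continuous_zetaF_line (hRH : RiemannHypothesis) {σ : ℝ} (hσ : 1/2 < σ) :
    Continuous (fun τ : ℝ => zetaF (σ + τ * Complex.I)) := by
  rw [continuous_iff_continuousAt]
  intro τ
  refine ContinuousAt.comp (f := fun τ : ℝ => (σ + τ * Complex.I : ℂ)) (g := zetaF) ?_ (by fun_prop)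
  exact (differentiableAt_zetaF hRH (by simpa using hσ)).continuousAt

lemma continuous_absReF (hRH : RiemannHypothesis) {δ : ℝ} (hδ : 0 < δ) : Continuous (absReF δ) := by
  have := continuous_zetaF_line hRH (σ := 1/2 + δ) (by linarith)
  unfold absReF
  push_cast at this
  exact (Complex.continuous_re.comp this).abs

lemma integral_poisson_le {δ γ a b : ℝ} (hδ : 0 < δ) :
    ∫ τ in a..b, δ / (δ^2 + (τ - γ)^2) ≤ Real.pi := by
  have hd : ∀ τ ∈ Set.uIcc a b, HasDerivAt (fun τ => Real.arctan ((τ - γ)/δ)) (δ / (δ^2 + (τ - γ)^2)) τ := by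
    intro τ _
    have := (((hasDerivAt_id τ).sub_const γ).div_const δ).arctan
    refine this.congr_deriv ?_
    have : 1 + ((τ - γ)/δ)^2 ≠ 0 := by positivity
    have : δ^2 + (τ - γ)^2 ≠ 0 := by positivity
    simp only [id_eq]
    field_simp
  rw [intervalIntegral.integral_eq_sub_of_hasDerivAt hd]
  · have h1 := Real.arctan_lt_pi_div_two ((b - γ)/δ)
    have h2 := Real.neg_pi_div_two_lt_arctan ((a - γ)/δ)
    linarith
  · apply Continuous.intervalIntegrable
    refine continuous_const.div (by fun_prop) (fun τ => by positivity)

lemma exists_integral_absReF_le (hRH : RiemannHypothesis) : ∃ C : ℝ, 0 < C ∧ ∀ δ : ℝ, 0 < δ → δ ≤ 1/4 →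
    ∀ t : ℝ, ∫ τ in (t - 1/2)..(t + 1/2), absReF δ τ ≤ C * ell t := by
  obtain ⟨C, hC, h⟩ := exists_local_zeros
  refine ⟨C + C * Real.pi, by positivity, fun δ hδ hδ1 t => ?_⟩
  obtain ⟨n, hn, ρ, hρ, hb⟩ := h t
  have hl := one_le_ell t
  have hρ1 : ∀ i, (ρ i).re = 1/2 := by
    intro i
    refine re_of_zetaReg_eq_zero hRH (hρ i).1 ?_
    have := (abs_le.mp ((Complex.abs_re_le_norm _).trans (hρ i).2)).1
    simp at this; linarith
  have hpt : ∀ τ ∈ Set.Icc (t - 1/2) (t + 1/2), absReF δ τ ≤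
      C * ell t + ∑ i, δ / (δ^2 + (τ - (ρ i).im)^2) := by
    intro τ hτ
    set s : ℂ := 1/2 + δ + τ * Complex.I with hs
    have hsre : s.re = 1/2 + δ := by simp [hs]
    have hsim : s.im = τ := by simp [hs]
    have hnorm : ‖s - (2 + t * Complex.I)‖ ≤ 1.6 := by
      rw [← sq_le_sq₀ (norm_nonneg _) (by norm_num), Complex.sq_norm, Complex.normSq_apply]
      have e1 : (s - (2 + t * Complex.I)).re = δ - 3/2 := by simp [hs]; ring
      have e2 : (s - (2 + t * Complex.I)).im = τ - t := by simp [hs]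
      rw [e1, e2]
      have := hτ.1; have := hτ.2
      nlinarith
    have h1 := hb s hnorm (zetaReg_ne_zero hRH (by rw [hsre]; linarith))
    have h2 := (Complex.abs_re_le_norm _).trans h1
    have h3 : (∑ i, 1 / (s - ρ i)).re = ∑ i, δ / (δ^2 + (τ - (ρ i).im)^2) := by
      rw [Complex.re_sum]
      refine Finset.sum_congr rfl (fun i _ => ?_)
      rw [one_div, Complex.inv_re, Complex.normSq_apply, Complex.sub_re, Complex.sub_im, hsre, hsim, hρ1]
      ring_nf
    rw [Complex.sub_re, h3] at h2
    have h4 : 0 ≤ ∑ i, δ / (δ^2 + (τ - (ρ i).im)^2) := Finset.sum_nonneg (fun i _ => by positivity)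
    have : absReF δ τ = |(deriv zetaReg s / zetaReg s).re| := by
      unfold absReF; rw [← hs, zetaF, Complex.neg_re, abs_neg]
    rw [this]
    rw [abs_le] at h2 ⊢
    constructor <;> linarith [h2.1, h2.2]
  have hci : ∀ i, Continuous (fun τ : ℝ => δ / (δ^2 + (τ - (ρ i).im)^2)) := fun i =>
    continuous_const.div (by fun_prop) (fun τ => by positivity)
  have hI : ∀ i, IntervalIntegrable (fun τ : ℝ => δ / (δ^2 + (τ - (ρ i).im)^2)) MeasureTheory.volume (t-1/2) (t+1/2) :=
    fun i => (hci i).intervalIntegrable _ _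
  calc _ ≤ ∫ τ in (t - 1/2)..(t + 1/2), (C * ell t + ∑ i, δ / (δ^2 + (τ - (ρ i).im)^2)) := by
        refine intervalIntegral.integral_mono_on (by linarith) ((continuous_absReF hRH hδ).intervalIntegrable _ _) ?_ hpt
        apply Continuous.intervalIntegrable
        exact continuous_const.add (continuous_finsetSum _ (fun i _ => hci i))
    _ = C * ell t + ∑ i, ∫ τ in (t - 1/2)..(t + 1/2), δ / (δ^2 + (τ - (ρ i).im)^2) := by
        rw [intervalIntegral.integral_add (by simp) ((continuous_finsetSum _ (fun i _ => hci i)).intervalIntegrable _ _),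
          intervalIntegral.integral_finsetSum (fun i _ => hI i)]
        simp; left; ring
    _ ≤ C * ell t + n * Real.pi := by
        gcongr
        refine (Finset.sum_le_card_nsmul _ _ Real.pi (fun i _ => integral_poisson_le hδ)).trans (by simp)
    _ ≤ C * ell t + C * ell t * Real.pi := by gcongr
    _ = _ := by ring

lemma vadd_norm_lower {a : ℝ} (τ : ℝ) : a^2 + τ^2 = ‖(a + τ * Complex.I : ℂ)‖^2 := by
  rw [Complex.sq_norm, Complex.normSq_apply]; simp; ring

lemma integrable_inv_sq_add_sq {a : ℝ} (ha : 0 < a) : MeasureTheory.Integrable (fun τ : ℝ => 1 / (a^2 + τ^2)) := by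
  have h := (integrable_inv_one_add_sq.comp_div ha.ne').const_mul (1/a^2)
  convert h using 2 with τ
  field_simp

lemma mellin_pos_log {s : ℂ} (hs : 0 < s.re) :
    mellin (fun t : ℝ => ((max (-Real.log t) 0 : ℝ) : ℂ)) s = 1 / s^2 ∧
    MellinConvergent (fun t : ℝ => ((max (-Real.log t) 0 : ℝ) : ℂ)) s := by
  set f₁ : ℝ → ℂ := Set.indicator (Set.Ioc 0 1) (fun _ => (1:ℂ)) with hf₁
  have hloc : MeasureTheory.LocallyIntegrableOn f₁ (Set.Ioi 0) := by
    have : MeasureTheory.Integrable f₁ := by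
      rw [hf₁, MeasureTheory.integrable_indicator_iff measurableSet_Ioc]
      simp
    exact this.locallyIntegrable.locallyIntegrableOn _
  have htop : f₁ =O[atTop] (fun t : ℝ => t ^ (-(s.re + 1))) := by
    have : f₁ =ᶠ[atTop] 0 := by
      filter_upwards [Filter.eventually_gt_atTop 1] with t ht
      exact Set.indicator_of_notMem (by simp [ht]) _
    exact this.trans_isBigO (isBigO_zero _ _)
  have hbot : f₁ =O[nhdsWithin 0 (Set.Ioi 0)] (fun t : ℝ => t ^ (-(0:ℝ))) := by
    simp only [neg_zero, Real.rpow_zero]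
    refine isBigO_of_le _ (fun x => ?_)
    rw [hf₁, Set.indicator_apply]
    split_ifs <;> simp
  have hd := mellin_hasDerivAt_of_isBigO_rpow hloc htop (lt_add_one _) hbot hs
  have he : ∀ t ∈ Set.Ioi (0:ℝ), ((max (-Real.log t) 0 : ℝ) : ℂ) = -((Real.log t : ℝ) • f₁ t) := by
    intro t ht
    by_cases h : t ≤ 1
    · have h1 : f₁ t = 1 := by rw [hf₁, Set.indicator_of_mem (show t ∈ Set.Ioc (0:ℝ) 1 from ⟨ht, h⟩)]
      rw [h1, max_eq_left (by have := Real.log_nonpos (le_of_lt ht) h; linarith)]; simp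
    · have h1 : f₁ t = 0 := by rw [hf₁, Set.indicator_of_notMem (by simp at h ⊢; intro _; exact h)]
      rw [h1, max_eq_right (by have := Real.log_nonneg (not_le.mp h).le; linarith)]; simp
  constructor
  · have e1 : mellin (fun t : ℝ => ((max (-Real.log t) 0 : ℝ) : ℂ)) s = - mellin (fun t => Real.log t • f₁ t) s := by
      unfold mellin
      rw [← MeasureTheory.integral_neg]
      refine MeasureTheory.setIntegral_congr_fun measurableSet_Ioi (fun t ht => ?_)
      simp only
      rw [he t ht, smul_neg]
    have hd2 : HasDerivAt (fun z : ℂ => 1 / z) (mellin (fun t => Real.log t • f₁ t) s) s := by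
      refine hd.2.congr_of_eventuallyEq ?_
      filter_upwards [(isOpen_lt continuous_const Complex.continuous_re).mem_nhds hs] with z hz
      exact (hasMellin_one_Ioc hz).2.symm
    have h0 : s ≠ 0 := by rintro rfl; simp at hs
    have hd3 := hasDerivAt_inv h0
    simp only [one_div] at hd2
    rw [e1, hd2.unique hd3]
    simp
  · have := hd.1.neg
    refine MeasureTheory.IntegrableOn.congr_fun this (fun t ht => ?_) measurableSet_Ioi
    simp only [Pi.neg_apply]
    rw [he t ht, smul_neg]

lemma norm_cexp_div_sq {a : ℝ} (y τ : ℝ) :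
    ‖Complex.exp ((a + τ * Complex.I) * y) / (a + τ * Complex.I)^2‖ = Real.exp (a * y) * (1 / (a^2 + τ^2)) := by
  rw [norm_div, Complex.norm_exp, norm_pow, ← vadd_norm_lower]
  simp; ring_nf

lemma line_ne_zero {a : ℝ} (ha : 0 < a) (τ : ℝ) : (a + τ * Complex.I : ℂ) ≠ 0 := by
  intro h
  have := congrArg Complex.re h
  simp at this
  linarith

lemma continuous_kernel {a : ℝ} (ha : 0 < a) (y : ℝ) :
    Continuous (fun τ : ℝ => Complex.exp ((a + τ * Complex.I) * y) / (a + τ * Complex.I)^2) := by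
  refine Continuous.div (by fun_prop) (by fun_prop) (fun τ => pow_ne_zero _ (line_ne_zero ha τ))

lemma integral_kernel {a : ℝ} (ha : 0 < a) (y : ℝ) :
    ∫ τ : ℝ, Complex.exp ((a + τ * Complex.I) * y) / (a + τ * Complex.I)^2 = 2 * Real.pi * (max y 0 : ℝ) := by
  set f : ℝ → ℂ := fun t : ℝ => ((max (-Real.log t) 0 : ℝ) : ℂ) with hf
  have hm : ∀ τ : ℝ, mellin f (a + τ * Complex.I) = 1 / (a + τ * Complex.I)^2 := fun τ =>
    (mellin_pos_log (by simpa using ha)).1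
  have hv : Complex.VerticalIntegrable (mellin f) a := by
    unfold Complex.VerticalIntegrable
    simp_rw [hm]
    refine (integrable_inv_sq_add_sq ha).mono' ?_ ?_
    · refine Continuous.aestronglyMeasurable ?_
      refine Continuous.div (by fun_prop) (by fun_prop) (fun τ => pow_ne_zero _ (line_ne_zero ha τ))
    · filter_upwards with τ
      rw [norm_div, norm_pow, ← vadd_norm_lower]; simp
  have hc : ContinuousAt f (Real.exp (-y)) := by
    have : ContinuousAt (fun t : ℝ => max (-Real.log t) 0) (Real.exp (-y)) :=
      ((Real.continuousAt_log (Real.exp_pos _).ne').neg).max continuousAt_const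
    exact Complex.continuous_ofReal.continuousAt.comp this
  have := mellinInv_mellin_eq a f (Real.exp_pos (-y)) (mellin_pos_log (by simpa using ha)).2 hv hc
  unfold mellinInv at this
  simp_rw [hm] at this
  have e : ∀ τ : ℝ, ((Real.exp (-y) : ℝ) : ℂ) ^ (-(a + τ * Complex.I)) • (1 / (a + τ * Complex.I)^2)
      = Complex.exp ((a + τ * Complex.I) * y) / (a + τ * Complex.I)^2 := by
    intro τ
    rw [Complex.cpow_def_of_ne_zero (by exact_mod_cast (Real.exp_pos _).ne'), ← Complex.ofReal_log (Real.exp_pos _).le,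
      Real.log_exp, smul_eq_mul, mul_one_div]
    congr 2
    push_cast; ring
  simp_rw [e] at this
  have h2 : f (Real.exp (-y)) = (max y 0 : ℝ) := by simp [hf]
  rw [h2] at this
  rw [← this]
  have : (Real.pi : ℂ) ≠ 0 := by exact_mod_cast Real.pi_ne_zero
  rw [Complex.real_smul, ← mul_assoc]
  push_cast
  rw [mul_one_div_cancel (by simp), one_mul]

open MeasureTheory in
lemma integral_laplace_kernel {Ω : Type*} [MeasurableSpace Ω] (μ : Measure Ω) [SFinite μ]
    {W lam : Ω → ℝ} (hW : Measurable W) (hlam : Measurable lam) {a : ℝ} (ha : 0 < a)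
    (hi : Integrable (fun ω => W ω * Real.exp (-(a * lam ω))) μ) (y : ℝ) :
    ∫ τ : ℝ, (∫ ω, W ω * Complex.exp (-((a + τ * Complex.I) * lam ω)) ∂μ) *
      (Complex.exp ((a + τ * Complex.I) * y) / (a + τ * Complex.I)^2) =
    2 * Real.pi * ∫ ω, (W ω * (max (y - lam ω) 0 : ℝ) : ℂ) ∂μ ∧
    Integrable (fun τ : ℝ => (∫ ω, W ω * Complex.exp (-((a + τ * Complex.I) * lam ω)) ∂μ) *
      (Complex.exp ((a + τ * Complex.I) * y) / (a + τ * Complex.I)^2)) := by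
  have hker : ∀ (τ : ℝ) (ω : Ω), W ω * Complex.exp (-((a + τ * Complex.I) * lam ω)) *
      (Complex.exp ((a + τ * Complex.I) * y) / (a + τ * Complex.I)^2) =
      W ω * (Complex.exp ((a + τ * Complex.I) * (y - lam ω : ℝ)) / (a + τ * Complex.I)^2) := by
    intro τ ω
    rw [mul_assoc, ← mul_div_assoc, ← Complex.exp_add]
    congr 4
    push_cast; ring
  have hInt : Integrable (Function.uncurry fun (τ : ℝ) (ω : Ω) =>
      (W ω : ℂ) * (Complex.exp ((a + τ * Complex.I) * (y - lam ω : ℝ)) / (a + τ * Complex.I)^2))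
      (volume.prod μ) := by
    have h1 := (((integrable_inv_sq_add_sq ha).const_mul (Real.exp (a * y))).mul_prod hi.norm)
    refine h1.mono' ?_ ?_
    · refine Measurable.aestronglyMeasurable ?_
      refine Measurable.mul (by fun_prop) (Measurable.div (by fun_prop) (by fun_prop))
    · filter_upwards with p
      simp only [Function.uncurry]
      rw [norm_mul, norm_cexp_div_sq, Complex.norm_real, norm_mul, Real.norm_of_nonneg (Real.exp_pos _).le, mul_sub, sub_eq_add_neg, Real.exp_add]
      apply le_of_eq; ring
  have heq : ∀ τ : ℝ, (∫ ω, W ω * Complex.exp (-((a + τ * Complex.I) * lam ω)) ∂μ) *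
      (Complex.exp ((a + τ * Complex.I) * y) / (a + τ * Complex.I)^2) =
      ∫ ω, (W ω : ℂ) * (Complex.exp ((a + τ * Complex.I) * (y - lam ω : ℝ)) / (a + τ * Complex.I)^2) ∂μ := by
    intro τ
    rw [← integral_mul_const]
    exact integral_congr_ae (Eventually.of_forall fun ω => hker τ ω)
  simp_rw [heq]
  refine ⟨?_, hInt.integral_prod_left⟩
  rw [integral_integral_swap hInt, ← integral_const_mul]
  refine integral_congr_ae (Eventually.of_forall fun ω => ?_)
  simp only
  rw [integral_const_mul, integral_kernel ha]
  ring

open MeasureTheory in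
lemma integrable_vonMangoldt_exp {a : ℝ} (ha : 1 < a) :
    Integrable (fun n : ℕ => ArithmeticFunction.vonMangoldt n * Real.exp (-(a * Real.log n))) Measure.count := by
  rw [integrable_count_iff]
  have h := ArithmeticFunction.LSeriesSummable_vonMangoldt (s := (a:ℂ)) (by simpa using ha)
  rw [LSeriesSummable, ← summable_norm_iff] at h
  refine h.congr (fun n => ?_)
  rcases Nat.eq_zero_or_pos n with rfl | hn
  · simp
  · have hn' : (0:ℝ) < n := by exact_mod_cast hn
    rw [LSeries.term_of_ne_zero hn.ne', norm_div, Complex.norm_natCast_cpow_of_pos hn, norm_mul,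
      Real.norm_of_nonneg (Real.exp_pos _).le, Complex.norm_real, Complex.ofReal_re,
      Real.rpow_def_of_pos hn', Real.exp_neg, div_eq_mul_inv, mul_comm a]

open MeasureTheory in
lemma integrable_exp_log {a : ℝ} (ha : 1 < a) :
    Integrable (fun u : ℝ => (1:ℝ) * Real.exp (-(a * Real.log u))) (volume.restrict (Set.Ioi 1)) := by
  have h : IntegrableOn (fun u : ℝ => u ^ (-a)) (Set.Ioi 1) := integrableOn_Ioi_rpow_of_lt (by linarith) one_pos
  refine IntegrableOn.congr_fun h (fun u hu => ?_) measurableSet_Ioi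
  have hu0 : (0:ℝ) < u := lt_trans one_pos hu
  simp only [one_mul]
  rw [Real.rpow_def_of_pos hu0]
  congr 1; ring

open MeasureTheory in
lemma zetaF_eq_integral {s : ℂ} (hs : 1 < s.re) :
    zetaF s = (∫ n : ℕ, (ArithmeticFunction.vonMangoldt n : ℂ) * Complex.exp (-(s * Real.log n)) ∂Measure.count) -
      ∫ u in Set.Ioi (1:ℝ), ((1:ℝ):ℂ) * Complex.exp (-(s * Real.log u)) := by
  have hs1 : s ≠ 1 := by rintro rfl; simp at hs
  have hs1' : s - 1 ≠ 0 := sub_ne_zero.mpr hs1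
  have hz : riemannZeta s ≠ 0 := riemannZeta_ne_zero_of_one_le_re hs.le
  have e1 : (∫ n : ℕ, (ArithmeticFunction.vonMangoldt n : ℂ) * Complex.exp (-(s * Real.log n)) ∂Measure.count) =
      - deriv riemannZeta s / riemannZeta s := by
    rw [← ArithmeticFunction.LSeries_vonMangoldt_eq_deriv_riemannZeta_div hs, LSeries]
    have ht : ∀ n : ℕ, (ArithmeticFunction.vonMangoldt n : ℂ) * Complex.exp (-(s * Real.log n)) =
        LSeries.term (fun n => (ArithmeticFunction.vonMangoldt n : ℂ)) s n := by
      intro n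
      rcases Nat.eq_zero_or_pos n with rfl | hn
      · simp
      · have hn' : (n:ℂ) ≠ 0 := by exact_mod_cast hn.ne'
        rw [LSeries.term_of_ne_zero hn.ne', Complex.cpow_def_of_ne_zero hn', Complex.exp_neg, ← Complex.natCast_log, mul_comm s]
        rfl
    simp_rw [ht]
    rw [integral_countable]
    · simp [Measure.real]
    · rw [integrable_count_iff, summable_norm_iff]
      exact ArithmeticFunction.LSeriesSummable_vonMangoldt hs
  have e2 : ∫ u in Set.Ioi (1:ℝ), ((1:ℝ):ℂ) * Complex.exp (-(s * Real.log u)) = 1 / (s - 1) := by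
    have : ∫ u in Set.Ioi (1:ℝ), ((1:ℝ):ℂ) * Complex.exp (-(s * Real.log u)) = ∫ t in Set.Ioi (1 : ℝ), (t:ℂ) ^ (-s) := by
      refine setIntegral_congr_fun measurableSet_Ioi (fun u hu => ?_)
      have hu0 : (0:ℝ) < u := lt_trans one_pos hu
      simp only [Complex.ofReal_one, one_mul]
      rw [Complex.cpow_def_of_ne_zero (by exact_mod_cast hu0.ne'), Complex.ofReal_log hu0.le]
      congr 1; ring
    rw [this, integral_Ioi_cpow_of_lt (by simpa using hs) one_pos]
    simp only [Complex.ofReal_one, Complex.one_cpow]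
    have : -s + 1 = -(s-1) := by ring
    rw [this]; field_simp
  rw [e1, e2, zetaF]
  have hd : HasDerivAt zetaReg (1 * riemannZeta s + (s - 1) * deriv riemannZeta s) s := by
    have h1 : HasDerivAt (fun s => (s - 1) * riemannZeta s) (1 * riemannZeta s + (s - 1) * deriv riemannZeta s) s :=
      ((hasDerivAt_id s).sub_const 1).mul (differentiableAt_riemannZeta hs1).hasDerivAt
    refine h1.congr_of_eventuallyEq ?_
    filter_upwards [isOpen_ne.mem_nhds hs1] with z hz
    exact zetaReg_of_ne hz
  rw [hd.deriv, zetaReg_of_ne hs1]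
  field_simp
  ring

open MeasureTheory in
lemma integral_line_eq_of_differentiable {G : ℂ → ℂ} {a b K : ℝ} (hab : a ≤ b)
    (hG : ∀ s : ℂ, a ≤ s.re → s.re ≤ b → DifferentiableAt ℂ G s)
    (hK : ∀ s : ℂ, a ≤ s.re → s.re ≤ b → ‖G s‖ ≤ K * (1 + |s.im|) ^ (-(3/2:ℝ))) :
    ∫ τ : ℝ, G (a + τ * Complex.I) = ∫ τ : ℝ, G (b + τ * Complex.I) ∧
    ∀ σ, a ≤ σ → σ ≤ b → Integrable (fun τ : ℝ => G (σ + τ * Complex.I)) := by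
  have hInt : ∀ σ, a ≤ σ → σ ≤ b → Integrable (fun τ : ℝ => G (σ + τ * Complex.I)) := by
    intro σ h1 h2
    have hi : Integrable (fun τ : ℝ => K * (1 + ‖τ‖) ^ (-(3/2:ℝ))) :=
      (integrable_one_add_norm (by norm_num)).const_mul K
    refine hi.mono' ?_ ?_
    · refine Continuous.aestronglyMeasurable ?_
      rw [continuous_iff_continuousAt]
      intro τ
      refine ContinuousAt.comp (f := fun τ : ℝ => (σ + τ * Complex.I : ℂ)) (g := G) ?_ (by fun_prop)
      exact (hG _ (by simpa using h1) (by simpa using h2)).continuousAt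
    · filter_upwards with τ
      simpa using hK (σ + τ * Complex.I) (by simpa using h1) (by simpa using h2)
  refine ⟨?_, hInt⟩
  have hdec : Tendsto (fun T : ℝ => K * (1 + |T|) ^ (-(3/2:ℝ))) atTop (nhds 0) := by
    rw [← mul_zero K]
    refine Tendsto.const_mul K ?_
    refine (tendsto_rpow_neg_atTop (by norm_num : (0:ℝ) < 3/2)).comp ?_
    exact tendsto_atTop_add_const_left _ _ tendsto_abs_atTop_atTop
  have hbd : ∀ T : ℝ, ‖∫ x in a..b, G (x + T * Complex.I)‖ ≤ K * (1 + |T|) ^ (-(3/2:ℝ)) * |b - a| := by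
    intro T
    refine intervalIntegral.norm_integral_le_of_norm_le_const (fun x hx => ?_)
    rw [Set.uIoc_of_le hab] at hx
    simpa using hK (x + T * Complex.I) (by simpa using hx.1.le) (by simpa using hx.2)
  have hz : Tendsto (fun T : ℝ => K * (1 + |T|) ^ (-(3/2:ℝ)) * |b - a|) atTop (nhds 0) := by
    simpa using hdec.mul_const |b - a|
  have t1 : Tendsto (fun T : ℝ => ∫ x in a..b, G (x + (-T : ℝ) * Complex.I)) atTop (nhds 0) :=
    squeeze_zero_norm (fun T => by simpa using hbd (-T)) hz
  have t2 : Tendsto (fun T : ℝ => ∫ x in a..b, G (x + T * Complex.I)) atTop (nhds 0) :=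
    squeeze_zero_norm hbd hz
  have t3 : ∀ σ, a ≤ σ → σ ≤ b → Tendsto (fun T : ℝ => ∫ τ in (-T)..T, G (σ + τ * Complex.I)) atTop
      (nhds (∫ τ : ℝ, G (σ + τ * Complex.I))) := fun σ h1 h2 =>
    intervalIntegral_tendsto_integral (hInt σ h1 h2) tendsto_neg_atTop_atBot tendsto_id
  have hrect : ∀ T : ℝ, (∫ x in a..b, G (x + (-T : ℝ) * Complex.I)) - (∫ x in a..b, G (x + T * Complex.I)) +
      Complex.I • (∫ τ in (-T)..T, G (b + τ * Complex.I)) -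
      Complex.I • (∫ τ in (-T)..T, G (a + τ * Complex.I)) = 0 := by
    intro T
    have := Complex.integral_boundary_rect_eq_zero_of_differentiableOn G (a + (-T:ℝ) * Complex.I) (b + T * Complex.I)
      (by
        intro z hz
        rw [Complex.mem_reProdIm] at hz
        have h1 := hz.1
        simp only [Complex.add_re, Complex.ofReal_re, Complex.mul_re, Complex.I_re, mul_zero, Complex.ofReal_im, Complex.I_im, mul_one, sub_self, add_zero] at h1
        rw [Set.uIcc_of_le hab] at h1
        exact (hG z h1.1 h1.2).differentiableWithinAt)
    simpa using this
  have hlim := ((t1.sub t2).add ((t3 b hab le_rfl).const_smul Complex.I)).sub ((t3 a le_rfl hab).const_smul Complex.I)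
  have h0 := tendsto_nhds_unique (hlim.congr hrect) tendsto_const_nhds
  simp only [sub_zero, zero_add, smul_eq_mul] at h0
  exact mul_left_cancel₀ Complex.I_ne_zero (sub_eq_zero.mp h0).symm

lemma ell_le_sqrt (t : ℝ) : ell t ≤ 6 * (1 + |t|) ^ (1/2:ℝ) := by
  unfold ell
  have h0 := abs_nonneg t
  have h1 : Real.log (|t| + 5) ≤ 2 * (|t| + 5) ^ (1/2:ℝ) := by
    have := Real.log_le_rpow_div (x := |t| + 5) (ε := 1/2) (by positivity) (by norm_num)
    linarith
  have h2 : (|t| + 5) ^ (1/2:ℝ) ≤ (9 * (1 + |t|)) ^ (1/2:ℝ) := by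
    gcongr; linarith
  rw [Real.mul_rpow (by norm_num) (by positivity)] at h2
  have : (9:ℝ) ^ (1/2:ℝ) = 3 := by
    rw [show (9:ℝ) = 3^(2:ℝ) by norm_num, ← Real.rpow_mul (by norm_num)]; norm_num
  rw [this] at h2
  linarith

/-- The first Riesz mean `∑ Λ(n) (y - log n)₊ - ∫₁^∞ (y - log u)₊ du`. -/
noncomputable def rieszE (y : ℝ) : ℝ :=
  (∫ n : ℕ, ArithmeticFunction.vonMangoldt n * max (y - Real.log n) 0 ∂MeasureTheory.Measure.count) -
    ∫ u in Set.Ioi (1:ℝ), max (y - Real.log u) 0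

lemma sq_add_sq_lower {δ σ : ℝ} (hδ : 0 < δ) (hδ1 : δ ≤ 1) (hσ : δ ≤ σ) (τ : ℝ) :
    1 / (σ^2 + τ^2) ≤ 2 / δ^2 * (1 + |τ|) ^ (-2:ℝ) := by
  have h0 := abs_nonneg τ
  rw [Real.rpow_neg (by positivity), show (2:ℝ) = ((2:ℕ):ℝ) by norm_num, Real.rpow_natCast]
  rw [← div_eq_mul_inv, div_div, div_le_div_iff₀ (by nlinarith [sq_nonneg τ]) (by positivity)]
  have : τ^2 = |τ|^2 := (sq_abs τ).symm
  rw [this]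
  push_cast
  nlinarith [mul_self_nonneg (1 - |τ|), mul_pos hδ hδ, mul_nonneg (sub_nonneg.2 hσ) (sub_nonneg.2 hσ), mul_nonneg (sub_nonneg.2 hσ) hδ.le,
    mul_nonneg (show 0 ≤ 1 - δ^2 by nlinarith) (sq_nonneg (|τ|)), mul_nonneg (sq_nonneg δ) (mul_self_nonneg (1 - |τ|))]

lemma norm_kernel_le {δ B : ℝ} (hδ : 0 < δ) (hδ1 : δ ≤ 1) {z s : ℂ} (hs : δ ≤ s.re) (hs2 : s.re ≤ 2)
    (hB : 0 ≤ B) (hz : ‖z‖ ≤ B * ell s.im / δ) {y : ℝ} (hy : 0 ≤ y) :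
    ‖z * (Complex.exp (s * y) / s^2)‖ ≤ B * 6 / δ * Real.exp (2 * y) * (2 / δ^2) * (1 + |s.im|) ^ (-(3/2:ℝ)) := by
  have e : s = (s.re:ℂ) + s.im * Complex.I := (Complex.re_add_im s).symm
  have h1 : ‖Complex.exp (s * y) / s^2‖ = Real.exp (s.re * y) * (1 / (s.re^2 + s.im^2)) := by
    conv_lhs => rw [e]
    exact norm_cexp_div_sq y s.im
  have h2 := sq_add_sq_lower hδ hδ1 hs s.im
  have h3 := ell_le_sqrt s.im
  rw [norm_mul, h1]
  have e2 : (1 + |s.im|) ^ (-(3/2:ℝ)) = (1 + |s.im|) ^ (1/2:ℝ) * (1 + |s.im|) ^ (-2:ℝ) := by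
    rw [← Real.rpow_add (by positivity)]; norm_num
  have h4 : Real.exp (s.re * y) ≤ Real.exp (2 * y) := by gcongr
  have h5 : ‖z‖ ≤ B * (6 * (1 + |s.im|) ^ (1/2:ℝ)) / δ := hz.trans (by gcongr)
  calc _ ≤ (B * (6 * (1 + |s.im|) ^ (1/2:ℝ)) / δ) * (Real.exp (2 * y) * (2 / δ^2 * (1 + |s.im|) ^ (-2:ℝ))) := by
        gcongr
    _ = _ := by rw [e2]; ring

open MeasureTheory in
lemma integral_zetaF_kernel (hRH : RiemannHypothesis) {δ : ℝ} (hδ : 0 < δ) (hδ4 : δ ≤ 1/4) {y : ℝ} (hy : 0 ≤ y) :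
    (∫ τ : ℝ, zetaF (1/2 + δ + τ * Complex.I) * (Complex.exp ((1/2 + δ + τ * Complex.I) * y) / (1/2 + δ + τ * Complex.I)^2)
      = (2 * Real.pi * (rieszE y : ℝ) : ℂ)) ∧
    Integrable (fun τ : ℝ => zetaF (1/2 + δ + τ * Complex.I) * (Complex.exp ((1/2 + δ + τ * Complex.I) * y) / (1/2 + δ + τ * Complex.I)^2)) := by
  obtain ⟨C, hC, hF⟩ := exists_norm_zetaF_le hRH
  have hshift := integral_line_eq_of_differentiable (G := fun s => zetaF s * (Complex.exp (s * y) / s^2))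
    (a := 1/2 + δ) (b := 1 + δ) (K := C * 6 / δ * Real.exp (2 * y) * (2 / δ^2)) (by linarith)
    (by
      intro s h1 h2
      have hs0 : s ≠ 0 := by rintro rfl; simp at h1; linarith
      refine (differentiableAt_zetaF hRH (by linarith)).mul (DifferentiableAt.div (by fun_prop) (by fun_prop) (pow_ne_zero _ hs0)))
    (by
      intro s h1 h2
      exact norm_kernel_le hδ (by linarith) (by linarith) (by linarith) hC.le (hF δ hδ (by linarith) s h1 (by linarith)) hy)
  obtain ⟨he, hi⟩ := hshift
  have hi1 := hi (1/2 + δ) le_rfl (by linarith)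
  push_cast at he hi1
  refine ⟨?_, hi1⟩
  rw [he]
  have l1 := integral_laplace_kernel (a := 1 + δ) (μ := Measure.count) (W := fun n : ℕ => ArithmeticFunction.vonMangoldt n)
    (lam := fun n : ℕ => Real.log n) (by fun_prop) (by fun_prop) (by linarith) (integrable_vonMangoldt_exp (by linarith)) y
  have l2 := integral_laplace_kernel (a := 1 + δ) (μ := volume.restrict (Set.Ioi (1:ℝ))) (W := fun u : ℝ => (1:ℝ))
    (lam := fun u : ℝ => Real.log u) (by fun_prop) (by fun_prop) (by linarith) (integrable_exp_log (by linarith)) y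
  have l3 := integral_sub l1.2 l2.2
  rw [l1.1, l2.1] at l3
  push_cast at l3
  have : ∀ τ : ℝ, zetaF (1 + δ + τ * Complex.I) * (Complex.exp ((1 + δ + τ * Complex.I) * y) / (1 + δ + τ * Complex.I)^2) = 
    (∫ n : ℕ, (ArithmeticFunction.vonMangoldt n : ℂ) * Complex.exp (-((1 + δ + τ * Complex.I) * Real.log n)) ∂Measure.count) * (Complex.exp ((1 + δ + τ * Complex.I) * y) / (1 + δ + τ * Complex.I)^2) -
      (∫ u in Set.Ioi (1:ℝ), ((1:ℝ):ℂ) * Complex.exp (-((1 + δ + τ * Complex.I) * Real.log u))) * (Complex.exp ((1 + δ + τ * Complex.I) * y) / (1 + δ + τ * Complex.I)^2) := by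
    intro τ
    rw [zetaF_eq_integral (by simp; linarith)]; ring
  simp_rw [this]
  push_cast
  rw [l3, rieszE]
  push_cast
  rw [← integral_complex_ofReal, ← integral_complex_ofReal]
  push_cast
  simp only [one_mul]
  ring

open MeasureTheory in
/-- For a nonnegative weight, `∫ W e^{-2cλ} (y + λ)₊` is affine in `y ≥ 0`. -/
lemma exists_affine_weight {Ω : Type*} [MeasurableSpace Ω] {μ : Measure Ω} {W lam : Ω → ℝ} (hW : Measurable W) (hlam : Measurable lam)
    (hl : ∀ᵐ ω ∂μ, 0 ≤ lam ω) {c b : ℝ} (hb : 0 < b)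
    (hi : Integrable (fun ω => W ω * Real.exp (-((2 * c - b) * lam ω))) μ) :
    ∃ β : ℝ, ∀ y : ℝ, 0 ≤ y → ∫ ω, (((W ω * Real.exp (-(2 * c * lam ω)) : ℝ) : ℂ) * (max (y - -lam ω) 0 : ℝ)) ∂μ =
      (((∫ ω, W ω * Real.exp (-(2 * c * lam ω)) ∂μ) * y + β : ℝ) : ℂ) := by
  refine ⟨∫ ω, W ω * Real.exp (-(2 * c * lam ω)) * lam ω ∂μ, fun y hy => ?_⟩
  have i1 : Integrable (fun ω => W ω * Real.exp (-(2 * c * lam ω))) μ := by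
    refine hi.mono (by fun_prop) ?_
    filter_upwards [hl] with ω hω
    simp only [norm_mul, Real.norm_eq_abs, Real.abs_exp]
    gcongr
    nlinarith
  have i2 : Integrable (fun ω => W ω * Real.exp (-(2 * c * lam ω)) * lam ω) μ := by
    refine (hi.const_mul (1/b)).mono (by fun_prop) ?_
    filter_upwards [hl] with ω hω
    simp only [norm_mul, Real.norm_eq_abs, Real.abs_exp, abs_of_nonneg hω, abs_of_pos (show 0 < 1/b by positivity)]
    have : lam ω ≤ 1/b * Real.exp (b * lam ω) := by
      have := Real.add_one_le_exp (b * lam ω)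
      rw [one_div, inv_mul_eq_div, le_div_iff₀ hb]; linarith
    calc |W ω| * Real.exp (-(2 * c * lam ω)) * lam ω ≤ |W ω| * Real.exp (-(2 * c * lam ω)) * (1/b * Real.exp (b * lam ω)) := by gcongr
      _ = 1/b * (|W ω| * (Real.exp (-(2 * c * lam ω)) * Real.exp (b * lam ω))) := by ring
      _ = _ := by rw [← Real.exp_add]; ring_nf
  have : ∀ᵐ ω ∂μ, (((W ω * Real.exp (-(2 * c * lam ω)) : ℝ) : ℂ) * (max (y - -lam ω) 0 : ℝ)) =
     ((W ω * Real.exp (-(2 * c * lam ω)) * y + W ω * Real.exp (-(2 * c * lam ω)) * lam ω : ℝ) : ℂ) := by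
    filter_upwards [hl] with ω hω
    rw [max_eq_left (by linarith)]
    push_cast; ring
  rw [integral_congr_ae this, integral_complex_ofReal, integral_add (i1.mul_const y) i2, integral_mul_const]

open MeasureTheory in
lemma exists_integral_conj_zetaF_kernel (hRH : RiemannHypothesis) : ∃ C : ℝ, 0 < C ∧ ∀ δ : ℝ, 0 < δ → δ ≤ 1/4 →
    ∃ α β : ℝ, |α| ≤ C ∧ ∀ y : ℝ, 0 ≤ y → 
    (∫ τ : ℝ, (starRingEnd ℂ) (zetaF (1/2 + δ + τ * Complex.I)) * (Complex.exp ((1/2 + δ + τ * Complex.I) * y) / (1/2 + δ + τ * Complex.I)^2)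
      = (2 * Real.pi * (α * y + β : ℝ) : ℂ)) := by
  obtain ⟨C, hC, hF⟩ := exists_norm_zetaF_le hRH
  refine ⟨C * ell 0 / (1/2), by have := one_le_ell 0; positivity, fun δ hδ hδ4 => ?_⟩
  have iL := integrable_vonMangoldt_exp (a := 1 + δ) (by linarith)
  have iU := integrable_exp_log (a := 1 + δ) (by linarith)
  have hc : (2 * (1/2 + δ) - δ : ℝ) = 1 + δ := by ring
  obtain ⟨β1, hβ1⟩ := exists_affine_weight (μ := Measure.count) (W := fun n : ℕ => ArithmeticFunction.vonMangoldt n)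
    (lam := fun n : ℕ => Real.log n) (c := 1/2 + δ) (b := δ) (by fun_prop) (by fun_prop) (Eventually.of_forall fun n => Real.log_natCast_nonneg n) hδ (by rw [hc]; exact iL)
  obtain ⟨β2, hβ2⟩ := exists_affine_weight (μ := volume.restrict (Set.Ioi (1:ℝ))) (W := fun u : ℝ => (1:ℝ))
    (lam := fun u : ℝ => Real.log u) (c := 1/2 + δ) (b := δ) (by fun_prop) (by fun_prop) 
    ((ae_restrict_mem measurableSet_Ioi).mono fun u hu => Real.log_nonneg (le_of_lt hu)) hδ (by rw [hc]; exact iU)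
  set A1 := ∫ n : ℕ, ArithmeticFunction.vonMangoldt n * Real.exp (-(2 * (1/2 + δ) * Real.log n)) ∂Measure.count with hA1
  set A2 := ∫ u in Set.Ioi (1:ℝ), (1:ℝ) * Real.exp (-(2 * (1/2 + δ) * Real.log u)) with hA2
  refine ⟨A1 - A2, β1 - β2, ?_, fun y hy => ?_⟩
  · have h := zetaF_eq_integral (s := ((2 * (1/2 + δ) : ℝ) : ℂ)) (by simp only [Complex.ofReal_re]; linarith)
    have e : zetaF ((2 * (1/2 + δ) : ℝ) : ℂ) = ((A1 - A2 : ℝ) : ℂ) := by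
      rw [h, hA1, hA2]
      push_cast
      rw [← integral_complex_ofReal, ← integral_complex_ofReal]
      push_cast; rfl
    have h2 := hF (1/2) (by norm_num) (by norm_num) ((2 * (1/2 + δ) : ℝ) : ℂ) (by simp only [Complex.ofReal_re]; linarith) (by simp only [Complex.ofReal_re]; linarith)
    rw [e, Complex.norm_real, Complex.ofReal_im] at h2
    exact h2
  · have hshift := integral_line_eq_of_differentiable (G := fun s => zetaF (((2 * (1/2 + δ) : ℝ) : ℂ) - s) * (Complex.exp (s * y) / s^2))
      (a := δ) (b := 1/2 + δ) (K := C * 6 / δ * Real.exp (2 * y) * (2 / δ^2)) (by linarith)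
      (by
        intro s h1 h2
        have hs0 : s ≠ 0 := by rintro rfl; simp at h1; linarith
        refine DifferentiableAt.mul ?_ (DifferentiableAt.div (by fun_prop) (by fun_prop) (pow_ne_zero _ hs0))
        have := differentiableAt_zetaF hRH (s := ((2 * (1/2 + δ) : ℝ) : ℂ) - s) (by simp only [Complex.sub_re, Complex.ofReal_re]; linarith)
        exact this.comp s (by fun_prop))
      (by
        intro s h1 h2
        refine norm_kernel_le hδ (by linarith) (by linarith) (by linarith) hC.le ?_ hy
        have := hF δ hδ (by linarith) (((2 * (1/2 + δ) : ℝ) : ℂ) - s) (by simp only [Complex.sub_re, Complex.ofReal_re]; linarith) (by simp only [Complex.sub_re, Complex.ofReal_re]; linarith)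
        rw [Complex.sub_im, Complex.ofReal_im, zero_sub] at this
        simpa [ell] using this)
    have he := hshift.1
    have l1 := integral_laplace_kernel (a := δ) (μ := Measure.count) (W := fun n : ℕ => ArithmeticFunction.vonMangoldt n * Real.exp (-(2 * (1/2 + δ) * Real.log n)))
      (lam := fun n : ℕ => -Real.log n) (by fun_prop) (by fun_prop) hδ (iL.congr (Eventually.of_forall fun n => by
        simp only; rw [mul_assoc, ← Real.exp_add]; ring_nf)) y
    have l2 := integral_laplace_kernel (a := δ) (μ := volume.restrict (Set.Ioi (1:ℝ))) (W := fun u : ℝ => (1:ℝ) * Real.exp (-(2 * (1/2 + δ) * Real.log u)))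
      (lam := fun u : ℝ => -Real.log u) (by fun_prop) (by fun_prop) hδ (iU.congr (Eventually.of_forall fun n => by
        simp only; rw [mul_assoc, ← Real.exp_add]; ring_nf)) y
    have l3 := integral_sub l1.2 l2.2
    rw [l1.1, l2.1, hβ1 y hy, hβ2 y hy] at l3
    have key : ∫ τ : ℝ, zetaF (((2 * (1/2 + δ) : ℝ) : ℂ) - (((1/2 + δ : ℝ) : ℂ) + τ * Complex.I)) * (Complex.exp ((((1/2 + δ : ℝ) : ℂ) + τ * Complex.I) * y) / (((1/2 + δ : ℝ) : ℂ) + τ * Complex.I)^2) = 2 * Real.pi * (((A1 - A2) * y + (β1 - β2) : ℝ) : ℂ) := by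
      rw [← he]
      have h4 : (2 * Real.pi * (((A1 - A2) * y + (β1 - β2) : ℝ) : ℂ)) = 2 * Real.pi * ((A1 * y + β1 : ℝ) : ℂ) - 2 * Real.pi * ((A2 * y + β2 : ℝ) : ℂ) := by
        push_cast; ring
      rw [h4, ← l3]
      congr 1; ext τ
      rw [zetaF_eq_integral (by simp; linarith), ← sub_mul]
      congr 2
      · congr 1; ext n
        push_cast
        rw [mul_assoc, ← Complex.exp_add]; congr 2; ring
      · congr 1; ext n
        push_cast
        rw [mul_assoc, ← Complex.exp_add]; congr 2; ring
    have h5 := congrArg (starRingEnd ℂ) key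
    rw [← integral_conj, ← integral_neg_eq_self (μ := volume)] at h5
    have h6 : (starRingEnd ℂ) (2 * Real.pi * (((A1 - A2) * y + (β1 - β2) : ℝ) : ℂ)) = 2 * Real.pi * (((A1 - A2) * y + (β1 - β2) : ℝ) : ℂ) := by
      rw [map_mul, map_mul, Complex.conj_ofReal, Complex.conj_ofReal, Complex.conj_ofNat]
    rw [h6] at h5
    rw [← h5]
    congr 1; ext τ
    simp only [map_mul, map_div₀, map_pow, ← Complex.exp_conj, map_add, Complex.conj_ofReal, Complex.conj_I]
    push_cast
    congr 1
    · congr 2; ring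
    · ring_nf

open MeasureTheory in
lemma exists_integral_re_zetaF_kernel (hRH : RiemannHypothesis) : ∃ C : ℝ, 0 < C ∧ ∀ δ : ℝ, 0 < δ → δ ≤ 1/4 →
    ∃ α β : ℝ, |α| ≤ C ∧ ∀ y : ℝ, 0 ≤ y → 
    (∫ τ : ℝ, ((2 * (zetaF (1/2 + δ + τ * Complex.I)).re : ℝ) : ℂ) * (Complex.exp ((1/2 + δ + τ * Complex.I) * y) / (1/2 + δ + τ * Complex.I)^2)
      = (2 * Real.pi * (rieszE y + α * y + β : ℝ) : ℂ)) ∧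
    Integrable (fun τ : ℝ => ((2 * (zetaF (1/2 + δ + τ * Complex.I)).re : ℝ) : ℂ) * (Complex.exp ((1/2 + δ + τ * Complex.I) * y) / (1/2 + δ + τ * Complex.I)^2)) := by
  obtain ⟨C, hC, h⟩ := exists_integral_conj_zetaF_kernel hRH
  refine ⟨C, hC, fun δ hδ hδ4 => ?_⟩
  obtain ⟨α, β, hα, h⟩ := h δ hδ hδ4
  refine ⟨α, β, hα, fun y hy => ?_⟩
  obtain ⟨h1, i1⟩ := integral_zetaF_kernel hRH hδ hδ4 hy
  have h2 := h y hy
  have cF : Continuous (fun τ : ℝ => zetaF (1/2 + δ + τ * Complex.I)) := by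
    have := continuous_zetaF_line hRH (σ := 1/2 + δ) (by linarith)
    push_cast at this; exact this
  have cK : Continuous (fun τ : ℝ => Complex.exp ((1/2 + δ + τ * Complex.I) * y) / (1/2 + δ + τ * Complex.I)^2) := by
    have := continuous_kernel (a := 1/2 + δ) (by linarith) y
    push_cast at this; exact this
  have i2 : Integrable (fun τ : ℝ => (starRingEnd ℂ) (zetaF (1/2 + δ + τ * Complex.I)) * (Complex.exp ((1/2 + δ + τ * Complex.I) * y) / (1/2 + δ + τ * Complex.I)^2)) := by
    refine i1.mono ?_ (Eventually.of_forall fun τ => ?_)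
    · exact ((Complex.continuous_conj.comp cF).mul cK).aestronglyMeasurable
    · rw [norm_mul, norm_mul, Complex.norm_conj]
  have e : ∀ τ : ℝ, ((2 * (zetaF (1/2 + δ + τ * Complex.I)).re : ℝ) : ℂ) * (Complex.exp ((1/2 + δ + τ * Complex.I) * y) / (1/2 + δ + τ * Complex.I)^2)
     = zetaF (1/2 + δ + τ * Complex.I) * (Complex.exp ((1/2 + δ + τ * Complex.I) * y) / (1/2 + δ + τ * Complex.I)^2) + 
      (starRingEnd ℂ) (zetaF (1/2 + δ + τ * Complex.I)) * (Complex.exp ((1/2 + δ + τ * Complex.I) * y) / (1/2 + δ + τ * Complex.I)^2) := by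
    intro τ
    rw [← add_mul, Complex.add_conj]
  simp_rw [e]
  refine ⟨?_, i1.add i2⟩
  rw [integral_add i1 i2, h1, h2]
  push_cast; ring

open MeasureTheory in
lemma integral_vonMangoldt_max_eq_sum {y : ℝ} {K : ℕ} (hK : Real.exp y ≤ K) :
    ∫ n : ℕ, ArithmeticFunction.vonMangoldt n * max (y - Real.log n) 0 ∂Measure.count =
      ∑ n ∈ Ioc 0 K, ArithmeticFunction.vonMangoldt n * max (y - Real.log n) 0 := by
  have hz : ∀ n ∉ Ioc 0 K, ArithmeticFunction.vonMangoldt n * max (y - Real.log n) 0 = 0 := by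
    intro n hn
    rcases Nat.eq_zero_or_pos n with rfl | hn0
    · simp
    · have hKn : K < n := by
        by_contra h
        exact hn (mem_Ioc.2 ⟨hn0, not_lt.1 h⟩)
      have : y ≤ Real.log n := by
        rw [Real.le_log_iff_exp_le (by exact_mod_cast hn0)]
        exact hK.trans (by exact_mod_cast hKn.le)
      rw [max_eq_right (by linarith), mul_zero]
  rw [integral_countable]
  · rw [tsum_eq_sum (s := Ioc 0 K)]
    · refine sum_congr rfl fun n _ => ?_
      simp [Measure.real]
    · intro n hn
      rw [hz n hn]; simp
  · rw [integrable_count_iff]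
    exact summable_of_ne_finset_zero (s := Ioc 0 K) fun n hn => by rw [hz n hn, norm_zero]

open MeasureTheory in
lemma integral_max_sub_log {y : ℝ} (hy : 0 ≤ y) :
    ∫ u in Set.Ioi (1:ℝ), max (y - Real.log u) 0 = Real.exp y - 1 - y := by
  have h1 : ∫ u in Set.Ioi (1:ℝ), max (y - Real.log u) 0 = ∫ u in Set.Ioc (1:ℝ) (Real.exp y), max (y - Real.log u) 0 := by
    refine setIntegral_eq_of_subset_of_forall_sdiff_eq_zero measurableSet_Ioi Set.Ioc_subset_Ioi_self ?_
    rintro u ⟨hu1, hu2⟩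
    have h1u : (1:ℝ) < u := hu1
    have : Real.exp y < u := by
      by_contra h
      exact hu2 ⟨hu1, not_lt.1 h⟩
    rw [max_eq_right]
    have := (Real.le_log_iff_exp_le (by linarith)).2 this.le
    linarith
  have h2 : ∫ u in Set.Ioc (1:ℝ) (Real.exp y), max (y - Real.log u) 0 = ∫ u in Set.Ioc (1:ℝ) (Real.exp y), (y - Real.log u) := by
    refine setIntegral_congr_fun measurableSet_Ioc ?_
    rintro u ⟨hu1, hu2⟩
    have := (Real.log_le_iff_le_exp (by linarith)).2 hu2
    simp only
    rw [max_eq_left (by linarith)]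
  rw [h1, h2, ← intervalIntegral.integral_of_le (Real.one_le_exp hy), intervalIntegral.integral_sub
    intervalIntegrable_const intervalIntegral.intervalIntegrable_log', integral_log]
  simp
  ring

lemma rieszE_sub_bounds {y ε : ℝ} (hy : 0 ≤ y) (hε : 0 < ε) :
    ε * Chebyshev.psi (Real.exp y) - (Real.exp (y + ε) - Real.exp y - ε) ≤ rieszE (y + ε) - rieszE y ∧
    rieszE (y + ε) - rieszE y ≤ ε * Chebyshev.psi (Real.exp (y + ε)) - (Real.exp (y + ε) - Real.exp y - ε) := by
  unfold rieszE
  rw [integral_max_sub_log hy, integral_max_sub_log (by linarith : 0 ≤ y + ε)]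
  obtain ⟨K, hK⟩ := exists_nat_ge (Real.exp (y + ε))
  have hyy : Real.exp y ≤ Real.exp (y + ε) := Real.exp_le_exp.2 (by linarith)
  rw [integral_vonMangoldt_max_eq_sum hK, integral_vonMangoldt_max_eq_sum (hyy.trans hK)]
  have hpsi : ∀ x : ℝ, Real.exp x ≤ K → Chebyshev.psi (Real.exp x) =
      ∑ n ∈ Ioc 0 K, if (n:ℝ) ≤ Real.exp x then ArithmeticFunction.vonMangoldt n else 0 := by
    intro x hx
    rw [Chebyshev.psi, ← sum_filter]
    refine sum_congr ?_ fun _ _ => rfl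
    ext n
    simp only [mem_Ioc, mem_filter]
    rw [Nat.le_floor_iff (Real.exp_pos x).le]
    constructor
    · rintro ⟨h1, h2⟩
      exact ⟨⟨h1, by exact_mod_cast h2.trans hx⟩, h2⟩
    · rintro ⟨⟨h1, -⟩, h2⟩
      exact ⟨h1, h2⟩
  rw [hpsi y (hyy.trans hK), hpsi (y + ε) hK]
  have a1 : ε * (∑ n ∈ Ioc 0 K, if (n:ℝ) ≤ Real.exp y then ArithmeticFunction.vonMangoldt n else 0) ≤
      (∑ n ∈ Ioc 0 K, ArithmeticFunction.vonMangoldt n * max (y + ε - Real.log n) 0) -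
      ∑ n ∈ Ioc 0 K, ArithmeticFunction.vonMangoldt n * max (y - Real.log n) 0 := by
    rw [mul_sum, ← sum_sub_distrib]
    refine sum_le_sum fun n hn => ?_
    have hn0 : (0:ℝ) < n := by exact_mod_cast (mem_Ioc.1 hn).1
    have hΛ : 0 ≤ ArithmeticFunction.vonMangoldt n := ArithmeticFunction.vonMangoldt_nonneg
    rw [← mul_sub]
    split_ifs with h
    · have := (Real.log_le_iff_le_exp hn0).2 h
      rw [max_eq_left (by linarith), max_eq_left (by linarith)]
      apply le_of_eq; ring
    · rw [mul_zero]
      refine mul_nonneg hΛ (sub_nonneg.2 (max_le_max (by linarith) le_rfl))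
  have a2 : (∑ n ∈ Ioc 0 K, ArithmeticFunction.vonMangoldt n * max (y + ε - Real.log n) 0) -
      ∑ n ∈ Ioc 0 K, ArithmeticFunction.vonMangoldt n * max (y - Real.log n) 0 ≤
      ε * (∑ n ∈ Ioc 0 K, if (n:ℝ) ≤ Real.exp (y + ε) then ArithmeticFunction.vonMangoldt n else 0) := by
    rw [mul_sum, ← sum_sub_distrib]
    refine sum_le_sum fun n hn => ?_
    have hn0 : (0:ℝ) < n := by exact_mod_cast (mem_Ioc.1 hn).1
    have hΛ : 0 ≤ ArithmeticFunction.vonMangoldt n := ArithmeticFunction.vonMangoldt_nonneg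
    rw [← mul_sub]
    split_ifs with h
    · rw [mul_comm ε]
      refine mul_le_mul_of_nonneg_left ?_ hΛ
      rw [sub_le_iff_le_add]
      refine max_le ?_ ?_
      · linarith [le_max_left (y - Real.log n) 0]
      · linarith [le_max_right (y - Real.log n) 0]
    · have := (Real.lt_log_iff_exp_lt hn0).2 (not_le.1 h)
      rw [max_eq_right (by linarith), max_eq_right (by linarith)]; simp
  constructor <;> linarith

open MeasureTheory in
/-- Averaging: against a slowly varying weight, `absReF` behaves on average like `ell`. -/
lemma exists_lintegral_absReF_mul_le (hRH : RiemannHypothesis) : ∃ C : ℝ, 0 < C ∧ ∀ δ : ℝ, 0 < δ → δ ≤ 1/4 →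
    ∀ (W : ℝ → ℝ) (K : ℝ), Measurable W → (∀ τ, 0 ≤ W τ) → 0 ≤ K →
    (∀ τ τ', |τ - τ'| ≤ 1/2 → W τ' ≤ K * W τ) →
    ∫⁻ τ, ENNReal.ofReal (absReF δ τ * W τ) ≤ ENNReal.ofReal (C * K) * ∫⁻ τ, ENNReal.ofReal (ell τ * W τ) := by
  obtain ⟨C, hC, h⟩ := exists_integral_absReF_le hRH
  refine ⟨C, hC, fun δ hδ hδ4 W K hWm hW0 hK hW => ?_⟩
  have hcont := continuous_absReF hRH hδ
  have hmeas : Measurable (absReF δ) := hcont.measurable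
  have hloc : ∀ t : ℝ, ∫⁻ τ in Set.Icc (t - 1/2) (t + 1/2), ENNReal.ofReal (absReF δ τ) ≤ ENNReal.ofReal (C * ell t) := by
    intro t
    have := h δ hδ hδ4 t
    rw [intervalIntegral.integral_of_le (by linarith), ← integral_Icc_eq_integral_Ioc] at this
    rw [← ofReal_integral_eq_lintegral_ofReal hcont.continuousOn.integrableOn_Icc (Eventually.of_forall fun τ => absReF_nonneg δ τ)]
    exact ENNReal.ofReal_le_ofReal this
  set S : Set (ℝ × ℝ) := {p | |p.1 - p.2| ≤ 1/2} with hS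
  have hSm : MeasurableSet S := measurableSet_le (by fun_prop) measurable_const
  have e1 : ∀ τ' : ℝ, ENNReal.ofReal (absReF δ τ' * W τ') = ∫⁻ τ, S.indicator (fun p => ENNReal.ofReal (absReF δ p.2 * W p.2)) (τ, τ') := by
    intro τ'
    have : ∀ τ : ℝ, S.indicator (fun p => ENNReal.ofReal (absReF δ p.2 * W p.2)) (τ, τ') =
       (Set.Icc (τ' - 1/2) (τ' + 1/2)).indicator (fun _ => ENNReal.ofReal (absReF δ τ' * W τ')) τ := by
      intro τ
      refine Set.indicator_eq_indicator ?_ rfl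
      simp only [hS, Set.mem_ofPred_eq, Set.mem_Icc, abs_le]
      constructor <;> rintro ⟨h1, h2⟩ <;> constructor <;> linarith
    simp_rw [this]
    rw [lintegral_indicator measurableSet_Icc, setLIntegral_const, Real.volume_Icc]
    norm_num
  calc ∫⁻ τ', ENNReal.ofReal (absReF δ τ' * W τ') 
      = ∫⁻ τ', ∫⁻ τ, S.indicator (fun p => ENNReal.ofReal (absReF δ p.2 * W p.2)) (τ, τ') := by
        exact lintegral_congr e1
    _ = ∫⁻ τ, ∫⁻ τ', S.indicator (fun p => ENNReal.ofReal (absReF δ p.2 * W p.2)) (τ, τ') := by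
        refine lintegral_lintegral_swap (f := fun τ' τ => S.indicator (fun p => ENNReal.ofReal (absReF δ p.2 * W p.2)) (τ, τ')) ?_
        refine Measurable.aemeasurable ?_
        have : Measurable (S.indicator (fun p : ℝ × ℝ => ENNReal.ofReal (absReF δ p.2 * W p.2))) :=
          Measurable.indicator (by fun_prop) hSm
        exact this.comp measurable_swap
    _ ≤ ∫⁻ τ, ENNReal.ofReal (C * K) * ENNReal.ofReal (ell τ * W τ) := by
        refine lintegral_mono fun τ => ?_
        calc ∫⁻ τ', S.indicator (fun p => ENNReal.ofReal (absReF δ p.2 * W p.2)) (τ, τ')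
            ≤ ∫⁻ τ', (Set.Icc (τ - 1/2) (τ + 1/2)).indicator (fun τ' => ENNReal.ofReal (K * W τ) * ENNReal.ofReal (absReF δ τ')) τ' := by
              refine lintegral_mono fun τ' => ?_
              simp only
              by_cases hp : |τ - τ'| ≤ 1/2
              · have hp' : τ' ∈ Set.Icc (τ - 1/2) (τ + 1/2) := by
                  rw [abs_le] at hp; constructor <;> linarith [hp.1, hp.2]
                rw [Set.indicator_of_mem (show (τ, τ') ∈ S from hp), Set.indicator_of_mem hp', ← ENNReal.ofReal_mul (mul_nonneg hK (hW0 τ))]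
                refine ENNReal.ofReal_le_ofReal ?_
                rw [mul_comm]
                exact mul_le_mul_of_nonneg_right (hW τ τ' hp) (absReF_nonneg δ τ')
              · rw [Set.indicator_of_notMem (show (τ, τ') ∉ S from hp)]; exact zero_le
          _ = ENNReal.ofReal (K * W τ) * ∫⁻ τ' in Set.Icc (τ - 1/2) (τ + 1/2), ENNReal.ofReal (absReF δ τ') := by
              rw [lintegral_indicator measurableSet_Icc, lintegral_const_mul _ (by fun_prop)]
          _ ≤ ENNReal.ofReal (K * W τ) * ENNReal.ofReal (C * ell τ) := by gcongr; exact hloc τ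
          _ = _ := by
              have := one_le_ell τ
              rw [← ENNReal.ofReal_mul (mul_nonneg hK (hW0 τ)), ← ENNReal.ofReal_mul (by positivity)]
              ring_nf
    _ = _ := by
        rw [lintegral_const_mul']
        exact ENNReal.ofReal_ne_top

lemma ell_le_add (τ a : ℝ) : ell τ ≤ ell a * (1 + |τ - a|) := by
  have h1 := one_le_ell a
  have h0 := abs_nonneg (τ - a)
  have h2 : |τ| ≤ |a| + |τ - a| := by
    have := abs_add_le a (τ - a); simpa using this
  have : ell τ ≤ ell a + Real.log (1 + |τ - a|) := by
    unfold ell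
    rw [← Real.log_mul (by positivity) (by positivity)]
    refine Real.log_le_log (by positivity) ?_
    nlinarith [abs_nonneg a]
  have h3 := Real.log_le_sub_one_of_pos (show 0 < 1 + |τ - a| by positivity)
  nlinarith

lemma measurable_ell : Measurable ell := by unfold ell; fun_prop

lemma ell_nonneg (τ : ℝ) : 0 ≤ ell τ := zero_le_one.trans (one_le_ell τ)

open MeasureTheory in
lemma exists_lintegral_absReF_div_le (hRH : RiemannHypothesis) : ∃ C : ℝ, 0 < C ∧ ∀ δ : ℝ, 0 < δ → δ ≤ 1/4 →
    ∀ a : ℝ, ∫⁻ τ, ENNReal.ofReal (absReF δ τ * (1 / (1 + (τ - a)^2)^2)) ≤ ENNReal.ofReal (C * ell a) := by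
  obtain ⟨C, hC, h⟩ := exists_lintegral_absReF_mul_le hRH
  refine ⟨C * 4 * (2 * Real.pi), by positivity, fun δ hδ hδ4 a => ?_⟩
  have h1 := h δ hδ hδ4 (fun τ => 1 / (1 + (τ - a)^2)^2) 4 (by fun_prop) (fun τ => by positivity) (by norm_num) (by
    intro τ τ' hτ
    rw [mul_one_div, div_le_div_iff₀ (by positivity) (by positivity), one_mul]
    have h2 : 1 + (τ - a)^2 ≤ 2 * (1 + (τ' - a)^2) := by
      have h3 := abs_le.1 hτ
      nlinarith [sq_nonneg (τ - a - 2 * (τ' - a)), sq_nonneg (τ + τ' - 2 * a)]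
    calc (1 + (τ - a)^2)^2 ≤ (2 * (1 + (τ' - a)^2))^2 := by gcongr
      _ = _ := by ring)
  refine h1.trans ?_
  have hl := one_le_ell a
  have h2 : ∫⁻ τ, ENNReal.ofReal (ell τ * (1 / (1 + (τ - a)^2)^2)) ≤ ENNReal.ofReal (ell a * 2 * Real.pi) := by
    have i1 : Integrable (fun τ : ℝ => ell a * 2 * (1 + (τ - a)^2)⁻¹) := by
      exact (integrable_inv_one_add_sq.comp_sub_right a).const_mul _
    calc _ ≤ ∫⁻ τ, ENNReal.ofReal (ell a * 2 * (1 + (τ - a)^2)⁻¹) := by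
          refine lintegral_mono fun τ => ENNReal.ofReal_le_ofReal ?_
          have := ell_le_add τ a
          have h5 : (1 + |τ - a|) ≤ 2 * (1 + (τ - a)^2) := by
            have := sq_abs (τ - a)
            nlinarith [sq_nonneg (|τ - a| - 1)]
          calc _ ≤ (ell a * (2 * (1 + (τ - a)^2))) * (1 / (1 + (τ - a)^2)^2) := by
                gcongr; exact this.trans (by gcongr)
            _ = _ := by field_simp
      _ = ENNReal.ofReal (∫ τ, ell a * 2 * (1 + (τ - a)^2)⁻¹) := by
          rw [ofReal_integral_eq_lintegral_ofReal i1 (Eventually.of_forall fun τ => by simp only [Pi.zero_apply]; positivity)]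
      _ = _ := by
          rw [integral_const_mul, integral_sub_right_eq_self (fun x : ℝ => (1 + x^2)⁻¹), integral_univ_inv_one_add_sq]
  calc _ ≤ ENNReal.ofReal (C * 4) * ENNReal.ofReal (ell a * 2 * Real.pi) := by gcongr
    _ = _ := by
      rw [← ENNReal.ofReal_mul (by positivity)]; ring_nf

open MeasureTheory in
lemma exists_lintegral_ell_sq_div_le : ∃ C : ℝ, 0 < C ∧ ∀ T : ℝ, 1 ≤ T →
    ∫⁻ τ, ENNReal.ofReal (ell τ * (ell τ * (1 / (|τ| + T))^2)) ≤ ENNReal.ofReal (C * Real.log (T + 5)^2 / T) := by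
  have i0 : Integrable (fun y : ℝ => (1 + ‖y‖) ^ (-(3/2:ℝ))) := integrable_one_add_norm (by norm_num)
  set J := ∫ y : ℝ, (1 + ‖y‖) ^ (-(3/2:ℝ)) with hJ
  have hJ0 : 0 ≤ J := integral_nonneg fun y => by positivity
  refine ⟨25 * (J + 1), by positivity, fun T hT => ?_⟩
  have hT0 : 0 < T := by linarith
  have hlog1 : 1 ≤ Real.log (T + 5) := by
    rw [Real.le_log_iff_exp_le (by positivity)]
    linarith [Real.exp_one_lt_d9]
  have i1 : Integrable (fun τ : ℝ => 25 * Real.log (T + 5)^2 / T^2 * (1 + ‖τ / T‖) ^ (-(3/2:ℝ))) :=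
    (i0.comp_div hT0.ne').const_mul _
  have e1 : ∫ τ : ℝ, 25 * Real.log (T + 5)^2 / T^2 * (1 + ‖τ / T‖) ^ (-(3/2:ℝ)) = 25 * J * Real.log (T + 5)^2 / T := by
    rw [integral_const_mul, Measure.integral_comp_div (fun y : ℝ => (1 + ‖y‖) ^ (-(3/2:ℝ))) T, ← hJ, abs_of_pos hT0, smul_eq_mul]
    field_simp
  calc _ ≤ ∫⁻ τ, ENNReal.ofReal (25 * Real.log (T + 5)^2 / T^2 * (1 + ‖τ / T‖) ^ (-(3/2:ℝ))) := by
        refine lintegral_mono fun τ => ENNReal.ofReal_le_ofReal ?_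
        have hy : ‖τ / T‖ = |τ| / T := by rw [Real.norm_eq_abs, abs_div, abs_of_pos hT0]
        rw [hy]
        set z := 1 + |τ| / T with hz
        have hz1 : 1 ≤ z := by rw [hz]; have : 0 ≤ |τ| / T := by positivity
                               linarith
        have b1 : ell τ ≤ Real.log (T + 5) * (1 + Real.log z) := by
          have : ell τ ≤ Real.log (T + 5) + Real.log z := by
            unfold ell
            rw [← Real.log_mul (by positivity) (by positivity)]
            refine Real.log_le_log (by positivity) ?_
            rw [hz]
            have : (T + 5) * (1 + |τ| / T) = T + 5 + |τ| + 5 * (|τ| / T) := by field_simp; ring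
            rw [this]
            have : 0 ≤ |τ| / T := by positivity
            linarith
          have := Real.log_nonneg hz1
          nlinarith
        have b2 : 1 + Real.log z ≤ 5 * z ^ (1/4:ℝ) := by
          have h1 := Real.log_le_rpow_div (x := z) (ε := 1/4) (by linarith) (by norm_num)
          have h2 : 1 ≤ z ^ (1/4:ℝ) := Real.one_le_rpow hz1 (by norm_num)
          linarith
        have b3 : ell τ ≤ Real.log (T + 5) * (5 * z ^ (1/4:ℝ)) := b1.trans (by gcongr)
        have b4 : 1 / (|τ| + T) = 1 / (T * z) := by rw [hz]; congr 1; field_simp; ring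
        rw [b4]
        have b5 : z ^ (-(3/2:ℝ)) = z ^ (1/4:ℝ) * z ^ (1/4:ℝ) * (1 / z^2) := by
          rw [show 1 / z^2 = z^(-2:ℝ) by rw [one_div, Real.rpow_neg (by linarith)]; norm_cast,
            ← Real.rpow_add (by linarith), ← Real.rpow_add (by linarith)]
          norm_num
        rw [b5]
        have := ell_nonneg τ
        calc _ ≤ (Real.log (T + 5) * (5 * z ^ (1/4:ℝ))) * ((Real.log (T + 5) * (5 * z ^ (1/4:ℝ))) * (1 / (T * z))^2) := by gcongr
          _ = _ := by field_simp; ring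
    _ = ENNReal.ofReal (25 * J * Real.log (T + 5)^2 / T) := by
        rw [← ofReal_integral_eq_lintegral_ofReal i1 (Eventually.of_forall fun τ => by simp only [Pi.zero_apply]; positivity), e1]
    _ ≤ _ := by
        refine ENNReal.ofReal_le_ofReal ?_
        gcongr
        linarith

lemma norm_cexp_ofReal_mul_I' (a b c : ℝ) : ‖Complex.exp ((a:ℂ) * b * c * Complex.I)‖ = 1 := by
  have := Complex.norm_exp_ofReal_mul_I (a * b * c)
  push_cast at this; exact this

open MeasureTheory in
lemma continuous_oscillatory {ν : ℝ → ℂ} (hν : Integrable ν) (κ : ℝ) :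
    Continuous (fun y : ℝ => ∫ τ, ν τ * Complex.exp ((κ:ℂ) * τ * y * Complex.I)) := by
  refine continuous_of_dominated (bound := fun τ => ‖ν τ‖) (fun y => ?_) (fun y => Eventually.of_forall fun τ => ?_) hν.norm
    (Eventually.of_forall fun τ => by fun_prop)
  · exact hν.aestronglyMeasurable.mul (by fun_prop : Continuous fun τ : ℝ => Complex.exp ((κ:ℂ) * τ * y * Complex.I)).aestronglyMeasurable
  · rw [norm_mul, norm_cexp_ofReal_mul_I', mul_one]

open MeasureTheory in
lemma norm_oscillatory_le {ν : ℝ → ℂ} (κ y : ℝ) :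
    ‖∫ τ, ν τ * Complex.exp ((κ:ℂ) * τ * y * Complex.I)‖ ≤ ∫ τ, ‖ν τ‖ := by
  refine (norm_integral_le_integral_norm _).trans (le_of_eq ?_)
  congr 1; ext τ
  rw [norm_mul, norm_cexp_ofReal_mul_I', mul_one]

open MeasureTheory in
lemma norm_gaussian_oscillatory (t y0 : ℝ) :
    ‖∫ y : ℝ, Complex.exp ((t:ℂ) * y * Complex.I) * (Real.exp (-(y - y0)^2) : ℝ)‖ = Real.pi ^ (1/2:ℝ) * Real.exp (-(t^2/4)) := by
  have h := fourierIntegral_gaussian (b := 1) (by simp) t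
  have e : ∫ y : ℝ, Complex.exp ((t:ℂ) * y * Complex.I) * (Real.exp (-(y - y0)^2) : ℝ) =
     Complex.exp ((t:ℂ) * y0 * Complex.I) * ∫ x : ℝ, Complex.exp (Complex.I * t * x) * Complex.exp (-1 * x^2) := by
    rw [← integral_add_right_eq_self _ y0, ← integral_const_mul]
    congr 1; ext y
    rw [← mul_assoc, ← Complex.exp_add]
    push_cast
    rw [add_sub_cancel_right]
    congr 2 <;> ring
  rw [e, h, norm_mul, norm_mul]
  have h1 := Complex.norm_exp_ofReal_mul_I (t * y0)
  push_cast at h1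
  have h2 : ‖((Real.pi:ℂ) / 1) ^ (1/2:ℂ)‖ = Real.pi ^ (1/2:ℝ) := by
    rw [div_one, Complex.norm_cpow_eq_rpow_re_of_pos Real.pi_pos]; norm_num
  have h3 : ‖Complex.exp (-(t:ℂ)^2 / (4 * 1))‖ = Real.exp (-(t^2/4)) := by
    rw [Complex.norm_exp]
    congr 1
    have : (-(t:ℂ)^2 / (4 * 1)) = ((-(t^2/4) : ℝ) : ℂ) := by push_cast; ring
    rw [this, Complex.ofReal_re]
  rw [h1, h2, h3, one_mul]

open MeasureTheory in
lemma integral_gaussian_mul_oscillatory_sq_le {ν : ℝ → ℂ} (hν : Integrable ν) (κ y0 : ℝ) :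
    ∫ y : ℝ, Real.exp (-(y - y0)^2) * ‖∫ τ, ν τ * Complex.exp ((κ:ℂ) * τ * y * Complex.I)‖^2 ≤
      2 * ∫ p : ℝ × ℝ, ‖ν p.1‖ * ‖ν p.2‖ * Real.exp (-(κ * (p.1 - p.2))^2/4) := by
  have iG : Integrable (fun y : ℝ => Real.exp (-(y - y0)^2)) := by
    have := (integrable_exp_neg_mul_sq (b := 1) one_pos).comp_sub_right y0
    simpa using this
  have iP : Integrable (fun p : ℝ × ℝ => ν p.1 * (starRingEnd ℂ) (ν p.2)) (volume.prod volume) := by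
    have hc : Integrable (fun τ => (starRingEnd ℂ) (ν τ)) := by
      refine hν.mono ?_ (Eventually.of_forall fun τ => by simp)
      exact Complex.continuous_conj.comp_aestronglyMeasurable hν.aestronglyMeasurable
    exact hν.mul_prod hc
  have iPG : Integrable (fun q : ℝ × (ℝ × ℝ) => ((Real.exp (-(q.1 - y0)^2) : ℝ) : ℂ) * (ν q.2.1 * (starRingEnd ℂ) (ν q.2.2))) (volume.prod (volume.prod volume)) :=
    iG.ofReal.mul_prod iP
  have iAll : Integrable (fun q : ℝ × (ℝ × ℝ) => ((Real.exp (-(q.1 - y0)^2) : ℝ) : ℂ) * (ν q.2.1 * (starRingEnd ℂ) (ν q.2.2)) *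
      Complex.exp (((κ * (q.2.1 - q.2.2) : ℝ):ℂ) * q.1 * Complex.I)) (volume.prod (volume.prod volume)) := by
    refine iPG.mono ?_ (Eventually.of_forall fun q => ?_)
    · exact iPG.aestronglyMeasurable.mul (by fun_prop : Continuous fun q : ℝ × (ℝ × ℝ) => Complex.exp (((κ * (q.2.1 - q.2.2) : ℝ):ℂ) * q.1 * Complex.I)).aestronglyMeasurable
    · have := Complex.norm_exp_ofReal_mul_I (κ * (q.2.1 - q.2.2) * q.1)
      push_cast at this
      rw [norm_mul _ (Complex.exp _)]; push_cast; rw [this, mul_one]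
  have e1 : ∀ y : ℝ, ((Real.exp (-(y - y0)^2) * ‖∫ τ, ν τ * Complex.exp ((κ:ℂ) * τ * y * Complex.I)‖^2 : ℝ) : ℂ) =
      ∫ p : ℝ × ℝ, ((Real.exp (-(y - y0)^2) : ℝ) : ℂ) * (ν p.1 * (starRingEnd ℂ) (ν p.2)) *
      Complex.exp (((κ * (p.1 - p.2) : ℝ):ℂ) * y * Complex.I) := by
    intro y
    rw [Complex.ofReal_mul, Complex.ofReal_pow, ← Complex.mul_conj', ← integral_conj, ← integral_prod_mul]
    rw [← integral_const_mul]
    congr 1; ext p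
    rw [map_mul, ← Complex.exp_conj]
    simp only [map_mul, Complex.conj_ofReal, Complex.conj_I]
    have : Complex.exp (((κ * (p.1 - p.2) : ℝ):ℂ) * y * Complex.I) = Complex.exp ((κ:ℂ) * p.1 * y * Complex.I) * Complex.exp ((κ:ℂ) * p.2 * y * -Complex.I) := by
      rw [← Complex.exp_add]; push_cast; ring_nf
    rw [this]; ring
  have e2 : ((∫ y : ℝ, Real.exp (-(y - y0)^2) * ‖∫ τ, ν τ * Complex.exp ((κ:ℂ) * τ * y * Complex.I)‖^2 : ℝ) : ℂ) =
      ∫ p : ℝ × ℝ, (ν p.1 * (starRingEnd ℂ) (ν p.2)) * ∫ y : ℝ, Complex.exp (((κ * (p.1 - p.2) : ℝ):ℂ) * y * Complex.I) * (Real.exp (-(y - y0)^2) : ℝ) := by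
    rw [← integral_complex_ofReal]
    simp_rw [e1]
    have sw := integral_integral_swap (f := fun (y : ℝ) (p : ℝ × ℝ) => ((Real.exp (-(y - y0)^2) : ℝ) : ℂ) * (ν p.1 * (starRingEnd ℂ) (ν p.2)) *
      Complex.exp (((κ * (p.1 - p.2) : ℝ):ℂ) * y * Complex.I)) iAll
    refine Eq.trans sw ?_
    congr 1; ext p
    rw [← integral_const_mul]
    congr 1; ext y; ring
  have e3 : 0 ≤ ∫ y : ℝ, Real.exp (-(y - y0)^2) * ‖∫ τ, ν τ * Complex.exp ((κ:ℂ) * τ * y * Complex.I)‖^2 :=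
    integral_nonneg fun y => by positivity
  have e4 := congrArg norm e2
  rw [Complex.norm_real, Real.norm_of_nonneg e3] at e4
  rw [e4]
  refine (norm_integral_le_integral_norm _).trans ?_
  rw [← integral_const_mul]
  have iQ : Integrable (fun p : ℝ × ℝ => ‖ν p.1‖ * ‖ν p.2‖ * Real.exp (-(κ * (p.1 - p.2))^2/4)) (volume.prod volume) := by
    have := (hν.norm.mul_prod hν.norm)
    refine this.mono ?_ (Eventually.of_forall fun p => ?_)
    · exact this.aestronglyMeasurable.mul (by fun_prop : Continuous fun p : ℝ × ℝ => Real.exp (-(κ * (p.1 - p.2))^2/4)).aestronglyMeasurable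
    · rw [norm_mul _ (Real.exp _), Real.norm_of_nonneg (Real.exp_pos _).le]
      refine mul_le_of_le_one_right (norm_nonneg _) ?_
      rw [Real.exp_le_one_iff]
      have := sq_nonneg (κ * (p.1 - p.2)); linarith
  refine integral_mono_of_nonneg (Eventually.of_forall fun p => norm_nonneg _) (iQ.const_mul 2) (Eventually.of_forall fun p => ?_)
  simp only
  rw [norm_mul, norm_gaussian_oscillatory, norm_mul, Complex.norm_conj]
  have hpi : Real.pi ^ (1/2:ℝ) ≤ 2 := by
    rw [← Real.sqrt_eq_rpow]
    rw [Real.sqrt_le_left (by norm_num)]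
    linarith [Real.pi_lt_four]
  have : -(κ * (p.1 - p.2))^2/4 = -((κ * (p.1 - p.2))^2/4) := by ring
  rw [this]
  calc _ ≤ ‖ν p.1‖ * ‖ν p.2‖ * (2 * Real.exp (-((κ * (p.1 - p.2))^2/4))) := by gcongr
    _ = _ := by ring

open MeasureTheory in
lemma integral_oscillatory_log_sq_le {ν : ℝ → ℂ} (hν : Integrable ν) (κ : ℝ) {X : ℝ} (hX : 0 < X) :
    ∫ v in X..2*X, ‖∫ τ, ν τ * Complex.exp ((κ:ℂ) * τ * Real.log v * Complex.I)‖^2 ≤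
      12 * X * ∫ p : ℝ × ℝ, ‖ν p.1‖ * ‖ν p.2‖ * Real.exp (-(κ * (p.1 - p.2))^2/4) := by
  set g : ℝ → ℝ := fun y => ‖∫ τ, ν τ * Complex.exp ((κ:ℂ) * τ * y * Complex.I)‖^2 with hg
  have hgc : Continuous g := ((continuous_oscillatory hν κ).norm.pow 2)
  have hl : Real.log (2 * X) = Real.log 2 + Real.log X := Real.log_mul two_ne_zero hX.ne'
  have hl2 : Real.log 2 < 1 := by linarith [Real.log_two_lt_d9]
  have hl0 : 0 < Real.log 2 := Real.log_pos one_lt_two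
  have hcv : ∫ v in X..2*X, g (Real.log v) = ∫ y in (Real.log X)..(Real.log (2*X)), g y * Real.exp y := by
    have := intervalIntegral.integral_comp_mul_deriv' (a := Real.log X) (b := Real.log (2*X)) (f := Real.exp) (f' := Real.exp)
      (g := fun v => g (Real.log v)) (fun x _ => Real.hasDerivAt_exp x) Real.continuous_exp.continuousOn
      (by
        refine hgc.comp_continuousOn (Real.continuousOn_log.mono ?_)
        rintro _ ⟨x, -, rfl⟩
        exact (Real.exp_pos x).ne')
    rw [Real.exp_log hX, Real.exp_log (by positivity)] at this
    rw [← this]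
    simp
  rw [show (∫ v in X..2*X, ‖∫ τ, ν τ * Complex.exp ((κ:ℂ) * τ * Real.log v * Complex.I)‖^2) = ∫ v in X..2*X, g (Real.log v) from rfl, hcv]
  have hi2 : Integrable (fun y => Real.exp (-(y - Real.log X)^2) * g y) := by
    have iG : Integrable (fun y : ℝ => Real.exp (-(y - Real.log X)^2)) := by
      have := (integrable_exp_neg_mul_sq (b := 1) one_pos).comp_sub_right (Real.log X)
      simpa using this
    refine iG.mul_bdd (c := (∫ τ, ‖ν τ‖)^2) hgc.aestronglyMeasurable (Eventually.of_forall fun y => ?_)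
    rw [hg, norm_pow, norm_norm]
    exact pow_le_pow_left₀ (norm_nonneg _) (norm_oscillatory_le κ y) 2
  calc ∫ y in (Real.log X)..(Real.log (2*X)), g y * Real.exp y 
      ≤ ∫ y in (Real.log X)..(Real.log (2*X)), 6 * X * (Real.exp (-(y - Real.log X)^2) * g y) := by
        refine intervalIntegral.integral_mono_on (by linarith) ?_ ?_ ?_
        · exact (hgc.mul Real.continuous_exp).intervalIntegrable _ _
        · exact (hi2.const_mul _).intervalIntegrable
        · rintro y ⟨h1, h2⟩
          have hy : Real.exp y ≤ 2 * X := by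
            rw [← Real.le_log_iff_exp_le (by positivity)]; exact h2
          have hE : 1 ≤ 3 * Real.exp (-(y - Real.log X)^2) := by
            have : Real.exp (-1) ≤ Real.exp (-(y - Real.log X)^2) := by
              apply Real.exp_le_exp.2; nlinarith
            have h3 : (1:ℝ)/3 ≤ Real.exp (-1) := by
              rw [Real.exp_neg, one_div]
              gcongr
              linarith [Real.exp_one_lt_d9]
            linarith
          have hg0 : 0 ≤ g y := by positivity
          calc g y * Real.exp y ≤ g y * (2 * X) := by gcongr
            _ = g y * (2 * X) * 1 := by ring
            _ ≤ g y * (2 * X) * (3 * Real.exp (-(y - Real.log X)^2)) := by gcongr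
            _ = _ := by ring
    _ ≤ ∫ y, 6 * X * (Real.exp (-(y - Real.log X)^2) * g y) := by
        rw [intervalIntegral.integral_of_le (by linarith)]
        exact setIntegral_le_integral (hi2.const_mul _) (Eventually.of_forall fun y => by simp only [Pi.zero_apply]; positivity)
    _ ≤ _ := by
        rw [integral_const_mul]
        have := integral_gaussian_mul_oscillatory_sq_le hν κ (Real.log X)
        calc _ ≤ 6 * X * (2 * ∫ p : ℝ × ℝ, ‖ν p.1‖ * ‖ν p.2‖ * Real.exp (-(κ * (p.1 - p.2))^2/4)) := by gcongr
          _ = _ := by ring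

lemma exp_neg_sq_mul_le {κ : ℝ} (hκ : 1/2 ≤ κ) (x : ℝ) :
    Real.exp (-(κ * x)^2/4) * (1 + |x|) ≤ 2 * (48^3 * Real.exp (1/16)) * (1 / (1 + x^2)^2) := by
  have h1 : Real.exp (-(κ * x)^2/4) ≤ Real.exp (-(x^2/16)) := by
    apply Real.exp_le_exp.2
    have : (1/4) * x^2 ≤ (κ * x)^2 := by
      rw [mul_pow]; gcongr; nlinarith
    linarith
  have h2 : (1 + x^2)^3 * Real.exp (-(x^2/16)) ≤ 48^3 * Real.exp (1/16) := by
    have h3 : (1 + x^2)/48 ≤ Real.exp ((1 + x^2)/48) := by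
      have := Real.add_one_le_exp ((1 + x^2)/48); linarith
    have h4 : ((1 + x^2)/48)^3 ≤ Real.exp ((1 + x^2)/48)^3 := by gcongr
    rw [← Real.exp_nat_mul] at h4
    have h5 : (1 + x^2)^3 ≤ 48^3 * Real.exp (1/16 + x^2/16) := by
      have : (1 + x^2)^3 = 48^3 * ((1 + x^2)/48)^3 := by ring
      rw [this]
      refine mul_le_mul_of_nonneg_left (h4.trans (le_of_eq ?_)) (by norm_num)
      congr 1; push_cast; ring
    calc _ ≤ (48^3 * Real.exp (1/16 + x^2/16)) * Real.exp (-(x^2/16)) := by gcongr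
      _ = 48^3 * (Real.exp (1/16 + x^2/16) * Real.exp (-(x^2/16))) := by ring
      _ = _ := by rw [← Real.exp_add]; congr 2; ring
  have h6 : 1 + |x| ≤ 2 * (1 + x^2) := by
    have := sq_abs x
    nlinarith [sq_nonneg (|x| - 1)]
  rw [mul_one_div, le_div_iff₀ (by positivity)]
  calc _ ≤ Real.exp (-(x^2/16)) * (2 * (1 + x^2)) * (1 + x^2)^2 := by gcongr
    _ = 2 * ((1 + x^2)^3 * Real.exp (-(x^2/16))) := by ring
    _ ≤ 2 * (48^3 * Real.exp (1/16)) := by gcongr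

lemma one_div_abs_add_le {T : ℝ} (hT : 1 ≤ T) (τ τ' : ℝ) : 1 / (|τ'| + T) ≤ (1 / (|τ| + T)) * (1 + |τ' - τ|) := by
  have h1 := abs_nonneg τ
  have h2 := abs_nonneg τ'
  have h3 := abs_nonneg (τ' - τ)
  have h4 : |τ| ≤ |τ'| + |τ' - τ| := by
    have := abs_sub_abs_le_abs_sub τ τ'
    rw [abs_sub_comm] at this; linarith
  rw [one_div_mul_eq_div, div_le_div_iff₀ (by linarith) (by linarith)]
  nlinarith

open MeasureTheory in
lemma exists_bilinear_gaussian_le (hRH : RiemannHypothesis) : ∃ C : ℝ, 0 < C ∧ ∀ δ : ℝ, 0 < δ → δ ≤ 1/4 →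
    ∀ κ : ℝ, 1/2 ≤ κ → ∀ T : ℝ, 1 ≤ T → ∀ B : ℝ, 0 ≤ B → ∀ ν : ℝ → ℂ, Integrable ν →
    (∀ τ, ‖ν τ‖ ≤ absReF δ τ * (B * (1 / (|τ| + T)))) →
    ∫ p : ℝ × ℝ, ‖ν p.1‖ * ‖ν p.2‖ * Real.exp (-(κ * (p.1 - p.2))^2/4) ≤ C * B^2 * Real.log (T + 5)^2 / T := by
  obtain ⟨C1, hC1, h1⟩ := exists_lintegral_absReF_div_le hRH
  obtain ⟨C2, hC2, h2⟩ := exists_lintegral_absReF_mul_le hRH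
  obtain ⟨C3, hC3, h3⟩ := exists_lintegral_ell_sq_div_le
  set D : ℝ := 2 * (48^3 * Real.exp (1/16)) with hD
  have hD0 : 0 < D := by positivity
  refine ⟨D * C1 * (C2 * 4) * C3, by positivity, fun δ hδ hδ4 κ hκ T hT B hB ν hν hb => ?_⟩
  have hm : AEStronglyMeasurable (fun p : ℝ × ℝ => ‖ν p.1‖ * ‖ν p.2‖ * Real.exp (-(κ * (p.1 - p.2))^2/4)) (volume.prod volume) :=
    (hν.norm.mul_prod hν.norm).aestronglyMeasurable.mul
      (by fun_prop : Continuous fun p : ℝ × ℝ => Real.exp (-(κ * (p.1 - p.2))^2/4)).aestronglyMeasurable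
  have hcont := continuous_absReF hRH hδ
  have hF0 := absReF_nonneg δ
  set b : ℝ → ℝ := fun τ => 1 / (|τ| + T) with hbdef
  have hb0 : ∀ τ, 0 ≤ b τ := fun τ => by positivity
  rw [Measure.volume_eq_prod, integral_eq_lintegral_of_nonneg_ae (Eventually.of_forall fun p => by simp only [Pi.zero_apply]; positivity) hm]
  refine ENNReal.toReal_le_of_le_ofReal (by positivity) ?_
  rw [lintegral_prod _ hm.aemeasurable.ennreal_ofReal]
  have hinner : ∀ τ, ∫⁻ τ', ENNReal.ofReal (‖ν τ‖ * ‖ν τ'‖ * Real.exp (-(κ * (τ - τ'))^2/4)) ≤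
      ENNReal.ofReal (D * C1 * B^2) * ENNReal.ofReal (absReF δ τ * (ell τ * b τ^2)) := by
    intro τ
    calc _ ≤ ∫⁻ τ', ENNReal.ofReal (absReF δ τ * (B * b τ) * (B * b τ * D)) * ENNReal.ofReal (absReF δ τ' * (1 / (1 + (τ' - τ)^2)^2)) := by
          refine lintegral_mono fun τ' => ?_
          simp only
          rw [← ENNReal.ofReal_mul (mul_nonneg (mul_nonneg (hF0 τ) (mul_nonneg hB (hb0 τ))) (mul_nonneg (mul_nonneg hB (hb0 τ)) hD0.le))]
          refine ENNReal.ofReal_le_ofReal ?_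
          have e1 := exp_neg_sq_mul_le hκ (τ - τ')
          have e2 : b τ' ≤ b τ * (1 + |τ - τ'|) := by
            have := one_div_abs_add_le hT τ τ'
            rwa [abs_sub_comm τ' τ] at this
          have e3 : (τ' - τ)^2 = (τ - τ')^2 := by ring
          rw [e3]
          have := hF0 τ
          have := hF0 τ'
          have := hb0 τ
          have := hb0 τ'
          calc _ ≤ (absReF δ τ * (B * b τ)) * (absReF δ τ' * (B * (b τ * (1 + |τ - τ'|)))) * Real.exp (-(κ * (τ - τ'))^2/4) := by
                gcongr
                · exact hb τ
                · exact (hb τ').trans (by gcongr)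
            _ = (absReF δ τ * (B * b τ)) * (absReF δ τ' * (B * b τ)) * (Real.exp (-(κ * (τ - τ'))^2/4) * (1 + |τ - τ'|)) := by ring
            _ ≤ (absReF δ τ * (B * b τ)) * (absReF δ τ' * (B * b τ)) * (D * (1 / (1 + (τ - τ')^2)^2)) := by gcongr
            _ = _ := by ring
      _ ≤ ENNReal.ofReal (absReF δ τ * (B * b τ) * (B * b τ * D)) * ENNReal.ofReal (C1 * ell τ) := by
          rw [lintegral_const_mul' _ _ ENNReal.ofReal_ne_top]
          gcongr
          exact h1 δ hδ hδ4 τ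
      _ = _ := by
          rw [← ENNReal.ofReal_mul (mul_nonneg (mul_nonneg (hF0 τ) (mul_nonneg hB (hb0 τ))) (mul_nonneg (mul_nonneg hB (hb0 τ)) hD0.le)),
            ← ENNReal.ofReal_mul (by positivity)]
          ring_nf
  calc _ ≤ ∫⁻ τ, ENNReal.ofReal (D * C1 * B^2) * ENNReal.ofReal (absReF δ τ * (ell τ * b τ^2)) := lintegral_mono hinner
    _ = ENNReal.ofReal (D * C1 * B^2) * ∫⁻ τ, ENNReal.ofReal (absReF δ τ * (ell τ * b τ^2)) := by
        rw [lintegral_const_mul' _ _ ENNReal.ofReal_ne_top]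
    _ ≤ ENNReal.ofReal (D * C1 * B^2) * (ENNReal.ofReal (C2 * 4) * ENNReal.ofReal (C3 * Real.log (T + 5)^2 / T)) := by
        gcongr
        refine (h2 δ hδ hδ4 (fun τ => ell τ * b τ^2) 4 ?_ (fun τ => mul_nonneg (ell_nonneg τ) (sq_nonneg _)) (by norm_num) ?_).trans ?_
        · have := measurable_ell
          fun_prop
        · intro τ τ' h
          have e1 := ell_le_add τ' τ
          have e2 := one_div_abs_add_le hT τ τ'
          rw [abs_sub_comm] at h
          have e3 : ell τ' ≤ ell τ * (3/2) := e1.trans (mul_le_mul_of_nonneg_left (by linarith) (ell_nonneg τ))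
          have e4 : b τ' ≤ b τ * (3/2) := e2.trans (mul_le_mul_of_nonneg_left (by linarith) (hb0 τ))
          have := ell_nonneg τ
          have := ell_nonneg τ'
          have := hb0 τ'
          calc ell τ' * b τ'^2 ≤ (ell τ * (3/2)) * (b τ * (3/2))^2 := by gcongr
            _ = 27/8 * (ell τ * b τ^2) := by ring
            _ ≤ _ := by gcongr; norm_num
        · gcongr
          exact h3 T hT
    _ = _ := by
        rw [← ENNReal.ofReal_mul (by positivity), ← ENNReal.ofReal_mul (by positivity)]
        ring_nf

open MeasureTheory in
/-- The Gram-type mean-square bound for oscillatory integrals with coefficients dominated by `absReF`. -/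
lemma exists_meanSquare_oscillatory_le (hRH : RiemannHypothesis) : ∃ C : ℝ, 0 < C ∧ ∀ δ : ℝ, 0 < δ → δ ≤ 1/4 →
    ∀ κ : ℝ, 1/2 ≤ κ → ∀ T : ℝ, 1 ≤ T → ∀ B : ℝ, 0 ≤ B → ∀ ν : ℝ → ℂ, Integrable ν →
    (∀ τ, ‖ν τ‖ ≤ absReF δ τ * (B * (1 / (|τ| + T)))) → ∀ X : ℝ, 0 < X →
    ∫ v in X..2*X, ‖∫ τ, ν τ * Complex.exp ((κ:ℂ) * τ * Real.log v * Complex.I)‖^2 ≤ C * X * (B^2 * Real.log (T + 5)^2 / T) := by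
  obtain ⟨C, hC, h⟩ := exists_bilinear_gaussian_le hRH
  refine ⟨12 * C, by positivity, fun δ hδ hδ4 κ hκ T hT B hB ν hν hb X hX => ?_⟩
  refine (integral_oscillatory_log_sq_le hν κ hX).trans ?_
  have := h δ hδ hδ4 κ hκ T hT B hB ν hν hb
  calc _ ≤ 12 * X * (C * B^2 * Real.log (T + 5)^2 / T) := by gcongr
    _ = _ := by ring

lemma norm_exp_sub_one_le_four {z : ℂ} (h : z.re ≤ 1) : ‖Complex.exp z - 1‖ ≤ 4 ∧ ‖Complex.exp z - 1‖ ≤ 4 * ‖z‖ := by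
  have h4 : ‖Complex.exp z - 1‖ ≤ 4 := by
    have h1 := norm_sub_le (Complex.exp z) 1
    rw [Complex.norm_exp, norm_one] at h1
    have h2 : Real.exp z.re ≤ Real.exp 1 := Real.exp_le_exp.2 h
    linarith [Real.exp_one_lt_d9]
  refine ⟨h4, ?_⟩
  rcases le_total ‖z‖ 1 with hz | hz
  · have := Complex.norm_exp_sub_one_le hz
    linarith [norm_nonneg z]
  · linarith

lemma norm_line_lower {δ : ℝ} (hδ : 0 < δ) (τ : ℝ) : (|τ| + 5) / 11 ≤ ‖(1/2 + δ + τ * Complex.I : ℂ)‖ := by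
  have h1 := Complex.abs_re_le_norm (1/2 + δ + τ * Complex.I : ℂ)
  have h2 := Complex.abs_im_le_norm (1/2 + δ + τ * Complex.I : ℂ)
  have e1 : (1/2 + δ + τ * Complex.I : ℂ).re = 1/2 + δ := by simp
  have e2 : (1/2 + δ + τ * Complex.I : ℂ).im = τ := by simp
  rw [e1, abs_of_pos (by linarith)] at h1
  rw [e2] at h2
  linarith

open MeasureTheory in
lemma exists_oscillatory_rep (hRH : RiemannHypothesis) : ∃ C : ℝ, 0 < C ∧ ∀ δ : ℝ, 0 < δ → δ ≤ 1/4 →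
    ∃ α : ℝ, |α| ≤ C ∧ ∀ ε : ℝ, 0 < ε → ε ≤ 1 → ∃ ρ : ℝ → ℂ, Integrable ρ ∧ Continuous ρ ∧
      (∀ τ, ‖ρ τ‖ ≤ absReF δ τ * (C * (1 / (|τ| + 5)))) ∧
      (∀ τ, ‖ρ τ‖ ≤ absReF δ τ * (C / ε * (1 / (|τ| + 5)) ^ 2)) ∧
      ∀ y : ℝ, 0 ≤ y → (((rieszE (y + ε) - rieszE y) / ε + α : ℝ) : ℂ) =
        ∫ τ, ρ τ * Complex.exp ((1/2 + δ + τ * Complex.I) * y) := by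
  obtain ⟨C, hC, h⟩ := exists_integral_re_zetaF_kernel hRH
  refine ⟨C + 4 * 11 ^ 2, by positivity, fun δ hδ hδ4 => ?_⟩
  obtain ⟨α, β, hα, h⟩ := h δ hδ hδ4
  refine ⟨α, by linarith, fun ε hε hε1 => ?_⟩
  have cF : Continuous (fun τ : ℝ => zetaF (1/2 + δ + τ * Complex.I)) := by
    have := continuous_zetaF_line hRH (σ := 1/2 + δ) (by linarith)
    push_cast at this; exact this
  have hs0 : ∀ τ : ℝ, (1/2 + δ + τ * Complex.I : ℂ) ≠ 0 := by
    intro τ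
    have := line_ne_zero (a := 1/2 + δ) (by linarith) τ
    push_cast at this; exact this
  have hε' : (ε:ℂ) ≠ 0 := by exact_mod_cast hε.ne'
  have hpi : (Real.pi:ℂ) ≠ 0 := by exact_mod_cast Real.pi_ne_zero
  set ρ : ℝ → ℂ := fun τ => ((zetaF (1/2 + δ + τ * Complex.I)).re : ℂ) * ((Complex.exp ((1/2 + δ + τ * Complex.I) * ε) - 1) /
    (Real.pi * ε * (1/2 + δ + τ * Complex.I)^2)) with hρ
  have e0 : ∀ y : ℝ, ∀ τ : ℝ, ρ τ * Complex.exp ((1/2 + δ + τ * Complex.I) * y) = (1 / (2 * Real.pi * ε)) *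
    (((2 * (zetaF (1/2 + δ + τ * Complex.I)).re : ℝ) : ℂ) * (Complex.exp ((1/2 + δ + τ * Complex.I) * (y + ε : ℝ)) / (1/2 + δ + τ * Complex.I)^2) -
    ((2 * (zetaF (1/2 + δ + τ * Complex.I)).re : ℝ) : ℂ) * (Complex.exp ((1/2 + δ + τ * Complex.I) * y) / (1/2 + δ + τ * Complex.I)^2)) := by
    intro y τ
    have := hs0 τ
    have e : Complex.exp ((1/2 + δ + τ * Complex.I) * (y + ε : ℝ)) = Complex.exp ((1/2 + δ + τ * Complex.I) * y) * Complex.exp ((1/2 + δ + τ * Complex.I) * ε) := by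
      rw [← Complex.exp_add]; push_cast; ring_nf
    rw [hρ, e]
    simp only
    push_cast
    generalize Complex.exp ((1/2 + δ + τ * Complex.I) * y) = A
    generalize Complex.exp ((1/2 + δ + τ * Complex.I) * ε) = A'
    generalize (1/2 + δ + τ * Complex.I : ℂ) = s at *
    field_simp
  have hi : Integrable ρ := by
    have i1 := ((h (0 + ε) (by linarith)).2.sub (h 0 le_rfl).2).const_mul (1 / (2 * Real.pi * ε) : ℂ)
    refine i1.congr (Eventually.of_forall fun τ => ?_)
    have := e0 0 τ
    simp only [Pi.sub_apply]
    rw [← this]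
    simp
  have hn : ∀ τ, ‖ρ τ‖ = absReF δ τ * (‖Complex.exp ((1/2 + δ + τ * Complex.I) * ε) - 1‖ / (Real.pi * ε * ‖(1/2 + δ + τ * Complex.I : ℂ)‖^2)) := by
    intro τ
    rw [hρ]
    simp only
    rw [norm_mul, norm_div, norm_mul, norm_mul, norm_pow, Complex.norm_real, Complex.norm_real, Complex.norm_real, Real.norm_of_nonneg hε.le,
      Real.norm_of_nonneg Real.pi_pos.le]
    rfl
  have hre : ∀ τ : ℝ, ((1/2 + δ + τ * Complex.I) * ε : ℂ).re ≤ 1 := by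
    intro τ
    simp
    nlinarith
  refine ⟨ρ, hi, ?_, fun τ => ?_, fun τ => ?_, fun y hy => ?_⟩
  · refine (Complex.continuous_ofReal.comp (Complex.continuous_re.comp cF)).mul ?_
    refine Continuous.div (by fun_prop) (by fun_prop) fun τ => ?_
    exact mul_ne_zero (mul_ne_zero hpi hε') (pow_ne_zero _ (hs0 τ))
  · rw [hn]
    refine mul_le_mul_of_nonneg_left ?_ (absReF_nonneg δ τ)
    have h1 := (norm_exp_sub_one_le_four (hre τ)).2
    have h2 := norm_line_lower hδ τ
    rw [norm_mul, Complex.norm_real, Real.norm_of_nonneg hε.le] at h1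
    set A := ‖(1/2 + δ + τ * Complex.I : ℂ)‖ with hA
    have hτ : 0 < (|τ| + 5) / 11 := by positivity
    have hA0 : 0 < A := hτ.trans_le h2
    calc _ ≤ (4 * (A * ε)) / (1 * ε * A^2) := by
          gcongr
          linarith [Real.pi_gt_three]
      _ = 4 * (1 / A) := by field_simp
      _ ≤ 4 * (1 / ((|τ| + 5) / 11)) := by gcongr
      _ = (4 * 11) * (1 / (|τ| + 5)) := by field_simp
      _ ≤ _ := by gcongr; linarith
  · rw [hn]
    refine mul_le_mul_of_nonneg_left ?_ (absReF_nonneg δ τ)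
    have h1 := (norm_exp_sub_one_le_four (hre τ)).1
    have h2 := norm_line_lower hδ τ
    set A := ‖(1/2 + δ + τ * Complex.I : ℂ)‖ with hA
    have hτ : 0 < (|τ| + 5) / 11 := by positivity
    have hA0 : 0 < A := hτ.trans_le h2
    calc _ ≤ 4 / (1 * ε * ((|τ| + 5) / 11)^2) := by
          gcongr
          linarith [Real.pi_gt_three]
      _ = (4 * 11 ^ 2) / ε * (1 / (|τ| + 5))^2 := by field_simp
      _ ≤ _ := by gcongr; linarith
  · simp_rw [e0 y]
    rw [integral_const_mul, integral_sub (h (y + ε) (by linarith)).2 (h y hy).2, (h (y + ε) (by linarith)).1, (h y hy).1]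
    push_cast
    field_simp
    ring

/-- `∫ ρ(τ) v^{κ s} dτ` along the line `Re s = 1/2 + δ`. -/
noncomputable def lineInt (δ κ : ℝ) (ρ : ℝ → ℂ) (v : ℝ) : ℂ :=
  ∫ τ : ℝ, ρ τ * Complex.exp ((1/2 + δ + τ * Complex.I) * ((κ * Real.log v : ℝ) : ℂ))

lemma lineInt_eq (δ κ : ℝ) (ρ : ℝ → ℂ) (v : ℝ) :
    lineInt δ κ ρ v = (Real.exp ((1/2 + δ) * (κ * Real.log v)) : ℝ) *
      ∫ τ : ℝ, ρ τ * Complex.exp ((κ:ℂ) * τ * Real.log v * Complex.I) := by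
  unfold lineInt
  rw [← MeasureTheory.integral_const_mul]
  congr 1; ext τ
  push_cast
  have h : Complex.exp ((1/2 + δ + τ * Complex.I) * (κ * Real.log v)) =
      Complex.exp ((1/2 + δ) * (κ * Real.log v)) * Complex.exp (κ * τ * Real.log v * Complex.I) := by
    rw [← Complex.exp_add]; congr 1; ring_nf
  rw [h]; ring

lemma norm_lineInt (δ κ : ℝ) (ρ : ℝ → ℂ) (v : ℝ) :
    ‖lineInt δ κ ρ v‖ = Real.exp ((1/2 + δ) * (κ * Real.log v)) *
      ‖∫ τ : ℝ, ρ τ * Complex.exp ((κ:ℂ) * τ * Real.log v * Complex.I)‖ := by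
  rw [lineInt_eq, norm_mul, Complex.norm_real, Real.norm_of_nonneg (Real.exp_pos _).le]

open MeasureTheory in
lemma continuousOn_lineInt {ρ : ℝ → ℂ} (hρ : Integrable ρ) (δ κ : ℝ) : ContinuousOn (lineInt δ κ ρ) (Set.Ioi 0) := by
  have hl : ContinuousOn Real.log (Set.Ioi 0) := Real.continuousOn_log.mono fun x hx => (ne_of_gt hx)
  have : ContinuousOn (fun v => (Real.exp ((1/2 + δ) * (κ * Real.log v)) : ℝ) *
      ∫ τ : ℝ, ρ τ * Complex.exp ((κ:ℂ) * τ * Real.log v * Complex.I)) (Set.Ioi 0) := by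
    refine ContinuousOn.mul ?_ ((continuous_oscillatory hρ κ).comp_continuousOn hl)
    have : Continuous fun y : ℝ => ((Real.exp ((1/2 + δ) * (κ * y)) : ℝ) : ℂ) := by fun_prop
    exact this.comp_continuousOn hl
  exact this.congr fun v _ => lineInt_eq δ κ ρ v

lemma exp_line_sq_le {δ κ v : ℝ} (hκ : κ ≤ 1) (hδ : 0 < δ) (hv : 1 ≤ v) (hv2 : Real.log v ≤ 2 / δ) :
    Real.exp ((1/2 + δ) * (κ * Real.log v))^2 ≤ Real.exp 4 * v ^ κ := by
  have hl := Real.log_nonneg hv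
  rw [Real.rpow_def_of_pos (by linarith), ← Real.exp_add, ← Real.exp_nat_mul]
  apply Real.exp_le_exp.2
  rw [le_div_iff₀ hδ] at hv2
  push_cast
  nlinarith [mul_nonneg (sub_nonneg.2 hκ) (mul_nonneg hl hδ.le)]

open MeasureTheory in
lemma exists_meanSquare_lineInt_le (hRH : RiemannHypothesis) : ∃ C : ℝ, 0 < C ∧ ∀ δ : ℝ, 0 < δ → δ ≤ 1/4 →
    ∀ κ : ℝ, 1/2 ≤ κ → κ ≤ 1 → ∀ T : ℝ, 1 ≤ T → ∀ B : ℝ, 0 ≤ B → ∀ ν : ℝ → ℂ, Integrable ν →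
    (∀ τ, ‖ν τ‖ ≤ absReF δ τ * (B * (1 / (|τ| + T)))) → ∀ X : ℝ, 1 ≤ X → Real.log (2 * X) ≤ 2 / δ →
    ∫ v in X..2*X, ‖lineInt δ κ ν v‖^2 ≤ C * X ^ κ * X * (B^2 * Real.log (T + 5)^2 / T) := by
  obtain ⟨C, hC, h⟩ := exists_meanSquare_oscillatory_le hRH
  refine ⟨Real.exp 4 * 2 * C, by positivity, fun δ hδ hδ4 κ hκ hκ1 T hT B hB ν hν hb X hX hX2 => ?_⟩
  have hX0 : 0 < X := by linarith
  have hsub : Set.uIcc X (2*X) ⊆ Set.Ioi 0 := by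
    rw [Set.uIcc_of_le (by linarith)]
    exact fun v hv => lt_of_lt_of_le hX0 hv.1
  have hl : ContinuousOn Real.log (Set.uIcc X (2*X)) := Real.continuousOn_log.mono fun x hx => (ne_of_gt (hsub hx))
  calc ∫ v in X..2*X, ‖lineInt δ κ ν v‖^2 
      ≤ ∫ v in X..2*X, Real.exp 4 * (2 * X ^ κ) * ‖∫ τ, ν τ * Complex.exp ((κ:ℂ) * τ * Real.log v * Complex.I)‖^2 := by
        refine intervalIntegral.integral_mono_on (by linarith) ?_ ?_ ?_
        · exact (((continuousOn_lineInt hν δ κ).mono hsub).norm.pow 2).intervalIntegrable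
        · exact ((((continuous_oscillatory hν κ).comp_continuousOn hl).norm.pow 2).const_smul (Real.exp 4 * (2 * X ^ κ))).intervalIntegrable
        · rintro v ⟨h1, h2⟩
          rw [norm_lineInt, mul_pow]
          refine mul_le_mul_of_nonneg_right ?_ (by positivity)
          refine (exp_line_sq_le hκ1 hδ (by linarith) ((Real.log_le_log (by linarith) h2).trans hX2)).trans ?_
          refine mul_le_mul_of_nonneg_left ?_ (Real.exp_pos _).le
          calc v ^ κ ≤ (2 * X) ^ κ := Real.rpow_le_rpow (by linarith) h2 (by linarith)
            _ = 2 ^ κ * X ^ κ := Real.mul_rpow (by norm_num) hX0.le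
            _ ≤ 2 ^ (1:ℝ) * X ^ κ := by gcongr; norm_num
            _ = _ := by rw [Real.rpow_one]
    _ ≤ Real.exp 4 * (2 * X ^ κ) * (C * X * (B^2 * Real.log (T + 5)^2 / T)) := by
        rw [intervalIntegral.integral_const_mul]
        have := h δ hδ hδ4 κ hκ T hT B hB ν hν hb X hX0
        gcongr
    _ = _ := by ring

open MeasureTheory in
lemma lineInt_sub_eq {δ κ : ℝ} {ν : ℝ → ℂ} (hν : Integrable ν)
    (hν' : Integrable fun τ : ℝ => (1/2 + δ + τ * Complex.I) * ν τ) {v w : ℝ} (hv : 0 < v) (hvw : v ≤ w) :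
    lineInt δ κ ν w - lineInt δ κ ν v =
      ∫ r in v..w, ((κ / r : ℝ) : ℂ) * lineInt δ κ (fun τ : ℝ => (1/2 + δ + τ * Complex.I) * ν τ) r := by
  have hInt : ∀ r : ℝ, Integrable fun τ : ℝ => ν τ * Complex.exp ((1/2 + δ + τ * Complex.I) * ((κ * Real.log r : ℝ) : ℂ)) := by
    intro r
    refine (hν.norm.mul_const (Real.exp ((1/2 + δ) * (κ * Real.log r)))).mono' ?_ (Eventually.of_forall fun τ => ?_)
    · exact hν.aestronglyMeasurable.mul (by fun_prop : Continuous fun τ : ℝ => Complex.exp ((1/2 + δ + τ * Complex.I) * ((κ * Real.log r : ℝ) : ℂ))).aestronglyMeasurable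
    · rw [norm_mul, Complex.norm_exp]
      simp
  have hder : ∀ τ : ℝ, ν τ * Complex.exp ((1/2 + δ + τ * Complex.I) * ((κ * Real.log w : ℝ) : ℂ)) - ν τ * Complex.exp ((1/2 + δ + τ * Complex.I) * ((κ * Real.log v : ℝ) : ℂ)) =
      ∫ r in v..w, ((κ / r : ℝ) : ℂ) * (((1/2 + δ + τ * Complex.I) * ν τ) * Complex.exp ((1/2 + δ + τ * Complex.I) * ((κ * Real.log r : ℝ) : ℂ))) := by
    intro τ
    symm
    refine intervalIntegral.integral_eq_sub_of_hasDerivAt (f := fun r : ℝ => ν τ * Complex.exp ((1/2 + δ + τ * Complex.I) * ((κ * Real.log r : ℝ) : ℂ))) (fun r hr => ?_) ?_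
    · rw [Set.uIcc_of_le hvw] at hr
      have hr0 : r ≠ 0 := (hv.trans_le hr.1).ne'
      have h1 : HasDerivAt (fun r : ℝ => ((κ * Real.log r : ℝ) : ℂ)) ((κ * r⁻¹ : ℝ) : ℂ) r :=
        ((Real.hasDerivAt_log hr0).const_mul κ).ofReal_comp
      have h2 := ((h1.const_mul (1/2 + δ + τ * Complex.I)).cexp).const_mul (ν τ)
      refine h2.congr_deriv ?_
      rw [div_eq_mul_inv]
      ring
    · refine ContinuousOn.intervalIntegrable ?_
      rw [Set.uIcc_of_le hvw]
      have hne : ∀ r ∈ Set.Icc v w, r ≠ 0 := fun r hr => (hv.trans_le hr.1).ne'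
      have hl : ContinuousOn Real.log (Set.Icc v w) := Real.continuousOn_log.mono fun r hr => hne r hr
      refine ContinuousOn.mul ?_ (continuousOn_const.mul ?_)
      · exact Complex.continuous_ofReal.comp_continuousOn (continuousOn_const.div continuousOn_id hne)
      · have : Continuous fun y : ℝ => Complex.exp ((1/2 + δ + τ * Complex.I) * ((κ * y : ℝ) : ℂ)) := by fun_prop
        exact this.comp_continuousOn hl
  unfold lineInt
  rw [← integral_sub (hInt w) (hInt v)]
  simp_rw [hder, intervalIntegral.integral_of_le hvw]
  have hswap := integral_integral_swap (μ := volume) (ν := volume.restrict (Set.Ioc v w))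
    (f := fun τ r => ((κ / r : ℝ) : ℂ) * (((1/2 + δ + τ * Complex.I) * ν τ) * Complex.exp ((1/2 + δ + τ * Complex.I) * ((κ * Real.log r : ℝ) : ℂ)))) ?_
  · rw [hswap]
    congr 1; ext r
    rw [integral_const_mul]
  · obtain ⟨M, hM⟩ : ∃ M : ℝ, ∀ r ∈ Set.Icc v w, |κ / r| * Real.exp ((1/2 + δ) * (κ * Real.log r)) ≤ M := by
      have hne : ∀ r ∈ Set.Icc v w, r ≠ 0 := fun r hr => (hv.trans_le hr.1).ne'
      have hl : ContinuousOn Real.log (Set.Icc v w) := Real.continuousOn_log.mono fun r hr => hne r hr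
      have hc : ContinuousOn (fun r : ℝ => |κ / r| * Real.exp ((1/2 + δ) * (κ * Real.log r))) (Set.Icc v w) := by
        refine ContinuousOn.mul (continuousOn_const.div continuousOn_id hne).abs ?_
        have : Continuous fun y : ℝ => Real.exp ((1/2 + δ) * (κ * y)) := by fun_prop
        exact this.comp_continuousOn hl
      obtain ⟨M, hM⟩ := isCompact_Icc.exists_bound_of_continuousOn hc
      exact ⟨M, fun r hr => (le_abs_self _).trans (hM r hr)⟩
    have ig : Integrable (fun p : ℝ × ℝ => ((1/2 + δ + p.1 * Complex.I) * ν p.1) * (1:ℂ)) (volume.prod (volume.restrict (Set.Ioc v w))) := by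
      refine hν'.mul_prod (integrable_const (1:ℂ))
    refine (ig.norm.mul_const M).mono' ?_ ?_
    · simp only [mul_one] at ig
      refine AEStronglyMeasurable.mul ?_ (ig.aestronglyMeasurable.mul ?_)
      · exact (by fun_prop : Measurable fun p : ℝ × ℝ => ((κ / p.2 : ℝ) : ℂ)).aestronglyMeasurable
      · exact (by fun_prop : Measurable fun p : ℝ × ℝ => Complex.exp ((1/2 + δ + p.1 * Complex.I) * ((κ * Real.log p.2 : ℝ) : ℂ))).aestronglyMeasurable
    · have hae : ∀ᵐ p : ℝ × ℝ ∂(volume.prod (volume.restrict (Set.Ioc v w))), p.2 ∈ Set.Ioc v w :=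
        Measure.quasiMeasurePreserving_snd.ae (ae_restrict_mem measurableSet_Ioc)
      filter_upwards [hae] with p hp
      have := hM p.2 ⟨hp.1.le, hp.2⟩
      simp only [Function.uncurry]
      rw [norm_mul, norm_mul _ (Complex.exp _), Complex.norm_exp, Complex.norm_real, Real.norm_eq_abs, mul_one]
      have e : ((1/2 + δ + p.1 * Complex.I) * ((κ * Real.log p.2 : ℝ) : ℂ) : ℂ).re = (1/2 + δ) * (κ * Real.log p.2) := by simp
      rw [e]
      calc _ = ‖(1/2 + δ + p.1 * Complex.I) * ν p.1‖ * (|κ / p.2| * Real.exp ((1/2 + δ) * (κ * Real.log p.2))) := by ring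
        _ ≤ _ := by gcongr

lemma sq_integral_le {g : ℝ → ℝ} (hg : Continuous g) {a b : ℝ} (hab : a < b) :
    (∫ r in a..b, g r)^2 ≤ (b - a) * ∫ r in a..b, g r ^ 2 := by
  set m := (∫ r in a..b, g r) / (b - a) with hm
  have hba : 0 < b - a := by linarith
  have h0 : 0 ≤ ∫ r in a..b, (g r - m)^2 := intervalIntegral.integral_nonneg hab.le fun r _ => sq_nonneg _
  have e : ∫ r in a..b, (g r - m)^2 = (∫ r in a..b, g r ^ 2) - 2 * m * (∫ r in a..b, g r) + (b - a) * m^2 := by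
    have : ∀ r, (g r - m)^2 = g r ^ 2 - 2 * m * g r + m^2 := fun r => by ring
    simp_rw [this]
    rw [intervalIntegral.integral_add, intervalIntegral.integral_sub, intervalIntegral.integral_const_mul,
      intervalIntegral.integral_const, smul_eq_mul]
    all_goals exact Continuous.intervalIntegrable (by fun_prop) _ _
  have e2 : ∫ r in a..b, g r = m * (b - a) := by rw [hm]; field_simp
  rw [e, e2] at h0
  rw [e2]
  nlinarith

lemma integral_integral_shift_le {q : ℝ → ℝ} (hq : Continuous q) (h0 : ∀ r, 0 ≤ q r) {X h : ℝ} (hX : 0 < X)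
    (hh : 0 ≤ h) (hhX : h ≤ X) :
    ∫ v in X..2*X, (∫ r in v..v+h, q r) ≤ h * ∫ r in X..4*X, q r := by
  set P : ℝ → ℝ := fun v => ∫ r in X..v, q r with hP
  have hii : ∀ a b, IntervalIntegrable q MeasureTheory.volume a b := fun a b => hq.intervalIntegrable a b
  have cP : Continuous P := intervalIntegral.continuous_primitive hii X
  have e : ∀ v, ∫ r in v..v+h, q r = P (v + h) - P v := fun v =>
    (intervalIntegral.integral_interval_sub_left (hii _ _) (hii _ _)).symm
  have mP : Monotone P := by
    intro a b hab
    have := intervalIntegral.integral_interval_sub_left (hii X b) (hii X a)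
    have h2 : 0 ≤ ∫ r in a..b, q r := intervalIntegral.integral_nonneg hab fun r _ => h0 r
    simp only [hP]; linarith
  have hPX : P X = 0 := intervalIntegral.integral_same
  have hiP : ∀ a b, IntervalIntegrable P MeasureTheory.volume a b := fun a b => cP.intervalIntegrable a b
  have hiPh : IntervalIntegrable (fun v => P (v + h)) MeasureTheory.volume X (2*X) :=
    (cP.comp (continuous_add_const h)).intervalIntegrable _ _
  simp_rw [e]
  rw [intervalIntegral.integral_sub hiPh (hiP _ _),
    intervalIntegral.integral_comp_add_right (fun v => P v)]
  have e1 := intervalIntegral.integral_add_adjacent_intervals (hiP (X+h) (2*X)) (hiP (2*X) (2*X+h))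
  have e2 := intervalIntegral.integral_add_adjacent_intervals (hiP X (X+h)) (hiP (X+h) (2*X))
  have b1 : ∫ v in 2*X..2*X+h, P v ≤ ∫ v in 2*X..2*X+h, P (4*X) :=
    intervalIntegral.integral_mono_on (by linarith) (hiP _ _) (Continuous.intervalIntegrable (by fun_prop) _ _)
      fun v hv => mP (by linarith [hv.2])
  have b2 : 0 ≤ ∫ v in X..X+h, P v := intervalIntegral.integral_nonneg (by linarith) fun v hv => by
    rw [← hPX]; exact mP hv.1
  rw [intervalIntegral.integral_const, smul_eq_mul] at b1
  have : 2 * X + h - 2 * X = h := by ring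
  rw [this] at b1
  linarith

lemma meanSquare_integral_shift_le {f : ℝ → ℂ} (hf : Continuous f) {X h : ℝ} (hX : 0 < X)
    (hh : 0 < h) (hhX : h ≤ X) :
    ∫ v in X..2*X, ‖∫ r in v..v+h, f r‖^2 ≤ h^2 * ∫ r in X..4*X, ‖f r‖^2 := by
  have hii : ∀ a b, IntervalIntegrable f MeasureTheory.volume a b := fun a b => hf.intervalIntegrable a b
  have cP : Continuous fun v => ∫ r in v..v+h, f r := by
    have cP := intervalIntegral.continuous_primitive hii X
    have e : ∀ v, ∫ r in v..v+h, f r = (∫ r in X..v+h, f r) - ∫ r in X..v, f r := fun v =>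
      (intervalIntegral.integral_interval_sub_left (hii _ _) (hii _ _)).symm
    simp_rw [e]
    exact (cP.comp (continuous_add_const h)).sub cP
  have cQ : Continuous fun v => ∫ r in v..v+h, ‖f r‖^2 := by
    have hii : ∀ a b, IntervalIntegrable (fun r => ‖f r‖^2) MeasureTheory.volume a b :=
      fun a b => (hf.norm.pow 2).intervalIntegrable a b
    have cP := intervalIntegral.continuous_primitive hii X
    have e : ∀ v, ∫ r in v..v+h, ‖f r‖^2 = (∫ r in X..v+h, ‖f r‖^2) - ∫ r in X..v, ‖f r‖^2 := fun v =>
      (intervalIntegral.integral_interval_sub_left (hii _ _) (hii _ _)).symm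
    simp_rw [e]
    exact (cP.comp (continuous_add_const h)).sub cP
  calc ∫ v in X..2*X, ‖∫ r in v..v+h, f r‖^2 ≤ ∫ v in X..2*X, h * ∫ r in v..v+h, ‖f r‖^2 := by
        refine intervalIntegral.integral_mono_on (by linarith) ((cP.norm.pow 2).intervalIntegrable _ _)
          ((cQ.const_mul h).intervalIntegrable _ _) fun v _ => ?_
        have h1 := intervalIntegral.norm_integral_le_integral_norm (f := f) (μ := MeasureTheory.volume) (show v ≤ v + h by linarith)
        have h2 := sq_integral_le hf.norm (show v < v + h by linarith)
        calc _ ≤ (∫ r in v..v+h, ‖f r‖)^2 := by gcongr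
          _ ≤ _ := h2
          _ = _ := by ring
    _ = h * ∫ v in X..2*X, (∫ r in v..v+h, ‖f r‖^2) := intervalIntegral.integral_const_mul _ _
    _ ≤ h * (h * ∫ r in X..4*X, ‖f r‖^2) := by
        gcongr
        exact integral_integral_shift_le (hf.norm.pow 2) (fun r => sq_nonneg ‖f r‖) hX hh.le hhX
    _ = _ := by ring

open MeasureTheory in
lemma exists_meanSquare_lineInt_diff_le (hRH : RiemannHypothesis) : ∃ C : ℝ, 0 < C ∧ ∀ δ : ℝ, 0 < δ → δ ≤ 1/4 →
    ∀ κ : ℝ, 1/2 ≤ κ → κ ≤ 1 → ∀ B : ℝ, 0 ≤ B → ∀ ρ : ℝ → ℂ, Integrable ρ →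
    (∀ τ, ‖ρ τ‖ ≤ absReF δ τ * (B * (1 / (|τ| + 5)))) → ∀ X h : ℝ, 1 ≤ X → 0 < h → h ≤ X → Real.log (4 * X) ≤ 2 / δ →
    ∫ v in X..2*X, ‖lineInt δ κ ρ (v + h) - lineInt δ κ ρ v‖^2 ≤ C * h * X ^ κ * (B^2 * Real.log (X / h + 5)^2) := by
  obtain ⟨C, hC, hM⟩ := exists_meanSquare_lineInt_le hRH
  refine ⟨132 * C, by positivity, fun δ hδ hδ4 κ hκ hκ1 B hB ρ hρ hb X h hX hh hhX hXδ => ?_⟩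
  have hX0 : 0 < X := by linarith
  set T := X / h with hT
  have hT1 : 1 ≤ T := by rw [hT, le_div_iff₀ hh]; linarith
  have hT0 : 0 < T := by linarith
  have hXT : X / T = h := by rw [hT]; field_simp
  -- mean square over `[X, 4X]`
  have hM4 : ∀ B' : ℝ, 0 ≤ B' → ∀ ν : ℝ → ℂ, Integrable ν → (∀ τ, ‖ν τ‖ ≤ absReF δ τ * (B' * (1 / (|τ| + T)))) →
      (∫ v in X..2*X, ‖lineInt δ κ ν v‖^2 ≤ C * X ^ κ * h * (B'^2 * Real.log (T + 5)^2)) ∧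
      ∫ v in X..4*X, ‖lineInt δ κ ν v‖^2 ≤ 5 * (C * X ^ κ * h * (B'^2 * Real.log (T + 5)^2)) := by
    intro B' hB' ν hν hbν
    have h1 := hM δ hδ hδ4 κ hκ hκ1 T hT1 B' hB' ν hν hbν X hX
      ((Real.log_le_log (by linarith) (by linarith)).trans hXδ)
    have h2 := hM δ hδ hδ4 κ hκ hκ1 T hT1 B' hB' ν hν hbν (2*X) (by linarith)
      (by rw [← mul_assoc]; norm_num; exact hXδ)
    have e1 : C * X ^ κ * X * (B'^2 * Real.log (T + 5)^2 / T) = C * X ^ κ * h * (B'^2 * Real.log (T + 5)^2) := by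
      rw [← hXT]; field_simp
    have e2 : C * (2*X) ^ κ * (2*X) * (B'^2 * Real.log (T + 5)^2 / T) ≤ 4 * (C * X ^ κ * h * (B'^2 * Real.log (T + 5)^2)) := by
      rw [← e1]
      have : (2*X) ^ κ ≤ 2 * X ^ κ := by
        rw [Real.mul_rpow (by norm_num) hX0.le]
        have : (2:ℝ) ^ κ ≤ 2 ^ (1:ℝ) := Real.rpow_le_rpow_of_exponent_le (by norm_num) hκ1
        rw [Real.rpow_one] at this
        gcongr
      calc C * (2*X) ^ κ * (2*X) * (B'^2 * Real.log (T + 5)^2 / T)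
          ≤ C * (2 * X ^ κ) * (2*X) * (B'^2 * Real.log (T + 5)^2 / T) := by gcongr
        _ = _ := by ring
    rw [e1] at h1
    refine ⟨h1, ?_⟩
    have hI : ∀ a b, X ≤ a → a ≤ b → IntervalIntegrable (fun v => ‖lineInt δ κ ν v‖^2) volume a b := by
      intro a b ha hab
      refine ContinuousOn.intervalIntegrable (((continuousOn_lineInt hν δ κ).mono ?_).norm.pow 2)
      rw [Set.uIcc_of_le hab]
      exact fun v hv => hX0.trans_le (ha.trans hv.1)
    have e3 : (2 * (2 * X)) = 4 * X := by ring
    rw [e3] at h2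
    rw [← intervalIntegral.integral_add_adjacent_intervals (hI X (2*X) le_rfl (by linarith)) (hI (2*X) (4*X) (by linarith) (by linarith))]
    linarith
  set S : Set ℝ := {τ | T < |τ|} with hS
  have mS : MeasurableSet S := measurableSet_lt measurable_const measurable_norm
  set hi := S.indicator ρ with hhi
  set lo := Sᶜ.indicator ρ with hlo
  have iS : Integrable hi := hρ.indicator mS
  have iL : Integrable lo := hρ.indicator mS.compl
  have hlin : ∀ v, lineInt δ κ ρ v = lineInt δ κ hi v + lineInt δ κ lo v := by
    intro v
    have hc : ∀ ν : ℝ → ℂ, Integrable ν → Integrable fun τ : ℝ => ν τ * Complex.exp ((1/2 + δ + τ * Complex.I) * ((κ * Real.log v : ℝ) : ℂ)) := by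
      intro ν hν
      refine (hν.norm.mul_const (Real.exp ((1/2 + δ) * (κ * Real.log v)))).mono' ?_ (Eventually.of_forall fun τ => ?_)
      · exact hν.aestronglyMeasurable.mul (by fun_prop : Continuous fun τ : ℝ => Complex.exp ((1/2 + δ + τ * Complex.I) * ((κ * Real.log v : ℝ) : ℂ))).aestronglyMeasurable
      · rw [norm_mul, Complex.norm_exp]
        simp
    unfold lineInt
    rw [← integral_add (hc _ iS) (hc _ iL)]
    congr 1; ext τ
    rw [← add_mul]
    congr 1
    exact (congrFun (Set.indicator_self_add_compl S ρ) τ).symm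
  have bS : ∀ τ, ‖hi τ‖ ≤ absReF δ τ * (2 * B * (1 / (|τ| + T))) := by
    intro τ
    by_cases ht : τ ∈ S
    · rw [hhi, Set.indicator_of_mem ht]
      refine (hb τ).trans (mul_le_mul_of_nonneg_left ?_ (absReF_nonneg δ τ))
      have ht' : T < |τ| := ht
      have : 1 / (|τ| + 5) ≤ 2 * (1 / (|τ| + T)) := by
        rw [mul_one_div, div_le_div_iff₀ (by positivity) (by positivity)]; linarith
      calc B * (1 / (|τ| + 5)) ≤ B * (2 * (1 / (|τ| + T))) := by gcongr
        _ = _ := by ring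
    · rw [hhi, Set.indicator_of_notMem ht, norm_zero]
      have := absReF_nonneg δ τ
      positivity
  set lo' : ℝ → ℂ := fun τ => (1/2 + δ + τ * Complex.I) * lo τ with hlo'
  have bL0 : ∀ τ, ‖lo' τ‖ ≤ absReF δ τ * B ∧ (τ ∈ S → lo' τ = 0) := by
    intro τ
    by_cases ht : τ ∈ S
    · have : lo' τ = 0 := by simp [hlo', hlo, Set.indicator_of_notMem (fun h : τ ∈ Sᶜ => h ht)]
      rw [this, norm_zero]
      exact ⟨mul_nonneg (absReF_nonneg δ τ) hB, fun _ => rfl⟩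
    · refine ⟨?_, fun h => absurd h ht⟩
      have e : lo τ = ρ τ := Set.indicator_of_mem (s := Sᶜ) ht ρ
      have hs : ‖(1/2 + δ + τ * Complex.I : ℂ)‖ ≤ |τ| + 5 := by
        refine (Complex.norm_le_abs_re_add_abs_im _).trans ?_
        have e1 : (1/2 + δ + τ * Complex.I : ℂ).re = 1/2 + δ := by simp
        have e2 : (1/2 + δ + τ * Complex.I : ℂ).im = τ := by simp
        rw [e1, e2, abs_of_pos (by linarith)]
        linarith
      simp only [hlo']
      rw [norm_mul, e]
      calc _ ≤ (|τ| + 5) * (absReF δ τ * (B * (1 / (|τ| + 5)))) := by gcongr; exact hb τ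
        _ = _ := by field_simp
  have bL : ∀ τ, ‖lo' τ‖ ≤ absReF δ τ * (2 * T * B * (1 / (|τ| + T))) := by
    intro τ
    have hr := absReF_nonneg δ τ
    by_cases ht : τ ∈ S
    · rw [(bL0 τ).2 ht, norm_zero]; positivity
    · have ht' : |τ| ≤ T := not_lt.1 ht
      refine (bL0 τ).1.trans (mul_le_mul_of_nonneg_left ?_ hr)
      have : 1 ≤ 2 * T * (1 / (|τ| + T)) := by
        rw [mul_one_div, le_div_iff₀ (by positivity)]; linarith
      calc B = B * 1 := by ring
        _ ≤ B * (2 * T * (1 / (|τ| + T))) := by gcongr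
        _ = _ := by ring
  have iL' : Integrable lo' := by
    refine (iL.norm.const_mul (T + 5)).mono' ?_ (Eventually.of_forall fun τ => ?_)
    · exact (by fun_prop : Continuous fun τ : ℝ => (1/2 + δ + τ * Complex.I : ℂ)).aestronglyMeasurable.mul iL.aestronglyMeasurable
    · by_cases ht : τ ∈ S
      · rw [(bL0 τ).2 ht, norm_zero]; positivity
      · have ht' : |τ| ≤ T := not_lt.1 ht
        simp only [hlo']
        rw [norm_mul]
        gcongr
        refine (Complex.norm_le_abs_re_add_abs_im _).trans ?_
        have e1 : (1/2 + δ + τ * Complex.I : ℂ).re = 1/2 + δ := by simp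
        have e2 : (1/2 + δ + τ * Complex.I : ℂ).im = τ := by simp
        rw [e1, e2, abs_of_pos (by linarith)]
        linarith
  obtain ⟨hS1, hS4⟩ := hM4 (2 * B) (by positivity) hi iS bS
  obtain ⟨-, hL4⟩ := hM4 (2 * T * B) (by positivity) lo' iL' bL
  have cH : ContinuousOn (lineInt δ κ hi) (Set.Ioi 0) := continuousOn_lineInt iS δ κ
  have cL : ContinuousOn (lineInt δ κ lo) (Set.Ioi 0) := continuousOn_lineInt iL δ κ
  have cL' : ContinuousOn (lineInt δ κ lo') (Set.Ioi 0) := continuousOn_lineInt iL' δ κ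
  have hsub : Set.uIcc X (2*X) ⊆ Set.Ioi 0 := by
    rw [Set.uIcc_of_le (by linarith)]
    exact fun v hv => lt_of_lt_of_le hX0 hv.1
  have hmap : Set.MapsTo (fun v => v + h) (Set.uIcc X (2*X)) (Set.Ioi 0) := fun v hv => add_pos (hsub hv) hh
  have cHh : ContinuousOn (fun v => lineInt δ κ hi (v + h)) (Set.uIcc X (2*X)) :=
    cH.comp (continuous_add_const h).continuousOn hmap
  have cLh : ContinuousOn (fun v => lineInt δ κ lo (v + h)) (Set.uIcc X (2*X)) :=
    cL.comp (continuous_add_const h).continuousOn hmap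
  have i1 : IntervalIntegrable (fun v => ‖lineInt δ κ hi (v + h)‖^2) volume X (2*X) :=
    (cHh.norm.pow 2).intervalIntegrable
  have i2 : IntervalIntegrable (fun v => ‖lineInt δ κ hi v‖^2) volume X (2*X) :=
    ((cH.mono hsub).norm.pow 2).intervalIntegrable
  have i3 : IntervalIntegrable (fun v => ‖lineInt δ κ lo (v + h) - lineInt δ κ lo v‖^2) volume X (2*X) :=
    ((cLh.sub (cL.mono hsub)).norm.pow 2).intervalIntegrable
  have main : ∫ v in X..2*X, ‖lineInt δ κ ρ (v + h) - lineInt δ κ ρ v‖^2 ≤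
      3 * ((∫ v in X..2*X, ‖lineInt δ κ hi (v + h)‖^2) + (∫ v in X..2*X, ‖lineInt δ κ hi v‖^2) +
        ∫ v in X..2*X, ‖lineInt δ κ lo (v + h) - lineInt δ κ lo v‖^2) := by
    rw [← intervalIntegral.integral_add i1 i2, ← intervalIntegral.integral_add (i1.add i2) i3, ← intervalIntegral.integral_const_mul]
    refine intervalIntegral.integral_mono_on (by linarith) ?_ (((i1.add i2).add i3).const_mul 3) fun v _ => ?_
    · have := (((cHh.add cLh).sub ((cH.add cL).mono hsub)).norm.pow 2).intervalIntegrable (μ := volume)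
      refine this.congr fun v _ => ?_
      simp only [hlin]
      rfl
    · rw [hlin, hlin]
      have e : lineInt δ κ hi (v + h) + lineInt δ κ lo (v + h) - (lineInt δ κ hi v + lineInt δ κ lo v) =
        lineInt δ κ hi (v + h) - lineInt δ κ hi v + (lineInt δ κ lo (v + h) - lineInt δ κ lo v) := by ring
      rw [e]
      have t1 := norm_add_le (lineInt δ κ hi (v + h) - lineInt δ κ hi v) (lineInt δ κ lo (v + h) - lineInt δ κ lo v)
      have t2 := norm_sub_le (lineInt δ κ hi (v + h)) (lineInt δ κ hi v)
      generalize lineInt δ κ hi (v + h) = a at *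
      generalize lineInt δ κ hi v = b at *
      generalize lineInt δ κ lo (v + h) - lineInt δ κ lo v = c at *
      have : ‖a - b + c‖ ≤ ‖a‖ + ‖b‖ + ‖c‖ := by linarith
      calc ‖a - b + c‖^2 ≤ (‖a‖ + ‖b‖ + ‖c‖)^2 := by gcongr
        _ ≤ 3 * (‖a‖^2 + ‖b‖^2 + ‖c‖^2) := by
          nlinarith [sq_nonneg (‖a‖ - ‖b‖), sq_nonneg (‖a‖ - ‖c‖), sq_nonneg (‖b‖ - ‖c‖)]
  have hpart1 : ∫ v in X..2*X, ‖lineInt δ κ hi (v + h)‖^2 ≤ ∫ v in X..4*X, ‖lineInt δ κ hi v‖^2 := by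
    rw [intervalIntegral.integral_comp_add_right (fun v => ‖lineInt δ κ hi v‖^2)]
    refine intervalIntegral.integral_mono_interval (by linarith) (by linarith) (by linarith) (Eventually.of_forall fun v => by simp only [Pi.zero_apply]; positivity) ?_
    refine ContinuousOn.intervalIntegrable ((cH.mono ?_).norm.pow 2)
    rw [Set.uIcc_of_le (by linarith)]
    exact fun v hv => lt_of_lt_of_le hX0 hv.1
  have hpart3 : ∫ v in X..2*X, ‖lineInt δ κ lo (v + h) - lineInt δ κ lo v‖^2 ≤ h^2 * ((1 / X)^2 * ∫ v in X..4*X, ‖lineInt δ κ lo' v‖^2) := by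
    set f : ℝ → ℂ := fun r => ((κ / (max r X) : ℝ) : ℂ) * lineInt δ κ lo' (max r X) with hf
    have cf : Continuous f := by
      refine Continuous.mul ?_ ?_
      · exact Complex.continuous_ofReal.comp (continuous_const.div (continuous_id.max continuous_const) fun r => (hX0.trans_le (le_max_right r X)).ne')
      · exact cL'.comp_continuous (continuous_id.max continuous_const) fun r => hX0.trans_le (le_max_right r X)
    have e : ∀ v ∈ Set.uIcc X (2*X), lineInt δ κ lo (v + h) - lineInt δ κ lo v = ∫ r in v..v+h, f r := by
      intro v hv
      rw [Set.uIcc_of_le (by linarith)] at hv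
      rw [lineInt_sub_eq iL iL' (hX0.trans_le hv.1) (by linarith)]
      refine intervalIntegral.integral_congr fun r hr => ?_
      rw [Set.uIcc_of_le (by linarith)] at hr
      simp only [hf]
      rw [max_eq_left (hv.1.trans hr.1)]
    rw [intervalIntegral.integral_congr (g := fun v => ‖∫ r in v..v+h, f r‖^2) fun v hv => by simp only [e v hv]]
    refine (meanSquare_integral_shift_le cf hX0 hh hhX).trans ?_
    refine mul_le_mul_of_nonneg_left ?_ (sq_nonneg h)
    rw [← intervalIntegral.integral_const_mul]
    refine intervalIntegral.integral_mono_on (by linarith) ((cf.norm.pow 2).intervalIntegrable _ _) ?_ fun v hv => ?_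
    · refine (ContinuousOn.intervalIntegrable ((cL'.mono ?_).norm.pow 2)).const_mul _
      rw [Set.uIcc_of_le (by linarith)]
      exact fun v hv => lt_of_lt_of_le hX0 hv.1
    · simp only [hf]
      have hv0 : 0 < v := hX0.trans_le hv.1
      rw [max_eq_left hv.1, norm_mul, mul_pow, Complex.norm_real, Real.norm_of_nonneg (by positivity)]
      gcongr
      exact hv.1
  have hfin : h^2 * ((1 / X)^2 * (5 * (C * X ^ κ * h * ((2 * T * B)^2 * Real.log (T + 5)^2)))) =
      20 * (C * h * X ^ κ * (B^2 * Real.log (T + 5)^2)) := by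
    rw [show (T:ℝ) = X / h from rfl]
    field_simp
    ring
  have hpart3' : ∫ v in X..2*X, ‖lineInt δ κ lo (v + h) - lineInt δ κ lo v‖^2 ≤ 20 * (C * h * X ^ κ * (B^2 * Real.log (T + 5)^2)) := by
    rw [← hfin]
    exact hpart3.trans (by gcongr)
  calc _ ≤ _ := main
    _ ≤ 3 * (5 * (C * X ^ κ * h * ((2*B)^2 * Real.log (T + 5)^2)) + C * X ^ κ * h * ((2*B)^2 * Real.log (T + 5)^2) +
        20 * (C * h * X ^ κ * (B^2 * Real.log (T + 5)^2))) := by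
        have := hpart1.trans hS4
        linarith
    _ = _ := by ring

/-- Measurable and bounded on bounded sets. -/
def LocBdd (f : ℝ → ℝ) : Prop := Measurable f ∧ ∀ R : ℝ, ∃ M : ℝ, ∀ v, |v| ≤ R → |f v| ≤ M

lemma LocBdd.add {f g : ℝ → ℝ} (hf : LocBdd f) (hg : LocBdd g) : LocBdd fun v => f v + g v := by
  refine ⟨hf.1.add hg.1, fun R => ?_⟩
  obtain ⟨A, hA⟩ := hf.2 R
  obtain ⟨B, hB⟩ := hg.2 R
  exact ⟨A + B, fun v hv => (abs_add_le _ _).trans (add_le_add (hA v hv) (hB v hv))⟩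

lemma LocBdd.mul {f g : ℝ → ℝ} (hf : LocBdd f) (hg : LocBdd g) : LocBdd fun v => f v * g v := by
  refine ⟨hf.1.mul hg.1, fun R => ?_⟩
  obtain ⟨A, hA⟩ := hf.2 R
  obtain ⟨B, hB⟩ := hg.2 R
  refine ⟨A * B, fun v hv => ?_⟩
  rw [abs_mul]
  exact mul_le_mul (hA v hv) (hB v hv) (abs_nonneg _) ((abs_nonneg _).trans (hA v hv))

lemma LocBdd.const (c : ℝ) : LocBdd fun _ => c := ⟨measurable_const, fun _ => ⟨|c|, fun _ _ => le_rfl⟩⟩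

lemma LocBdd.sub {f g : ℝ → ℝ} (hf : LocBdd f) (hg : LocBdd g) : LocBdd fun v => f v - g v := by
  have := hf.add ((LocBdd.const (-1)).mul hg)
  simpa [sub_eq_add_neg] using this

lemma LocBdd.sq {f : ℝ → ℝ} (hf : LocBdd f) : LocBdd fun v => f v ^ 2 := by
  simpa [pow_two] using hf.mul hf

lemma LocBdd.comp_add {f : ℝ → ℝ} (hf : LocBdd f) (c : ℝ) : LocBdd fun v => f (v + c) := by
  refine ⟨hf.1.comp (measurable_id.add_const c), fun R => ?_⟩
  obtain ⟨A, hA⟩ := hf.2 (R + |c|)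
  exact ⟨A, fun v hv => hA _ ((abs_add_le _ _).trans (by linarith))⟩

lemma LocBdd.comp_sub {f : ℝ → ℝ} (hf : LocBdd f) (c : ℝ) : LocBdd fun v => f (c - v) := by
  refine ⟨hf.1.comp (measurable_id.const_sub c), fun R => ?_⟩
  obtain ⟨A, hA⟩ := hf.2 (R + |c|)
  exact ⟨A, fun v hv => hA _ ((abs_sub _ _).trans (by linarith))⟩

lemma LocBdd.intervalIntegrable {f : ℝ → ℝ} (hf : LocBdd f) (a b : ℝ) :
    IntervalIntegrable f MeasureTheory.volume a b := by
  obtain ⟨M, hM⟩ := hf.2 (|a| + |b|)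
  refine (intervalIntegrable_const (c := M)).mono_fun hf.1.aestronglyMeasurable ?_
  refine (MeasureTheory.ae_restrict_iff' measurableSet_uIoc).2 (Eventually.of_forall fun v hv => ?_)
  refine (hM v ?_).trans (le_abs_self M)
  have h1 := Set.uIoc_subset_uIcc hv
  rw [Set.mem_uIcc] at h1
  rw [abs_le]
  have := neg_abs_le a; have := neg_abs_le b; have := le_abs_self a; have := le_abs_self b
  have := abs_nonneg a; have := abs_nonneg b
  constructor <;> rcases h1 with h1 | h1 <;> linarith [h1.1, h1.2]

lemma Monotone.locBdd {f : ℝ → ℝ} (hf : Monotone f) : LocBdd f := by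
  refine ⟨hf.measurable, fun R => ⟨|f (-R)| + |f R|, fun v hv => ?_⟩⟩
  rw [abs_le] at hv
  have h1 := hf hv.1
  have h2 := hf hv.2
  have := neg_abs_le (f (-R)); have := le_abs_self (f R)
  have := abs_nonneg (f (-R)); have := abs_nonneg (f R)
  rw [abs_le]; constructor <;> linarith

/-- `ψ(v^κ) - v^κ`, extended by zero to negative `v`. -/
noncomputable def psiErr (κ v : ℝ) : ℝ := Chebyshev.psi (max v 0 ^ κ) - max v 0 ^ κ

lemma monotone_max_rpow {κ : ℝ} (hκ : 0 ≤ κ) : Monotone fun v : ℝ => max v 0 ^ κ := fun _ _ hab =>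
  Real.rpow_le_rpow (le_max_right _ _) (max_le_max_right 0 hab) hκ

lemma locBdd_psiErr {κ : ℝ} (hκ : 0 ≤ κ) : LocBdd (psiErr κ) :=
  LocBdd.sub (Monotone.locBdd (Chebyshev.psi_mono.comp (monotone_max_rpow hκ))) (monotone_max_rpow hκ).locBdd

lemma psiErr_of_nonpos {κ v : ℝ} (hκ : 0 < κ) (hv : v ≤ 0) : psiErr κ v = 0 := by
  unfold psiErr
  rw [max_eq_right hv, Real.zero_rpow hκ.ne', Chebyshev.psi_eq_zero_of_lt_two (by norm_num), sub_zero]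

lemma psiErr_exp (κ : ℝ) {v : ℝ} (hv : 0 < v) :
    psiErr κ v = Chebyshev.psi (Real.exp (κ * Real.log v)) - Real.exp (κ * Real.log v) := by
  unfold psiErr
  rw [max_eq_left hv.le, Real.rpow_def_of_pos hv, mul_comm]

lemma abs_psiErr_le_one {κ v : ℝ} (hκ : 0 < κ) (hv : v ≤ 1) : |psiErr κ v| ≤ 1 := by
  unfold psiErr
  have h1 : max v 0 ^ κ ≤ 1 := Real.rpow_le_one (le_max_right _ _) (max_le hv zero_le_one) hκ.le
  have h0 : 0 ≤ max v 0 ^ κ := Real.rpow_nonneg (le_max_right _ _) _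
  rw [Chebyshev.psi_eq_zero_of_lt_two (by linarith), zero_sub, abs_neg, abs_of_nonneg h0]
  exact h1

lemma tendsto_rieszE_quotient {y : ℝ} (hy : 0 ≤ y) :
    Tendsto (fun n : ℕ => (rieszE (y + 1 / ((n:ℝ) + 1)) - rieszE y) / (1 / ((n:ℝ) + 1))) atTop
      (nhds (Chebyshev.psi (Real.exp y) - Real.exp y + 1)) := by
  have hε : ∀ n : ℕ, (0:ℝ) < 1 / ((n:ℝ) + 1) := fun n => by positivity
  have ht : Tendsto (fun n : ℕ => 1 / ((n:ℝ) + 1)) atTop (nhds 0) := tendsto_one_div_add_atTop_nhds_zero_nat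
  have hd : Tendsto (fun n : ℕ => (Real.exp (y + 1 / ((n:ℝ) + 1)) - Real.exp y) / (1 / ((n:ℝ) + 1))) atTop (nhds (Real.exp y)) := by
    have h1 := (hasDerivAt_iff_tendsto_slope_zero.1 (Real.hasDerivAt_exp y))
    have h2 : Tendsto (fun n : ℕ => 1 / ((n:ℝ) + 1)) atTop (nhdsWithin 0 {0}ᶜ) :=
      tendsto_nhdsWithin_iff.2 ⟨ht, Eventually.of_forall fun n => (hε n).ne'⟩
    refine (h1.comp h2).congr fun n => ?_
    simp only [Function.comp, smul_eq_mul]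
    exact (div_eq_inv_mul _ _).symm
  have hlim : Tendsto (fun n : ℕ => Chebyshev.psi (Real.exp y) - (Real.exp (y + 1 / ((n:ℝ) + 1)) - Real.exp y) / (1 / ((n:ℝ) + 1)) + 1) atTop
      (nhds (Chebyshev.psi (Real.exp y) - Real.exp y + 1)) := (hd.const_sub _).add_const 1
  have hfl : ∀ᶠ n : ℕ in atTop, Chebyshev.psi (Real.exp (y + 1 / ((n:ℝ) + 1))) = Chebyshev.psi (Real.exp y) := by
    have hc : Tendsto (fun n : ℕ => Real.exp (y + 1 / ((n:ℝ) + 1))) atTop (nhds (Real.exp y)) := by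
      have : Tendsto (fun n : ℕ => y + 1 / ((n:ℝ) + 1)) atTop (nhds (y + 0)) := ht.const_add y
      rw [add_zero] at this
      exact (Real.continuous_exp.tendsto y).comp this
    filter_upwards [hc.eventually_lt_const (Nat.lt_floor_add_one (Real.exp y))] with n hn
    have : ⌊Real.exp (y + 1 / ((n:ℝ) + 1))⌋₊ = ⌊Real.exp y⌋₊ := by
      rw [Nat.floor_eq_iff (Real.exp_pos _).le]
      refine ⟨(Nat.floor_le (Real.exp_pos y).le).trans (Real.exp_le_exp.2 (by linarith [hε n])), hn⟩
    rw [Chebyshev.psi_eq_psi_coe_floor, this, ← Chebyshev.psi_eq_psi_coe_floor]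
  refine tendsto_of_tendsto_of_tendsto_of_le_of_le' hlim hlim (Eventually.of_forall fun n => ?_) ?_
  · rw [le_div_iff₀ (hε n)]
    refine le_trans (le_of_eq ?_) (rieszE_sub_bounds hy (hε n)).1
    have := (hε n).ne'
    field_simp
    ring
  · filter_upwards [hfl] with n hn
    rw [div_le_iff₀ (hε n)]
    refine (rieszE_sub_bounds hy (hε n)).2.trans (le_of_eq ?_)
    rw [hn]
    have := (hε n).ne'
    field_simp
    ring

open MeasureTheory in
lemma integral_sq_le_of_tendsto {f : ℕ → ℝ → ℂ} {g : ℝ → ℝ} {a b K : ℝ} (hab : a ≤ b) (hg : Measurable g)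
    (hf : ∀ n, ContinuousOn (f n) (Set.Icc a b)) (hlim : ∀ v ∈ Set.Icc a b, Tendsto (fun n => f n v) atTop (nhds (g v : ℂ)))
    (hK : ∀ n, ∫ v in a..b, ‖f n v‖^2 ≤ K) : ∫ v in a..b, g v ^ 2 ≤ K := by
  have hK0 : 0 ≤ K := (intervalIntegral.integral_nonneg hab fun v _ => sq_nonneg _).trans (hK 0)
  rw [intervalIntegral.integral_of_le hab, integral_eq_lintegral_of_nonneg_ae (Eventually.of_forall fun v => sq_nonneg _)
    (hg.pow_const 2).aestronglyMeasurable]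
  refine ENNReal.toReal_le_of_le_ofReal hK0 ?_
  have hfi : ∀ n, IntegrableOn (fun v => ‖f n v‖^2) (Set.Ioc a b) := fun n =>
    (((hf n).norm.pow 2).integrableOn_Icc).mono_set Set.Ioc_subset_Icc_self
  calc ∫⁻ v in Set.Ioc a b, ENNReal.ofReal (g v ^ 2)
      = ∫⁻ v in Set.Ioc a b, liminf (fun n => ENNReal.ofReal (‖f n v‖^2)) atTop := by
        refine setLIntegral_congr_fun measurableSet_Ioc fun v hv => ?_
        have h1 := (hlim v ⟨hv.1.le, hv.2⟩).norm.pow 2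
        rw [Complex.norm_real, Real.norm_eq_abs, sq_abs] at h1
        exact ((ENNReal.tendsto_ofReal h1).liminf_eq).symm
    _ ≤ liminf (fun n => ∫⁻ v in Set.Ioc a b, ENNReal.ofReal (‖f n v‖^2)) atTop :=
        lintegral_liminf_le' fun n => (hfi n).aestronglyMeasurable.aemeasurable.ennreal_ofReal
    _ ≤ liminf (fun _ : ℕ => ENNReal.ofReal K) atTop := by
        refine liminf_le_liminf (Eventually.of_forall fun n => ?_)
        rw [← ofReal_integral_eq_lintegral_ofReal (hfi n) (Eventually.of_forall fun v => sq_nonneg _)]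
        refine ENNReal.ofReal_le_ofReal ?_
        have := hK n
        rwa [intervalIntegral.integral_of_le hab] at this
    _ = ENNReal.ofReal K := liminf_const _

lemma exists_delta {X : ℝ} (hX : 1 ≤ X) : ∃ δ : ℝ, 0 < δ ∧ δ ≤ 1/4 ∧ Real.log (4 * X) ≤ 2 / δ := by
  have h1 : 0 < Real.log (4 * X) := Real.log_pos (by linarith)
  refine ⟨min (1/4) (2 / Real.log (4 * X)), lt_min (by norm_num) (by positivity), min_le_left _ _, ?_⟩
  rw [le_div_iff₀ (lt_min (by norm_num) (by positivity))]
  calc Real.log (4 * X) * min (1/4) (2 / Real.log (4 * X)) ≤ Real.log (4 * X) * (2 / Real.log (4 * X)) := by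
        gcongr; exact min_le_right _ _
    _ = 2 := by field_simp

open MeasureTheory in
lemma exists_psiErr_approx (hRH : RiemannHypothesis) : ∃ C : ℝ, 0 < C ∧ ∀ δ : ℝ, 0 < δ → δ ≤ 1/4 →
    ∃ α : ℝ, |α| ≤ C ∧ ∃ ρ : ℕ → ℝ → ℂ, (∀ n, Integrable (ρ n)) ∧ (∀ n τ, ‖ρ n τ‖ ≤ absReF δ τ * (C * (1 / (|τ| + 5)))) ∧
      ∀ κ v : ℝ, 0 ≤ κ → 1 ≤ v → Tendsto (fun n => lineInt δ κ (ρ n) v) atTop (nhds ((psiErr κ v + α : ℝ) : ℂ)) := by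
  obtain ⟨C, hC, h⟩ := exists_oscillatory_rep hRH
  refine ⟨C + 1, by linarith, fun δ hδ hδ4 => ?_⟩
  obtain ⟨α, hα, h⟩ := h δ hδ hδ4
  have h' : ∀ n : ℕ, _ := fun n => h (1 / ((n:ℝ) + 1)) (by positivity)
    (by rw [div_le_one (by positivity)]; linarith [(Nat.cast_nonneg n : (0:ℝ) ≤ n)])
  choose ρ h1 h2 h3 h4 h5 using h'
  refine ⟨1 + α, (abs_add_le _ _).trans (by rw [abs_one]; linarith), ρ, h1, fun n τ => ?_, fun κ v hκ hv => ?_⟩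
  · refine (h3 n τ).trans (mul_le_mul_of_nonneg_left ?_ (absReF_nonneg δ τ))
    gcongr
    linarith
  · have hy : 0 ≤ κ * Real.log v := mul_nonneg hκ (Real.log_nonneg hv)
    have e : ∀ n, lineInt δ κ (ρ n) v = (((rieszE (κ * Real.log v + 1 / ((n:ℝ) + 1)) - rieszE (κ * Real.log v)) / (1 / ((n:ℝ) + 1)) + α : ℝ) : ℂ) :=
      fun n => (h5 n _ hy).symm
    simp_rw [e]
    refine (Complex.continuous_ofReal.tendsto _).comp ?_
    have := (tendsto_rieszE_quotient hy).add_const α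
    rw [psiErr_exp κ (by linarith), ← add_assoc]
    exact this

open MeasureTheory in
lemma exists_meanSquare_psiErr_le (hRH : RiemannHypothesis) : ∃ C : ℝ, 0 < C ∧ ∀ κ : ℝ, 1/2 ≤ κ → κ ≤ 1 →
    ∀ X : ℝ, 1 ≤ X → ∫ v in X..2*X, psiErr κ v ^ 2 ≤ C * X ^ κ * X := by
  obtain ⟨C₁, hC₁, h₁⟩ := exists_psiErr_approx hRH
  obtain ⟨C₂, hC₂, h₂⟩ := exists_meanSquare_lineInt_le hRH
  refine ⟨2 * (C₂ * (C₁^2 * Real.log (5 + 5)^2 / 5)) + 2 * C₁^2, by positivity, fun κ hκ hκ1 X hX => ?_⟩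
  obtain ⟨δ, hδ, hδ4, hδX⟩ := exists_delta hX
  obtain ⟨α, hα, ρ, hi, hb, hlim⟩ := h₁ δ hδ hδ4
  have hX0 : 0 < X := by linarith
  have hm := (locBdd_psiErr (κ := κ) (by linarith)).add (LocBdd.const α)
  have key : ∫ v in X..2*X, (psiErr κ v + α) ^ 2 ≤ C₂ * X ^ κ * X * (C₁^2 * Real.log (5 + 5)^2 / 5) := by
    refine integral_sq_le_of_tendsto (f := fun n => lineInt δ κ (ρ n)) (by linarith) hm.1 (fun n => (continuousOn_lineInt (hi n) δ κ).mono
      fun v hv => lt_of_lt_of_le hX0 hv.1) (fun v hv => hlim κ v (by linarith) (hX.trans hv.1)) fun n => ?_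
    exact h₂ δ hδ hδ4 κ hκ hκ1 5 (by norm_num) C₁ hC₁.le (ρ n) (hi n) (hb n) X hX
      ((Real.log_le_log (by linarith) (by linarith)).trans hδX)
  have hle : ∫ v in X..2*X, psiErr κ v ^ 2 ≤ ∫ v in X..2*X, (2 * (psiErr κ v + α) ^ 2 + 2 * C₁^2) := by
    refine intervalIntegral.integral_mono_on (by linarith) ((locBdd_psiErr (by linarith)).sq.intervalIntegrable _ _)
      ((((LocBdd.const 2).mul hm.sq).add (LocBdd.const (2 * C₁^2))).intervalIntegrable _ _) fun v _ => ?_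
    have : α^2 ≤ C₁^2 := by rw [← sq_abs]; gcongr
    nlinarith [sq_nonneg (psiErr κ v + 2 * α)]
  rw [intervalIntegral.integral_add (((LocBdd.const 2).mul hm.sq).intervalIntegrable _ _) ((LocBdd.const (2 * C₁^2)).intervalIntegrable _ _),
    intervalIntegral.integral_const_mul, intervalIntegral.integral_const, smul_eq_mul] at hle
  have hXκ : 1 ≤ X ^ κ := Real.one_le_rpow hX (by linarith)
  calc _ ≤ _ := hle
    _ ≤ 2 * (C₂ * X ^ κ * X * (C₁^2 * Real.log (5 + 5)^2 / 5)) + X ^ κ * X * (2 * C₁^2) := by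
        have : (2 * X - X) * (2 * C₁^2) ≤ X ^ κ * X * (2 * C₁^2) := by
          gcongr; nlinarith
        linarith
    _ = _ := by ring

open MeasureTheory in
lemma exists_meanSquare_psiErr_diff_le (hRH : RiemannHypothesis) : ∃ C : ℝ, 0 < C ∧ ∀ κ : ℝ, 1/2 ≤ κ → κ ≤ 1 →
    ∀ X h : ℝ, 1 ≤ X → 0 < h → h ≤ X →
    ∫ v in X..2*X, (psiErr κ (v + h) - psiErr κ v) ^ 2 ≤ C * h * X ^ κ * Real.log (X / h + 5)^2 := by
  obtain ⟨C₁, hC₁, h₁⟩ := exists_psiErr_approx hRH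
  obtain ⟨C₂, hC₂, h₂⟩ := exists_meanSquare_lineInt_diff_le hRH
  refine ⟨C₂ * C₁^2, by positivity, fun κ hκ hκ1 X h hX hh hhX => ?_⟩
  obtain ⟨δ, hδ, hδ4, hδX⟩ := exists_delta hX
  obtain ⟨α, hα, ρ, hi, hb, hlim⟩ := h₁ δ hδ hδ4
  have hX0 : 0 < X := by linarith
  have hE := locBdd_psiErr (κ := κ) (by linarith)
  have e : C₂ * C₁^2 * h * X ^ κ * Real.log (X / h + 5)^2 = C₂ * h * X ^ κ * (C₁^2 * Real.log (X / h + 5)^2) := by ring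
  rw [e]
  refine integral_sq_le_of_tendsto (f := fun n v => lineInt δ κ (ρ n) (v + h) - lineInt δ κ (ρ n) v) (by linarith)
    ((hE.comp_add h).sub hE).1 (fun n => ?_) (fun v hv => ?_) fun n => ?_
  · have hc := continuousOn_lineInt (hi n) δ κ
    exact (hc.comp (continuous_add_const h).continuousOn fun v hv => add_pos (hX0.trans_le hv.1) hh).sub
      (hc.mono fun v hv => hX0.trans_le hv.1)
  · have h1 := (hlim κ (v + h) (by linarith) (by linarith [hv.1])).sub (hlim κ v (by linarith) (hX.trans hv.1))
    rw [← Complex.ofReal_sub] at h1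
    convert h1 using 3
    ring
  · exact h₂ δ hδ hδ4 κ hκ hκ1 C₁ hC₁.le (ρ n) (hi n) (hb n) X h hX hh hhX hδX

lemma two_rpow_ge {κ : ℝ} (hκ : 1/2 ≤ κ) : (7/5 : ℝ) ≤ 2 ^ κ := by
  calc (7/5 : ℝ) ≤ Real.sqrt 2 := Real.le_sqrt_of_sq_le (by norm_num)
    _ = 2 ^ (1/2 : ℝ) := Real.sqrt_eq_rpow 2
    _ ≤ 2 ^ κ := Real.rpow_le_rpow_of_exponent_le (by norm_num) hκ

lemma exists_integral_psiErr_sq_le (hRH : RiemannHypothesis) : ∃ C : ℝ, 0 < C ∧ ∀ κ : ℝ, 1/2 ≤ κ → κ ≤ 1 →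
    ∀ J : ℕ, ∫ v in (0:ℝ)..2^J, psiErr κ v ^ 2 ≤ C * (2^J) ^ κ * 2^J := by
  obtain ⟨C, hC, h⟩ := exists_meanSquare_psiErr_le hRH
  refine ⟨C + 1, by linarith, fun κ hκ hκ1 J => ?_⟩
  have hE := (locBdd_psiErr (κ := κ) (by linarith)).sq
  induction J with
  | zero =>
    have : ∫ v in (0:ℝ)..1, psiErr κ v ^ 2 ≤ ∫ v in (0:ℝ)..1, 1 := by
      refine intervalIntegral.integral_mono_on (by norm_num) (hE.intervalIntegrable _ _) ((LocBdd.const 1).intervalIntegrable _ _) fun v hv => ?_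
      have := abs_psiErr_le_one (κ := κ) (by linarith) hv.2
      rw [← sq_abs]
      nlinarith [abs_nonneg (psiErr κ v)]
    simp at this ⊢
    linarith
  | succ J ih =>
    rw [← intervalIntegral.integral_add_adjacent_intervals (hE.intervalIntegrable 0 (2^J)) (hE.intervalIntegrable (2^J) (2^(J+1)))]
    have h1 := h κ hκ hκ1 (2^J) (one_le_pow₀ (by norm_num))
    have h2 : ((2:ℝ)^(J+1)) ^ κ = 2 ^ κ * (2^J) ^ κ := by
      rw [pow_succ', Real.mul_rpow (by norm_num) (by positivity)]
    rw [h2, pow_succ']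
    have h3 := two_rpow_ge hκ
    have hp : 0 < ((2:ℝ)^J) ^ κ * 2^J := by positivity
    have : (C + C + 1) * (((2:ℝ)^J) ^ κ * 2^J) ≤ ((C + 1) * (2 ^ κ) * 2) * (((2:ℝ)^J) ^ κ * 2^J) := by
      gcongr
      nlinarith
    linarith

lemma exists_integral_psiErr_diff_sq_le (hRH : RiemannHypothesis) : ∃ C : ℝ, 0 < C ∧ ∀ κ : ℝ, 1/2 ≤ κ → κ ≤ 1 →
    ∀ i J : ℕ, ∫ v in (-2^i:ℝ)..2^(i + J), (psiErr κ (v + 2^i) - psiErr κ v) ^ 2 ≤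
      C * 2^i * (2^(i + J)) ^ κ * Real.log (2^J + 5)^2 := by
  obtain ⟨C₁, hC₁, h₁⟩ := exists_integral_psiErr_sq_le hRH
  obtain ⟨C₂, hC₂, h₂⟩ := exists_meanSquare_psiErr_diff_le hRH
  refine ⟨16 * C₁ + 3 * C₂, by positivity, fun κ hκ hκ1 i J => ?_⟩
  have hE := locBdd_psiErr (κ := κ) (by linarith)
  have hD := ((hE.comp_add (2^i)).sub hE).sq
  set h : ℝ := 2^i with hh
  have hh1 : 1 ≤ h := one_le_pow₀ (by norm_num)
  have h3 := two_rpow_ge hκ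
  have h4 : (2:ℝ) ^ κ ≤ 2 := by
    calc (2:ℝ) ^ κ ≤ 2 ^ (1:ℝ) := Real.rpow_le_rpow_of_exponent_le (by norm_num) hκ1
      _ = 2 := Real.rpow_one 2
  induction J with
  | zero =>
    have b1 : ∫ v in (-h)..h, (psiErr κ (v + h) - psiErr κ v) ^ 2 ≤ ∫ v in (-h)..h, (2 * psiErr κ (v + h)^2 + 2 * psiErr κ v^2) := by
      refine intervalIntegral.integral_mono_on (by linarith) (hD.intervalIntegrable _ _)
        ((((LocBdd.const 2).mul (hE.comp_add h).sq).add ((LocBdd.const 2).mul hE.sq)).intervalIntegrable _ _) fun v _ => ?_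
      nlinarith [sq_nonneg (psiErr κ (v + h) + psiErr κ v)]
    rw [intervalIntegral.integral_add (((LocBdd.const 2).mul (hE.comp_add h).sq).intervalIntegrable _ _) (((LocBdd.const 2).mul hE.sq).intervalIntegrable _ _),
      intervalIntegral.integral_const_mul, intervalIntegral.integral_const_mul,
      intervalIntegral.integral_comp_add_right (fun v => psiErr κ v ^ 2), neg_add_cancel] at b1
    have b2 : ∫ v in (-h)..h, psiErr κ v ^ 2 ≤ ∫ v in (0:ℝ)..h + h, psiErr κ v ^ 2 := by
      rw [← intervalIntegral.integral_add_adjacent_intervals (hE.sq.intervalIntegrable (-h) 0) (hE.sq.intervalIntegrable 0 h)]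
      have : ∫ v in (-h)..0, psiErr κ v ^ 2 = ∫ v in (-h)..0, (0:ℝ) := by
        refine intervalIntegral.integral_congr fun v hv => ?_
        rw [Set.uIcc_of_le (by linarith)] at hv
        simp [psiErr_of_nonpos (κ := κ) (by linarith) hv.2]
      rw [this, intervalIntegral.integral_zero, zero_add]
      exact intervalIntegral.integral_mono_interval le_rfl (by linarith) (by linarith)
        (Eventually.of_forall fun v => by simp only [Pi.zero_apply]; positivity) (hE.sq.intervalIntegrable _ _)
    have b3 := h₁ κ hκ hκ1 (i + 1)
    rw [pow_succ, mul_two, ← hh] at b3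
    have e1 : (h + h) ^ κ ≤ 2 * h ^ κ := by
      rw [← two_mul, Real.mul_rpow (by norm_num) (by positivity)]
      gcongr
    have hl : 1 ≤ Real.log (2^0 + 5)^2 := by
      refine one_le_pow₀ ?_
      rw [Real.le_log_iff_exp_le (by norm_num)]
      linarith [Real.exp_one_lt_d9]
    rw [add_zero, ← hh]
    calc _ ≤ _ := b1
      _ ≤ 4 * (C₁ * (2 * h ^ κ) * (h + h)) := by
          have : C₁ * (h + h) ^ κ * (h + h) ≤ C₁ * (2 * h ^ κ) * (h + h) := by gcongr
          linarith
      _ = (16 * C₁) * h * h ^ κ * 1 := by ring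
      _ ≤ _ := by gcongr; linarith
  | succ J ih =>
    rw [← intervalIntegral.integral_add_adjacent_intervals (hD.intervalIntegrable (-h) (2^(i+J))) (hD.intervalIntegrable (2^(i+J)) (2^(i+(J+1))))]
    have hhX : h ≤ 2^(i+J) := by rw [hh]; exact pow_le_pow_right₀ (by norm_num) (by omega)
    have b := h₂ κ hκ hκ1 (2^(i+J)) h (hh1.trans hhX) (by linarith) hhX
    have eX : (2:ℝ)^(i+(J+1)) = 2 * 2^(i+J) := by rw [← add_assoc, pow_succ']
    have eJ : (2:ℝ)^(i+J) / h = 2^J := by rw [hh, pow_add]; field_simp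
    rw [eJ] at b
    rw [eX, Real.mul_rpow (by norm_num) (by positivity)]
    set Y : ℝ := (2^(i+J)) ^ κ with hY
    have hY0 : 0 < Y := by positivity
    have hlog : Real.log (2^J + 5)^2 ≤ Real.log (2^(J+1) + 5)^2 := by
      have h0 : (1:ℝ) ≤ 2^J := one_le_pow₀ (by norm_num)
      have : (2:ℝ)^J ≤ 2^(J+1) := pow_le_pow_right₀ (by norm_num) (by omega)
      have := Real.log_nonneg (show (1:ℝ) ≤ 2^J + 5 by linarith)
      gcongr
    calc _ ≤ (16 * C₁ + 3 * C₂) * h * Y * Real.log (2^J + 5)^2 + C₂ * h * Y * Real.log (2^J + 5)^2 := add_le_add ih b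
      _ = (16 * C₁ + 4 * C₂) * (h * Y * Real.log (2^J + 5)^2) := by ring
      _ ≤ (16 * C₁ + 4 * C₂) * (h * Y * Real.log (2^(J+1) + 5)^2) := by gcongr
      _ ≤ ((16 * C₁ + 3 * C₂) * 2 ^ κ) * (h * Y * Real.log (2^(J+1) + 5)^2) := by
          gcongr
          nlinarith
      _ = _ := by ring

/-- Locally bounded, measurable, and zero on the nonpositive half-line. -/
def Causal (f : ℝ → ℝ) : Prop := LocBdd f ∧ ∀ v ≤ 0, f v = 0

/-- The convolution `∫ f(u) g(M - u) du`. -/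
noncomputable def lconv (f g : ℝ → ℝ) (M : ℝ) : ℝ := ∫ u : ℝ, f u * g (M - u)

open MeasureTheory in
lemma LocBdd.integrable_of_support {f : ℝ → ℝ} (hf : LocBdd f) {a b : ℝ} (h0 : ∀ v, v ∉ Set.Icc a b → f v = 0) :
    Integrable f := by
  rcases le_total a b with hab | hab
  · have h1 : IntegrableOn f (Set.Icc a b) := by
      rw [integrableOn_Icc_iff_integrableOn_Ioc]
      exact (intervalIntegrable_iff_integrableOn_Ioc_of_le hab).1 (hf.intervalIntegrable a b)
    rw [← integrableOn_univ]
    exact (integrableOn_iff_integrable_of_support_subset (s := Set.Icc a b) (f := f) (μ := volume)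
      (fun v hv => by by_contra h; exact hv (h0 v h))).1 h1 |>.integrableOn
  · have hz : ∀ v, v ≠ a → f v = 0 := fun v hv => h0 v fun h => hv (le_antisymm (h.2.trans hab) h.1)
    refine (integrable_zero ℝ ℝ volume).congr ?_
    have : ∀ᵐ v : ℝ, v ≠ a := by simp [ae_iff]
    filter_upwards [this] with v hv
    exact (hz v hv).symm

open MeasureTheory in
lemma integral_eq_intervalIntegral_of_support {f : ℝ → ℝ} {a b : ℝ} (hab : a ≤ b) (h0 : ∀ v, v ∉ Set.Icc a b → f v = 0) :
    ∫ v, f v = ∫ v in a..b, f v := by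
  rw [intervalIntegral.integral_of_le hab, ← integral_Icc_eq_integral_Ioc]
  exact (setIntegral_eq_integral_of_forall_compl_eq_zero fun v hv => h0 v hv).symm

open MeasureTheory in
lemma Causal.integrable_mul {f g : ℝ → ℝ} (hf : Causal f) (hg : Causal g) (a b : ℝ) :
    Integrable fun u => f (u + a) * g (b - u) := by
  refine ((hf.1.comp_add a).mul (hg.1.comp_sub b)).integrable_of_support (a := -a) (b := b) fun v hv => ?_
  by_cases h : v + a ≤ 0
  · rw [hf.2 _ h, zero_mul]
  · rw [hg.2 _ (by by_contra h2; exact hv ⟨by linarith, by linarith⟩), mul_zero]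

open MeasureTheory in
lemma Causal.integrable_lconv {f g : ℝ → ℝ} (hf : Causal f) (hg : Causal g) (M : ℝ) :
    Integrable fun u => f u * g (M - u) := by
  simpa using hf.integrable_mul hg 0 M

open MeasureTheory in
lemma lconv_add_shift (f g : ℝ → ℝ) (M h : ℝ) : lconv f g (M + h) = ∫ u, f (u + h) * g (M - u) := by
  unfold lconv
  rw [← integral_add_right_eq_self _ h]
  congr 1; ext u
  rw [show M + h - (u + h) = M - u by ring]

open MeasureTheory in
lemma lconv_secondDiff {f g : ℝ → ℝ} (hf : Causal f) (hg : Causal g) (M h : ℝ) :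
    lconv f g (M + 2 * h) - 2 * lconv f g (M + h) + lconv f g M =
      ∫ u, (f (u + h) - f u) * (g (M - u + h) - g (M - u)) := by
  have e1 : lconv f g (M + 2 * h) = ∫ u, f (u + h) * g (M + h - u) := by
    rw [← lconv_add_shift]; congr 1; ring
  have e2 : lconv f g (M + h) = ∫ u, f (u + h) * g (M - u) := lconv_add_shift f g M h
  have e3 : lconv f g (M + h) = ∫ u, f u * g (M + h - u) := rfl
  have i1 := hf.integrable_mul hg h (M + h)
  have i2 := hf.integrable_mul hg h M
  have i3 := hf.integrable_lconv hg (M + h)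
  have i4 := hf.integrable_lconv hg M
  have : ∫ u, (f (u + h) - f u) * (g (M - u + h) - g (M - u)) =
      ∫ u, ((f (u + h) * g (M + h - u) - f (u + h) * g (M - u)) - (f u * g (M + h - u) - f u * g (M - u))) := by
    congr 1; ext u
    rw [show M - u + h = M + h - u by ring]; ring
  have i12 : Integrable fun u => f (u + h) * g (M + h - u) - f (u + h) * g (M - u) := i1.sub i2
  have i34 : Integrable fun u => f u * g (M + h - u) - f u * g (M - u) := i3.sub i4
  rw [this, integral_sub i12 i34, integral_sub i1 i2, integral_sub i3 i4, ← e1, ← e2, ← e3]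
  unfold lconv
  ring

/-- `|∫ f g| ≤ (λ ∫ f² + λ⁻¹ ∫ g²) / 2`. -/
lemma abs_integral_mul_le {f g : ℝ → ℝ} (hf : LocBdd f) (hg : LocBdd g) {a b l : ℝ} (hab : a ≤ b) (hl : 0 < l) :
    |∫ u in a..b, f u * g u| ≤ (l * (∫ u in a..b, f u ^ 2) + l⁻¹ * ∫ u in a..b, g u ^ 2) / 2 := by
  have i1 := ((LocBdd.const l).mul hf.sq).intervalIntegrable a b
  have i2 := ((LocBdd.const l⁻¹).mul hg.sq).intervalIntegrable a b
  have e : (l * (∫ u in a..b, f u ^ 2) + l⁻¹ * ∫ u in a..b, g u ^ 2) / 2 = ∫ u in a..b, (l * f u ^ 2 + l⁻¹ * g u ^ 2) / 2 := by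
    rw [intervalIntegral.integral_div, intervalIntegral.integral_add i1 i2, intervalIntegral.integral_const_mul, intervalIntegral.integral_const_mul]
  rw [e]
  refine (intervalIntegral.abs_integral_le_integral_abs hab).trans ?_
  refine intervalIntegral.integral_mono_on hab ((hf.mul hg).intervalIntegrable a b).abs ?_ fun u _ => ?_
  · exact ((i1.add i2).div_const 2)
  · rw [abs_mul, ← sq_abs (f u), ← sq_abs (g u)]
    have : l * |f u|^2 + l⁻¹ * |g u|^2 - 2 * (|f u| * |g u|) = l⁻¹ * (l * |f u| - |g u|)^2 := by
      field_simp; ring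
    have h2 : 0 ≤ l⁻¹ * (l * |f u| - |g u|)^2 := by positivity
    linarith

lemma causal_psiErr {κ : ℝ} (hκ : 0 < κ) : Causal (psiErr κ) :=
  ⟨locBdd_psiErr hκ.le, fun _ hv => psiErr_of_nonpos hκ hv⟩

lemma exists_secondDiff_psiErr_le (hRH : RiemannHypothesis) : ∃ C : ℝ, 0 < C ∧ ∀ i J : ℕ, ∀ M : ℝ, 0 ≤ M → M + 2^i ≤ 2^(i+J) →
    |lconv (psiErr 1) (psiErr (1/2)) (M + 2 * 2^i) - 2 * lconv (psiErr 1) (psiErr (1/2)) (M + 2^i) + lconv (psiErr 1) (psiErr (1/2)) M| ≤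
      C * 2^i * (2^(i + J)) ^ (3/4 : ℝ) * Real.log (2^J + 5)^2 := by
  obtain ⟨C, hC, h⟩ := exists_integral_psiErr_diff_sq_le hRH
  refine ⟨C, hC, fun i J M hM hMY => ?_⟩
  have c1 := causal_psiErr (κ := 1) one_pos
  have c2 := causal_psiErr (κ := 1/2) (by norm_num)
  set t : ℝ := 2^i with ht
  have ht0 : 0 < t := by positivity
  set Y : ℝ := 2^(i+J) with hY
  have hY0 : 0 < Y := by positivity
  rw [lconv_secondDiff c1 c2]
  set f : ℝ → ℝ := fun u => psiErr 1 (u + t) - psiErr 1 u with hf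
  set g : ℝ → ℝ := fun u => psiErr (1/2) (u + t) - psiErr (1/2) u with hg
  have lf : LocBdd f := (c1.1.comp_add t).sub c1.1
  have lg : LocBdd g := (c2.1.comp_add t).sub c2.1
  have f0 : ∀ v, v ≤ -t → f v = 0 := fun v hv => by
    simp only [hf]; rw [c1.2 _ (by linarith), c1.2 _ (by linarith), sub_zero]
  have g0 : ∀ v, v ≤ -t → g v = 0 := fun v hv => by
    simp only [hg]; rw [c2.2 _ (by linarith), c2.2 _ (by linarith), sub_zero]
  have e : ∫ u, f u * g (M - u) = ∫ u in (-t)..(M+t), f u * g (M - u) := by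
    refine integral_eq_intervalIntegral_of_support (by linarith) fun v hv => ?_
    by_cases h : v ≤ -t
    · rw [f0 v h, zero_mul]
    · rw [g0 (M - v) (by by_contra h2; exact hv ⟨by linarith, by linarith⟩), mul_zero]
  rw [e]
  refine (abs_integral_mul_le lf (lg.comp_sub M) (by linarith) (Real.rpow_pos_of_pos hY0 (-(1/4)))).trans ?_
  have hmono : ∀ F : ℝ → ℝ, LocBdd F → ∫ u in (-t)..(M+t), F u ^ 2 ≤ ∫ u in (-t)..Y, F u ^ 2 := fun F hF =>
    intervalIntegral.integral_mono_interval le_rfl (by linarith) hMY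
        (Eventually.of_forall fun v => by simp only [Pi.zero_apply]; positivity) (hF.sq.intervalIntegrable _ _)
  have b1 := (hmono f lf).trans (h 1 (by norm_num) le_rfl i J)
  have b2 : ∫ u in (-t)..(M+t), g (M - u) ^ 2 ≤ C * t * Y ^ (1/2 : ℝ) * Real.log (2^J + 5)^2 := by
    rw [intervalIntegral.integral_comp_sub_left (fun u => g u ^ 2)]
    have e1 : M - (M + t) = -t := by ring
    have e2 : M - -t = M + t := by ring
    rw [e1, e2]
    exact (hmono g lg).trans (h (1/2) le_rfl (by norm_num) i J)
  have e1 : Y ^ (-(1/4) : ℝ) * Y ^ (1 : ℝ) = Y ^ (3/4 : ℝ) := by rw [← Real.rpow_add hY0]; norm_num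
  have e2 : (Y ^ (-(1/4) : ℝ))⁻¹ * Y ^ (1/2 : ℝ) = Y ^ (3/4 : ℝ) := by
    rw [← Real.rpow_neg hY0.le, ← Real.rpow_add hY0]; norm_num
  calc _ ≤ (Y ^ (-(1/4) : ℝ) * (C * t * Y ^ (1 : ℝ) * Real.log (2^J + 5)^2) + (Y ^ (-(1/4) : ℝ))⁻¹ * (C * t * Y ^ (1/2 : ℝ) * Real.log (2^J + 5)^2)) / 2 := by
        gcongr
    _ = ((Y ^ (-(1/4) : ℝ) * Y ^ (1 : ℝ)) + (Y ^ (-(1/4) : ℝ))⁻¹ * Y ^ (1/2 : ℝ)) * (C * t * Real.log (2^J + 5)^2) / 2 := by ring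
    _ = _ := by rw [e1, e2]; ring

lemma exists_lconv_psiErr_le (hRH : RiemannHypothesis) : ∃ C : ℝ, 0 < C ∧ ∀ K : ℕ, ∀ M : ℝ, 0 ≤ M → M ≤ 2^K →
    |lconv (psiErr 1) (psiErr (1/2)) M| ≤ C * (2^K) ^ (3/4 : ℝ) * 2^K := by
  obtain ⟨C, hC, h⟩ := exists_integral_psiErr_sq_le hRH
  refine ⟨C, hC, fun K M hM hMY => ?_⟩
  have c1 := causal_psiErr (κ := 1) one_pos
  have c2 := causal_psiErr (κ := 1/2) (by norm_num)
  set Y : ℝ := 2^K with hY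
  have hY0 : 0 < Y := by positivity
  unfold lconv
  have e : ∫ u, psiErr 1 u * psiErr (1/2) (M - u) = ∫ u in (0:ℝ)..M, psiErr 1 u * psiErr (1/2) (M - u) := by
    refine integral_eq_intervalIntegral_of_support (by linarith) fun v hv => ?_
    by_cases h : v ≤ 0
    · rw [c1.2 v h, zero_mul]
    · rw [c2.2 (M - v) (by by_contra h2; exact hv ⟨by linarith, by linarith⟩), mul_zero]
  rw [e]
  refine (abs_integral_mul_le c1.1 (c2.1.comp_sub M) hM (Real.rpow_pos_of_pos hY0 (-(1/4)))).trans ?_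
  have hmono : ∀ F : ℝ → ℝ, LocBdd F → ∫ u in (0:ℝ)..M, F u ^ 2 ≤ ∫ u in (0:ℝ)..Y, F u ^ 2 := fun F hF =>
    intervalIntegral.integral_mono_interval le_rfl (by linarith) hMY
        (Eventually.of_forall fun v => by simp only [Pi.zero_apply]; positivity) (hF.sq.intervalIntegrable _ _)
  have b1 := (hmono _ c1.1).trans (h 1 (by norm_num) le_rfl K)
  have b2 : ∫ u in (0:ℝ)..M, psiErr (1/2) (M - u) ^ 2 ≤ C * Y ^ (1/2 : ℝ) * Y := by
    rw [intervalIntegral.integral_comp_sub_left (fun u => psiErr (1/2) u ^ 2), sub_self, sub_zero]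
    exact (hmono _ c2.1).trans (h (1/2) le_rfl (by norm_num) K)
  have e1 : Y ^ (-(1/4) : ℝ) * Y ^ (1 : ℝ) = Y ^ (3/4 : ℝ) := by rw [← Real.rpow_add hY0]; norm_num
  have e2 : (Y ^ (-(1/4) : ℝ))⁻¹ * Y ^ (1/2 : ℝ) = Y ^ (3/4 : ℝ) := by
    rw [← Real.rpow_neg hY0.le, ← Real.rpow_add hY0]; norm_num
  calc _ ≤ (Y ^ (-(1/4) : ℝ) * (C * Y ^ (1 : ℝ) * Y) + (Y ^ (-(1/4) : ℝ))⁻¹ * (C * Y ^ (1/2 : ℝ) * Y)) / 2 := by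
        gcongr
    _ = ((Y ^ (-(1/4) : ℝ) * Y ^ (1 : ℝ)) + (Y ^ (-(1/4) : ℝ))⁻¹ * Y ^ (1/2 : ℝ)) * (C * Y) / 2 := by ring
    _ = _ := by rw [e1, e2]; ring

lemma exists_lconv_psiErr_diff_le (hRH : RiemannHypothesis) : ∃ C : ℝ, 0 < C ∧ ∀ K : ℕ, ∀ M : ℝ, 0 ≤ M → M ≤ 2^K →
    |lconv (psiErr 1) (psiErr (1/2)) (M + 1) - lconv (psiErr 1) (psiErr (1/2)) M| ≤
      C * (K + 1) * (2^(K+1)) ^ (3/4 : ℝ) * Real.log (2^(K+1) + 5)^2 := by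
  obtain ⟨C₁, hC₁, h₁⟩ := exists_secondDiff_psiErr_le hRH
  obtain ⟨C₂, hC₂, h₂⟩ := exists_lconv_psiErr_le hRH
  refine ⟨C₁ + 4 * C₂, by positivity, fun K M hM hMK => ?_⟩
  set B := lconv (psiErr 1) (psiErr (1/2)) with hB
  set Y : ℝ := 2^(K+1) with hY
  have hY1 : 1 ≤ Y := one_le_pow₀ (by norm_num)
  have hYK : Y = 2 * 2^K := by rw [hY, pow_succ']
  set l := Real.log (Y + 5)^2 with hl
  have hl1 : 1 ≤ l := by
    refine one_le_pow₀ ?_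
    rw [Real.le_log_iff_exp_le (by linarith)]
    linarith [Real.exp_one_lt_d9]
  have step : ∀ j : ℕ, j ≤ K → |B (M + 1) - B M| ≤ |B (M + 2^j) - B M| / 2^j + j * (C₁ * Y ^ (3/4 : ℝ) * l) := by
    intro j
    induction j with
    | zero => intro _; simp
    | succ j ih =>
      intro hj
      obtain ⟨J, hJ⟩ : ∃ J, j + J = K + 1 := ⟨K + 1 - j, by omega⟩
      have hj2 : (2:ℝ)^j ≤ 2^K := pow_le_pow_right₀ (by norm_num) (by omega)
      have b := h₁ j J M hM (by rw [hJ]; linarith)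
      rw [hJ] at b
      have hlog : Real.log (2^J + 5)^2 ≤ l := by
        have h0 : (1:ℝ) ≤ 2^J := one_le_pow₀ (by norm_num)
        have : (2:ℝ)^J ≤ Y := pow_le_pow_right₀ (by norm_num) (by omega)
        have := Real.log_nonneg (show (1:ℝ) ≤ 2^J + 5 by linarith)
        rw [hl]; gcongr
      have b' : |B (M + 2 * 2^j) - 2 * B (M + 2^j) + B M| ≤ C₁ * 2^j * Y ^ (3/4 : ℝ) * l := b.trans (by gcongr)
      have hp : (0:ℝ) < 2^j := by positivity
      have b2 : |B (M + 2^j) - B M| ≤ |B (M + 2 * 2^j) - B M| / 2 + C₁ * 2^j * Y ^ (3/4 : ℝ) * l := by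
        rw [abs_le] at b'
        have h3 := neg_abs_le (B (M + 2 * 2^j) - B M)
        have h4 := le_abs_self (B (M + 2 * 2^j) - B M)
        have h5 := (abs_nonneg _).trans b
        rw [abs_le]
        constructor <;> linarith [b'.1, b'.2]
      rw [pow_succ']
      calc _ ≤ _ := ih (by omega)
        _ ≤ (|B (M + 2 * 2^j) - B M| / 2 + C₁ * 2^j * Y ^ (3/4 : ℝ) * l) / 2^j + j * (C₁ * Y ^ (3/4 : ℝ) * l) := by gcongr
        _ = _ := by push_cast; field_simp; ring
  have hs := step K le_rfl
  have t1 := h₂ (K+1) (M + 2^K) (by positivity) (by rw [← hY, hYK]; linarith)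
  have t2 := h₂ (K+1) M hM (by rw [← hY, hYK]; linarith [show (0:ℝ) < 2^K by positivity])
  have t3 : |B (M + 2^K) - B M| ≤ 2 * (C₂ * Y ^ (3/4 : ℝ) * Y) := (abs_sub _ _).trans (by linarith)
  have hY34 : 0 < Y ^ (3/4 : ℝ) := by positivity
  calc _ ≤ _ := hs
    _ ≤ 2 * (C₂ * Y ^ (3/4 : ℝ) * Y) / 2^K + K * (C₁ * Y ^ (3/4 : ℝ) * l) := by gcongr
    _ = 4 * C₂ * Y ^ (3/4 : ℝ) + K * (C₁ * Y ^ (3/4 : ℝ) * l) := by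
        congr 1
        rw [div_eq_iff (by positivity)]
        nth_rewrite 2 [hYK]; ring
    _ ≤ 4 * C₂ * Y ^ (3/4 : ℝ) * ((K + 1) * l) + (K + 1) * (C₁ * Y ^ (3/4 : ℝ) * l) := by
        have : 1 ≤ ((K:ℝ) + 1) * l := by nlinarith [(Nat.cast_nonneg K : (0:ℝ) ≤ K)]
        have h6 : 4 * C₂ * Y ^ (3/4 : ℝ) ≤ 4 * C₂ * Y ^ (3/4 : ℝ) * ((K + 1) * l) := le_mul_of_one_le_right (by positivity) this
        have h7 : 0 ≤ C₁ * Y ^ (3/4 : ℝ) * l := by positivity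
        nlinarith
    _ = _ := by ring

lemma min_one_inv_le_rpow {z η : ℝ} (hz : 0 < z) (hη : 0 ≤ η) (hη1 : η ≤ 1) : min 1 z⁻¹ ≤ z ^ (-η) := by
  rcases le_total z 1 with h | h
  · exact (min_le_left _ _).trans (Real.one_le_rpow_of_pos_of_le_one_of_nonpos hz h (by linarith))
  · refine (min_le_right _ _).trans ?_
    rw [← Real.rpow_neg_one]
    exact Real.rpow_le_rpow_of_exponent_le h (by linarith)

open MeasureTheory in
lemma exists_abs_rieszE_quotient_le (hRH : RiemannHypothesis) : ∃ C : ℝ, 0 < C ∧ ∀ ε : ℝ, 0 < ε → ε ≤ 1 → ∀ y : ℝ, 0 ≤ y →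
    |(rieszE (y + ε) - rieszE y) / ε| ≤ C * Real.exp (51/100 * y) * ε ^ (-(1/50) : ℝ) := by
  obtain ⟨C₁, hC₁, h₁⟩ := exists_norm_zetaF_le hRH
  obtain ⟨C₂, hC₂, h₂⟩ := exists_oscillatory_rep hRH
  obtain ⟨α, hα, h₃⟩ := h₂ (1/100) (by norm_num) (by norm_num)
  set I : ℝ := ∫ τ : ℝ, (1 + ‖τ‖) ^ (-(101/100) : ℝ) with hI
  have hInt : Integrable fun τ : ℝ => (1 + ‖τ‖) ^ (-(101/100) : ℝ) :=
    integrable_one_add_norm (by simp; norm_num)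
  have hI0 : 0 ≤ I := integral_nonneg fun τ => by positivity
  refine ⟨C₁ * 10000 * C₂ * I + C₂, by positivity, fun ε hε hε1 y hy => ?_⟩
  obtain ⟨ρ, hi, -, hb1, hb2, hrep⟩ := h₃ ε hε hε1
  have hεη : 1 ≤ ε ^ (-(1/50) : ℝ) := Real.one_le_rpow_of_pos_of_le_one_of_nonpos hε hε1 (by norm_num)
  have hρ : ∀ τ : ℝ, ‖ρ τ‖ ≤ C₁ * 10000 * C₂ * ε ^ (-(1/50) : ℝ) * (1 + ‖τ‖) ^ (-(101/100) : ℝ) := by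
    intro τ
    set t := |τ| + 5 with ht
    have ht0 : 0 < t := by positivity
    have hA : absReF (1/100) τ ≤ C₁ * 10000 * t ^ (1/100 : ℝ) := by
      have e := h₁ (1/100) (by norm_num) (by norm_num) (1/2 + (1/100 : ℝ) + τ * Complex.I) (by simp) (by simp; norm_num)
      have e2 : (1/2 + (1/100 : ℝ) + τ * Complex.I : ℂ).im = τ := by simp
      rw [e2] at e
      have hl : ell τ ≤ 100 * t ^ (1/100 : ℝ) := by
        have := Real.log_le_rpow_div (x := t) (ε := 1/100) ht0.le (by norm_num)
        unfold ell
        linarith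
      calc absReF (1/100) τ ≤ _ := Complex.abs_re_le_norm _
        _ ≤ _ := e
        _ ≤ C₁ * (100 * t ^ (1/100 : ℝ)) / (1/100) := by gcongr
        _ = _ := by ring
    have h0 := absReF_nonneg (1/100) τ
    have hm : ‖ρ τ‖ ≤ absReF (1/100) τ * (C₂ * (1/t) * min 1 (ε * t)⁻¹) := by
      rcases le_total 1 (ε * t)⁻¹ with h | h
      · rw [min_eq_left h, mul_one]; exact hb1 τ
      · rw [min_eq_right h]
        refine (hb2 τ).trans (le_of_eq ?_)
        rw [← ht]; field_simp
    have hm2 := min_one_inv_le_rpow (z := ε * t) (η := 1/50) (by positivity) (by norm_num) (by norm_num)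
    rw [Real.mul_rpow hε.le ht0.le] at hm2
    calc ‖ρ τ‖ ≤ _ := hm
      _ ≤ (C₁ * 10000 * t ^ (1/100 : ℝ)) * (C₂ * (1/t) * (ε ^ (-(1/50) : ℝ) * t ^ (-(1/50) : ℝ))) := by gcongr
      _ = C₁ * 10000 * C₂ * ε ^ (-(1/50) : ℝ) * (t ^ (1/100 : ℝ) * t ^ (-1 : ℝ) * t ^ (-(1/50) : ℝ)) := by
          rw [Real.rpow_neg_one]; ring
      _ = C₁ * 10000 * C₂ * ε ^ (-(1/50) : ℝ) * t ^ (-(101/100) : ℝ) := by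
          rw [← Real.rpow_add ht0, ← Real.rpow_add ht0]; norm_num
      _ ≤ _ := by
          refine mul_le_mul_of_nonneg_left ?_ (by positivity)
          refine Real.rpow_le_rpow_of_nonpos (by positivity) ?_ (by norm_num)
          rw [Real.norm_eq_abs]; linarith
  have hbig : |(rieszE (y + ε) - rieszE y) / ε + α| ≤ C₁ * 10000 * C₂ * I * Real.exp (51/100 * y) * ε ^ (-(1/50) : ℝ) := by
    rw [← Real.norm_eq_abs, ← Complex.norm_real, hrep y hy]
    have e : C₁ * 10000 * C₂ * I * Real.exp (51/100 * y) * ε ^ (-(1/50) : ℝ) =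
        ∫ τ : ℝ, (C₁ * 10000 * C₂ * ε ^ (-(1/50) : ℝ) * Real.exp (51/100 * y)) * (1 + ‖τ‖) ^ (-(101/100) : ℝ) := by
      rw [integral_const_mul, ← hI]; ring
    rw [e]
    refine norm_integral_le_of_norm_le (hInt.const_mul _) (Eventually.of_forall fun τ => ?_)
    rw [norm_mul, Complex.norm_exp]
    have e2 : ((1/2 + (1/100 : ℝ) + τ * Complex.I) * y : ℂ).re = 51/100 * y := by
      rw [Complex.re_mul_ofReal]; congr 1; simp; norm_num
    rw [e2]
    calc _ ≤ (C₁ * 10000 * C₂ * ε ^ (-(1/50) : ℝ) * (1 + ‖τ‖) ^ (-(101/100) : ℝ)) * Real.exp (51/100 * y) := by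
          gcongr; exact hρ τ
      _ = _ := by ring
  have hexp : 1 ≤ Real.exp (51/100 * y) := Real.one_le_exp (by positivity)
  have hαb : |α| ≤ C₂ * Real.exp (51/100 * y) * ε ^ (-(1/50) : ℝ) := by
    calc |α| ≤ C₂ * 1 * 1 := by linarith
      _ ≤ _ := by gcongr
  have := abs_sub ((rieszE (y + ε) - rieszE y) / ε + α) α
  rw [add_sub_cancel_right] at this
  linarith

lemma exists_abs_psiErr_le (hRH : RiemannHypothesis) : ∃ C : ℝ, 0 < C ∧ ∀ x : ℝ, |psiErr 1 x| ≤ C * max x 1 ^ (13/25 : ℝ) := by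
  obtain ⟨C, hC, h⟩ := exists_abs_rieszE_quotient_le hRH
  have hexp1 := Real.exp_pos 1
  have hpsi1 := Chebyshev.psi_nonneg (Real.exp 1)
  refine ⟨C + 2 + Chebyshev.psi (Real.exp 1) + Real.exp 1, by positivity, fun x => ?_⟩
  have hone : 1 ≤ max x 1 ^ (13/25 : ℝ) := Real.one_le_rpow (le_max_right _ _) (by norm_num)
  rcases le_total x 1 with hx | hx
  · have := abs_psiErr_le_one (κ := 1) one_pos hx
    nlinarith
  have hx0 : 0 < x := by linarith
  rcases le_total x (Real.exp 1) with hxe | hxe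
  · have e : psiErr 1 x = Chebyshev.psi x - x := by
      unfold psiErr; rw [max_eq_left hx0.le, Real.rpow_one]
    have h1 := Chebyshev.psi_mono hxe
    have h2 := Chebyshev.psi_nonneg x
    have : |psiErr 1 x| ≤ Chebyshev.psi (Real.exp 1) + Real.exp 1 := by
      rw [e, abs_le]; constructor <;> linarith
    nlinarith
  obtain ⟨y, hy⟩ : ∃ y, y = Real.log x := ⟨_, rfl⟩
  have hy1 : 1 ≤ y := by rw [hy, Real.le_log_iff_exp_le hx0]; exact hxe
  have hxy : Real.exp y = x := by rw [hy]; exact Real.exp_log hx0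
  obtain ⟨ε, hε⟩ : ∃ ε, ε = Real.exp (-(y/2)) := ⟨_, rfl⟩
  have hε0 : 0 < ε := hε ▸ Real.exp_pos _
  have hε1 : ε ≤ 1 := by rw [hε]; exact Real.exp_le_one_iff.2 (by linarith)
  have hεη : ε ^ (-(1/50) : ℝ) = Real.exp (1/100 * y) := by
    rw [hε, ← Real.exp_mul]; congr 1; ring
  have hprod : Real.exp (51/100 * y) * Real.exp (1/100 * y) = max x 1 ^ (13/25 : ℝ) := by
    rw [← Real.exp_add, max_eq_left hx, Real.rpow_def_of_pos hx0, ← hy]; congr 1; ring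
  have hεx : ε * x ≤ max x 1 ^ (13/25 : ℝ) := by
    rw [← hprod, ← Real.exp_add]
    calc ε * x = Real.exp (-(y/2) + y) := by rw [Real.exp_add, hxy, hε]
      _ ≤ _ := Real.exp_le_exp.2 (by linarith)
  generalize max x 1 ^ (13/25 : ℝ) = P at *
  have q1 := h ε hε0 hε1 y (by linarith)
  have q2 := h ε hε0 hε1 (y - ε) (by linarith)
  rw [sub_add_cancel] at q2
  have q2' : C * Real.exp (51/100 * (y - ε)) * ε ^ (-(1/50) : ℝ) ≤ C * Real.exp (51/100 * y) * ε ^ (-(1/50) : ℝ) := by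
    gcongr; linarith
  rw [hεη, mul_assoc, hprod] at q1
  rw [hεη, mul_assoc C (Real.exp (51/100 * y)), hprod] at q2'
  rw [hεη] at q2
  have q2 := q2.trans q2'
  have b1 := (rieszE_sub_bounds (y := y) (by linarith) hε0).1
  have b2 := (rieszE_sub_bounds (y := y - ε) (by linarith) hε0).2
  rw [sub_add_cancel] at b2
  have x1 : Real.exp (y + ε) - Real.exp y ≤ ε * x + ε * (ε * x) := by
    rw [Real.exp_add, hxy]
    have : Real.exp ε ≤ 1 + ε + ε^2 := by
      have := Real.abs_exp_sub_one_sub_id_le (x := ε) (by rw [abs_of_pos hε0]; exact hε1)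
      rw [abs_le] at this
      linarith [this.2]
    linarith [mul_le_mul_of_nonneg_left this hx0.le]
  have x2 : ε * x - ε * (ε * x) ≤ Real.exp y - Real.exp (y - ε) := by
    rw [sub_eq_add_neg y ε, Real.exp_add, hxy]
    have : Real.exp (-ε) ≤ 1 - ε + ε^2 := by
      have := Real.abs_exp_sub_one_sub_id_le (x := -ε) (by rw [abs_neg, abs_of_pos hε0]; exact hε1)
      rw [abs_le] at this
      linarith [this.2]
    linarith [mul_le_mul_of_nonneg_left this hx0.le]
  have e : psiErr 1 x = Chebyshev.psi x - x := by
    unfold psiErr; rw [max_eq_left hx0.le, Real.rpow_one]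
  rw [abs_le, div_le_iff₀ hε0, le_div_iff₀ hε0] at q1 q2
  rw [hxy] at b1 b2 x1 x2
  have u1 : Chebyshev.psi x - x ≤ C * P + ε * x := by
    refine le_of_mul_le_mul_left ?_ hε0
    linarith [q1.2]
  have u2 : -(C * P) - ε * x - 1 ≤ Chebyshev.psi x - x := by
    refine le_of_mul_le_mul_left ?_ hε0
    linarith [q2.1]
  have hP : Chebyshev.psi (Real.exp 1) + Real.exp 1 ≤ (Chebyshev.psi (Real.exp 1) + Real.exp 1) * P :=
    le_mul_of_one_le_right (by positivity) hone
  rw [e, abs_le]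
  constructor <;> linarith

lemma causal_max_rpow {κ : ℝ} (hκ : 0 < κ) : Causal fun v => max v 0 ^ κ :=
  ⟨(monotone_max_rpow hκ.le).locBdd, fun v hv => by
    simp only [max_eq_right hv]; exact Real.zero_rpow hκ.ne'⟩

lemma Causal.add {f g : ℝ → ℝ} (hf : Causal f) (hg : Causal g) : Causal fun v => f v + g v :=
  ⟨hf.1.add hg.1, fun v hv => by simp only [hf.2 v hv, hg.2 v hv, add_zero]⟩

/-- The mixed second difference of `F` with steps `1` and `H`. -/
def diff2 (F : ℝ → ℝ) (N H : ℝ) : ℝ := F (N + H + 1) - F (N + H) - F (N + 1) + F N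

open MeasureTheory in
lemma lconv_comm (f g : ℝ → ℝ) (M : ℝ) : lconv f g M = lconv g f M := by
  unfold lconv
  rw [← integral_sub_left_eq_self _ volume M]
  congr 1; ext u
  rw [sub_sub_cancel, mul_comm]

open MeasureTheory in
lemma lconv_add_left {f₁ f₂ g : ℝ → ℝ} (h₁ : Causal f₁) (h₂ : Causal f₂) (hg : Causal g) (M : ℝ) :
    lconv (fun v => f₁ v + f₂ v) g M = lconv f₁ g M + lconv f₂ g M := by
  unfold lconv
  rw [← integral_add (h₁.integrable_lconv hg M) (h₂.integrable_lconv hg M)]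
  congr 1; ext u; ring

lemma lconv_add_right {f g₁ g₂ : ℝ → ℝ} (hf : Causal f) (h₁ : Causal g₁) (h₂ : Causal g₂) (M : ℝ) :
    lconv f (fun v => g₁ v + g₂ v) M = lconv f g₁ M + lconv f g₂ M := by
  rw [lconv_comm, lconv_add_left h₁ h₂ hf, lconv_comm g₁, lconv_comm g₂]

open MeasureTheory in
lemma diff2_lconv {f g : ℝ → ℝ} (hf : Causal f) (hg : Causal g) (N H : ℝ) :
    diff2 (lconv f g) N H = ∫ w, f (N - w) * diff2 g w H := by
  have e : ∀ c, lconv f g (N + c) = ∫ w, g (w + c) * f (N - w) := fun c => by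
    rw [lconv_comm, lconv_add_shift]
  have i : ∀ c, Integrable fun w => g (w + c) * f (N - w) := fun c => hg.integrable_mul hf c N
  have e0 := e 0
  rw [add_zero] at e0
  have i1 := i (H + 1)
  have i2 := i H
  have i3 := i 1
  have i4 := i 0
  have i12 : Integrable fun w => g (w + (H + 1)) * f (N - w) - g (w + H) * f (N - w) := i1.sub i2
  have i123 : Integrable fun w => g (w + (H + 1)) * f (N - w) - g (w + H) * f (N - w) - g (w + 1) * f (N - w) := i12.sub i3
  unfold diff2
  rw [add_assoc, e, e, e, e0, ← integral_sub i1 i2, ← integral_sub i12 i3, ← integral_add i123 i4]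
  congr 1; ext w
  simp only [add_zero, ← add_assoc]
  ring

lemma LocBdd.diff2 {g : ℝ → ℝ} (hg : LocBdd g) (H : ℝ) : LocBdd fun w => diff2 g w H := by
  have h1 : LocBdd fun w => g (w + H + 1) := by
    simpa only [← add_assoc] using hg.comp_add (H + 1)
  exact ((h1.sub (hg.comp_add H)).sub (hg.comp_add 1)).add hg

lemma Causal.diff2_eq_zero {g : ℝ → ℝ} (hg : Causal g) {w H : ℝ} (hH : 0 ≤ H) (hw : w ≤ -H - 1) : diff2 g w H = 0 := by
  unfold diff2
  rw [hg.2 _ (by linarith), hg.2 _ (by linarith), hg.2 _ (by linarith), hg.2 _ (by linarith)]; ring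

lemma diff2_lconv_eq_intervalIntegral {f g : ℝ → ℝ} (hf : Causal f) (hg : Causal g) {N H : ℝ} (hN : 0 ≤ N) (hH : 0 ≤ H) :
    diff2 (lconv f g) N H = ∫ w in (-H - 1)..N, f (N - w) * diff2 g w H := by
  rw [diff2_lconv hf hg]
  refine integral_eq_intervalIntegral_of_support (by linarith) fun v hv => ?_
  by_cases h : v ≤ -H - 1
  · rw [hg.diff2_eq_zero hH h, mul_zero]
  · rw [hf.2 _ (by by_contra h2; exact hv ⟨by linarith, by linarith⟩), zero_mul]

lemma abs_intervalIntegral_mul_le {f k : ℝ → ℝ} (hf : LocBdd f) (hk : LocBdd k) {a b B : ℝ} (hab : a ≤ b)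
    (hB : ∀ w ∈ Set.Icc a b, |f w| ≤ B) : |∫ w in a..b, f w * k w| ≤ B * ∫ w in a..b, |k w| := by
  rw [← intervalIntegral.integral_const_mul]
  refine (intervalIntegral.abs_integral_le_integral_abs hab).trans ?_
  refine intervalIntegral.integral_mono_on hab ((hf.mul hk).intervalIntegrable a b).abs
    ((hk.intervalIntegrable a b).abs.const_mul B) fun u hu => ?_
  rw [abs_mul]
  exact mul_le_mul_of_nonneg_right (hB u hu) (abs_nonneg _)

lemma diff2_max_bounds {w H : ℝ} (hH : 0 ≤ H) : 0 ≤ diff2 (fun v => max v 0 ^ (1:ℝ)) w H ∧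
    (0 ≤ w → diff2 (fun v => max v 0 ^ (1:ℝ)) w H = 0) := by
  simp only [diff2, Real.rpow_one]
  constructor
  · rcases le_total (w + H + 1) 0 with h1 | h1 <;> rcases le_total (w + H) 0 with h2 | h2 <;>
      rcases le_total (w + 1) 0 with h3 | h3 <;> rcases le_total w 0 with h4 | h4 <;>
      simp only [max_eq_left, max_eq_right, h1, h2, h3, h4] <;> linarith
  · intro h
    rw [max_eq_left, max_eq_left, max_eq_left, max_eq_left] <;> linarith

lemma integral_max_add_rpow_one {a b c : ℝ} (ha : a + c ≤ 0) (hb : 0 ≤ b + c) :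
    ∫ w in a..b, max (w + c) 0 ^ (1:ℝ) = (b + c)^2 / 2 := by
  simp only [Real.rpow_one]
  rw [intervalIntegral.integral_comp_add_right (fun v : ℝ => max v 0)]
  have hc : Continuous fun v : ℝ => max v 0 := by fun_prop
  rw [← intervalIntegral.integral_add_adjacent_intervals (hc.intervalIntegrable _ 0) (hc.intervalIntegrable 0 _)]
  have e1 : ∫ v in (a + c)..0, max v 0 = ∫ v in (a + c)..0, (0:ℝ) :=
    intervalIntegral.integral_congr fun v hv => by
      rw [Set.uIcc_of_le ha] at hv
      exact max_eq_right hv.2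
  have e2 : ∫ v in (0:ℝ)..(b + c), max v 0 = ∫ v in (0:ℝ)..(b + c), v :=
    intervalIntegral.integral_congr fun v hv => by
      rw [Set.uIcc_of_le hb] at hv
      exact max_eq_left hv.1
  rw [e1, e2]; simp

lemma integral_diff2_max {H N : ℝ} (hH : 0 ≤ H) (hN : 0 ≤ N) :
    ∫ w in (-H - 1)..N, diff2 (fun v => max v 0 ^ (1:ℝ)) w H = H := by
  have hl : LocBdd fun v : ℝ => max v 0 ^ (1:ℝ) := (causal_max_rpow one_pos).1
  have i : ∀ c, IntervalIntegrable (fun w : ℝ => max (w + c) 0 ^ (1:ℝ)) MeasureTheory.volume (-H-1) N := fun c =>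
    (hl.comp_add c).intervalIntegrable _ _
  have e : ∀ w : ℝ, diff2 (fun v => max v 0 ^ (1:ℝ)) w H = max (w + (H+1)) 0 ^ (1:ℝ) - max (w + H) 0 ^ (1:ℝ) - max (w + 1) 0 ^ (1:ℝ) + max (w + 0) 0 ^ (1:ℝ) := fun w => by
    simp only [diff2, add_assoc, add_zero]
  simp only [e]
  rw [intervalIntegral.integral_add (((i _).sub (i _)).sub (i _)) (i _), intervalIntegral.integral_sub ((i _).sub (i _)) (i _),
    intervalIntegral.integral_sub (i _) (i _), integral_max_add_rpow_one, integral_max_add_rpow_one, integral_max_add_rpow_one, integral_max_add_rpow_one]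
  · ring
  all_goals linarith

/-- The kernel of the linear term integrates to `H`, so that term is `H` times a local average. -/
lemma abs_diff2_lconv_max_sub_le {f : ℝ → ℝ} (hf : Causal f) {N H A B : ℝ} (hN : 0 ≤ N) (hH : 0 ≤ H)
    (hB : ∀ v ∈ Set.Icc N (N + H + 1), |f v - A| ≤ B) :
    |diff2 (lconv f fun v => max v 0 ^ (1:ℝ)) N H - A * H| ≤ B * H := by
  have hg := causal_max_rpow one_pos
  set k : ℝ → ℝ := fun w => diff2 (fun v => max v 0 ^ (1:ℝ)) w H with hk
  have lk : LocBdd k := hg.1.diff2 H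
  have kint : ∀ a b, IntervalIntegrable k MeasureTheory.volume a b := lk.intervalIntegrable
  have e := diff2_lconv_eq_intervalIntegral hf hg hN hH
  have ek := integral_diff2_max hH hN
  have lfk : LocBdd fun w => f (N - w) * k w := (hf.1.comp_sub N).mul lk
  have i1 : IntervalIntegrable (fun w => f (N - w) * k w) MeasureTheory.volume (-H - 1) N := lfk.intervalIntegrable _ _
  have e2 : diff2 (lconv f fun v => max v 0 ^ (1:ℝ)) N H - A * H = ∫ w in (-H-1)..N, (f (N - w) * k w - A * k w) := by
    rw [intervalIntegral.integral_sub i1 ((kint _ _).const_mul A), intervalIntegral.integral_const_mul, e, ek]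
  have i2 : IntervalIntegrable (fun w => f (N - w) * k w - A * k w) MeasureTheory.volume (-H - 1) N :=
    i1.sub ((kint _ _).const_mul A)
  rw [e2]
  refine (intervalIntegral.abs_integral_le_integral_abs (by linarith)).trans ?_
  calc _ ≤ ∫ w in (-H-1)..N, B * k w := ?_
    _ = B * H := by rw [intervalIntegral.integral_const_mul, ek]
  refine intervalIntegral.integral_mono_on (by linarith) i2.abs ((kint _ _).const_mul B) fun w hw => ?_
  rw [← sub_mul, abs_mul, abs_of_nonneg (diff2_max_bounds hH).1]
  rcases le_total 0 w with h | h
  · rw [hk]; simp only; rw [(diff2_max_bounds hH).2 h]; simp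
  · exact mul_le_mul_of_nonneg_right (hB _ ⟨by linarith, by linarith [hw.1]⟩) (diff2_max_bounds hH).1

lemma sqrt_step_antitone {w H : ℝ} (hw : 0 ≤ w) (hH : 0 ≤ H) :
    √(w + H + 1) - √(w + H) ≤ √(w + 1) - √w := by
  have key : ∀ v : ℝ, 0 ≤ v → √(v + 1) - √v = (√(v + 1) + √v)⁻¹ := fun v hv => by
    have h1 := Real.sq_sqrt (show 0 ≤ v + 1 by linarith)
    have h2 := Real.sq_sqrt hv
    have h3 : 0 < √(v + 1) + √v := by
      have := Real.sqrt_pos.2 (show 0 < v + 1 by linarith); positivity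
    exact eq_inv_of_mul_eq_one_left (by nlinarith)
  rw [key w hw, key _ (by linarith)]
  have h3 : 0 < √(w + 1) + √w := by
    have := Real.sqrt_pos.2 (show 0 < w + 1 by linarith); positivity
  gcongr <;> linarith

/-- The second difference of the square root has small total mass. -/
lemma integral_abs_diff2_sqrt_le {H N : ℝ} (hH : 0 ≤ H) (hN : 0 ≤ N) :
    ∫ w in (-H - 1)..N, |diff2 (fun v => max v 0 ^ (1/2:ℝ)) w H| ≤ 3 * √(H + 1) := by
  set s : ℝ → ℝ := fun v => max v 0 ^ (1/2:ℝ) with hs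
  have hcau : Causal s := causal_max_rpow (by norm_num)
  have hs_eq : ∀ v, 0 ≤ v → s v = √v := fun v hv => by
    rw [hs]; simp only; rw [max_eq_left hv, Real.sqrt_eq_rpow]
  have hmono : Monotone s := monotone_max_rpow (by norm_num)
  have hs0 : ∀ v, 0 ≤ s v := fun v => by positivity
  set q : ℝ → ℝ := fun w => s (w + 1) - s w with hq
  have hq0 : ∀ w, 0 ≤ q w := fun w => sub_nonneg.2 (hmono (by linarith))
  have lq : LocBdd q := (hcau.1.comp_add 1).sub hcau.1
  have is : ∀ a b, IntervalIntegrable s MeasureTheory.volume a b := hcau.1.intervalIntegrable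
  have iq : ∀ a b, IntervalIntegrable q MeasureTheory.volume a b := lq.intervalIntegrable
  have iqH : ∀ a b, IntervalIntegrable (fun w => q (w + H)) MeasureTheory.volume a b := (lq.comp_add H).intervalIntegrable
  have lk : LocBdd fun w => diff2 s w H := hcau.1.diff2 H
  have ik : ∀ a b, IntervalIntegrable (fun w => |diff2 s w H|) MeasureTheory.volume a b := fun a b => (lk.intervalIntegrable a b).abs
  have ek : ∀ w, diff2 s w H = q (w + H) - q w := fun w => by simp only [diff2, hq]; ring
  have hQ : ∫ w in (-1:ℝ)..H, q w ≤ √(H + 1) := by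
    have e1 : ∫ w in (-1:ℝ)..H, s (w + 1) = ∫ w in (0:ℝ)..(H+1), s w := by
      rw [intervalIntegral.integral_comp_add_right s]; norm_num
    have e2 : ∫ w in (-1:ℝ)..H, q w = (∫ w in H..(H+1), s w) - ∫ w in (-1:ℝ)..0, s w := by
      rw [hq, intervalIntegral.integral_sub ((hcau.1.comp_add 1).intervalIntegrable _ _) (is _ _), e1,
        ← intervalIntegral.integral_add_adjacent_intervals (is 0 H) (is H (H+1)),
        ← intervalIntegral.integral_add_adjacent_intervals (is (-1) 0) (is 0 H)]
      ring
    have e3 : ∫ w in H..(H+1), s w ≤ ∫ w in H..(H+1), √(H + 1) :=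
      intervalIntegral.integral_mono_on (by linarith) (is _ _) (by simp) fun w hw => by
        rw [← hs_eq _ (by linarith)]; exact hmono hw.2
    have e4 : 0 ≤ ∫ w in (-1:ℝ)..0, s w := intervalIntegral.integral_nonneg (by norm_num) fun w _ => hs0 w
    rw [intervalIntegral.integral_const] at e3
    simp only [add_sub_cancel_left, one_smul] at e3
    linarith
  have hsplit : (∫ w in (-1:ℝ)..0, q w) + ∫ w in (0:ℝ)..H, q w = ∫ w in (-1:ℝ)..H, q w :=
    intervalIntegral.integral_add_adjacent_intervals (iq _ _) (iq _ _)
  have hn : ∀ a b : ℝ, a ≤ b → 0 ≤ ∫ w in a..b, q w := fun a b hab => intervalIntegral.integral_nonneg hab fun w _ => hq0 w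
  have hneg : ∫ w in (-H - 1)..0, |diff2 s w H| ≤ (∫ w in (-1:ℝ)..H, q w) + ∫ w in (-1:ℝ)..0, q w := by
    have e1 : ∫ w in (-H - 1)..0, q (w + H) = ∫ w in (-1:ℝ)..H, q w := by
      rw [intervalIntegral.integral_comp_add_right q]; congr 1 <;> ring
    have e2 : ∫ w in (-H - 1)..(-1:ℝ), q w = 0 := by
      rw [← intervalIntegral.integral_zero (a := -H - 1) (b := -1) (μ := MeasureTheory.volume)]
      refine intervalIntegral.integral_congr fun w hw => ?_
      rw [Set.uIcc_of_le (by linarith)] at hw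
      simp only [hq]
      rw [hcau.2 _ (by linarith [hw.2]), hcau.2 _ (by linarith [hw.2]), sub_zero]
    have e3 : ∫ w in (-H - 1)..0, q w = ∫ w in (-1:ℝ)..0, q w := by
      rw [← intervalIntegral.integral_add_adjacent_intervals (iq (-H-1) (-1)) (iq (-1) 0), e2, zero_add]
    rw [← e1, ← e3, ← intervalIntegral.integral_add (iqH _ _) (iq _ _)]
    refine intervalIntegral.integral_mono_on (by linarith) (ik _ _) ((iqH _ _).add (iq _ _)) fun w _ => ?_
    rw [ek]
    refine (abs_sub _ _).trans (le_of_eq ?_)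
    rw [abs_of_nonneg (hq0 _), abs_of_nonneg (hq0 _)]
  have hpos : ∫ w in (0:ℝ)..N, |diff2 s w H| ≤ ∫ w in (0:ℝ)..H, q w := by
    have e0 : ∫ w in (0:ℝ)..N, |diff2 s w H| = ∫ w in (0:ℝ)..N, (q w - q (w + H)) := by
      refine intervalIntegral.integral_congr fun w hw => ?_
      rw [Set.uIcc_of_le hN] at hw
      rw [ek, abs_of_nonpos, neg_sub]
      simp only [hq]
      rw [hs_eq _ (by linarith [hw.1]), hs_eq _ (by linarith [hw.1]), hs_eq _ (by linarith [hw.1]), hs_eq _ hw.1]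
      linarith [sqrt_step_antitone hw.1 hH]
    rw [e0, intervalIntegral.integral_sub (iq _ _) (iqH _ _), intervalIntegral.integral_comp_add_right q, zero_add]
    have a1 := intervalIntegral.integral_add_adjacent_intervals (iq 0 N) (iq N (N + H))
    have a2 := intervalIntegral.integral_add_adjacent_intervals (iq 0 H) (iq H (N + H))
    have := hn N (N + H) (by linarith)
    linarith
  rw [← intervalIntegral.integral_add_adjacent_intervals (ik (-H-1) 0) (ik 0 N)]
  have := hn 0 H hH
  have := hn (-1) 0 (by norm_num)
  linarith

/-- The bilinear decomposition of the count weighted by von Mangoldt functions. -/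
lemma lconv_psi_decomp (M : ℝ) :
    lconv (fun v => Chebyshev.psi (max v 0 ^ (1:ℝ))) (fun v => Chebyshev.psi (max v 0 ^ (1/2:ℝ))) M =
      lconv (fun v => Chebyshev.psi (max v 0 ^ (1/2:ℝ))) (fun v => max v 0 ^ (1:ℝ)) M
      + lconv (psiErr 1) (fun v => max v 0 ^ (1/2:ℝ)) M + lconv (psiErr 1) (psiErr (1/2)) M := by
  have c1 := causal_psiErr (κ := 1) one_pos
  have c2 := causal_psiErr (κ := 1/2) (by norm_num)
  have p1 := causal_max_rpow (κ := 1) one_pos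
  have p2 := causal_max_rpow (κ := 1/2) (by norm_num)
  have e : ∀ κ, (fun v : ℝ => Chebyshev.psi (max v 0 ^ κ)) = fun v => max v 0 ^ κ + psiErr κ v := fun κ => by
    ext v; unfold psiErr; ring
  have c : Causal fun v : ℝ => Chebyshev.psi (max v 0 ^ (1/2:ℝ)) := by
    rw [e]; exact p2.add c2
  rw [e 1, lconv_add_left p1 c1 c, lconv_comm (fun v => max v 0 ^ (1:ℝ)), add_assoc]
  congr 1
  rw [e (1/2), lconv_add_right c1 p2 c2]

lemma psiErr_half_eq (v : ℝ) : psiErr (1/2) v = psiErr 1 (max v 0 ^ (1/2:ℝ)) := by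
  unfold psiErr
  rw [max_eq_left (by positivity : (0:ℝ) ≤ max v 0 ^ (1/2:ℝ)), Real.rpow_one]

lemma three_mul_rpow_le {N κ : ℝ} (hN : 0 ≤ N) (hκ : κ ≤ 1) : (3 * N) ^ κ ≤ 3 * N ^ κ := by
  rw [Real.mul_rpow (by norm_num) hN]
  gcongr
  calc (3:ℝ) ^ κ ≤ 3 ^ (1:ℝ) := Real.rpow_le_rpow_of_exponent_le (by norm_num) hκ
    _ = 3 := Real.rpow_one 3

lemma exists_abs_psiErr_local_le (hRH : RiemannHypothesis) : ∃ C : ℝ, 0 < C ∧ ∀ N : ℝ, 1 ≤ N → ∀ v : ℝ, v ≤ 3 * N →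
    |psiErr 1 v| ≤ C * N ^ (13/25 : ℝ) ∧ |psiErr (1/2) v| ≤ C * N ^ (1/3 : ℝ) := by
  obtain ⟨C, hC, h⟩ := exists_abs_psiErr_le hRH
  refine ⟨C * 3, by positivity, fun N hN v hv => ⟨?_, ?_⟩⟩
  · calc |psiErr 1 v| ≤ C * max v 1 ^ (13/25 : ℝ) := h v
      _ ≤ C * (3 * N) ^ (13/25 : ℝ) := by
          have : max v 1 ≤ 3 * N := max_le hv (by linarith)
          gcongr
      _ ≤ C * (3 * N ^ (13/25 : ℝ)) := by
          gcongr; exact three_mul_rpow_le (by linarith) (by norm_num)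
      _ = _ := by ring
  · rw [psiErr_half_eq]
    have hb : max (max v 0 ^ (1/2 : ℝ)) 1 ≤ (3 * N) ^ (1/2 : ℝ) :=
      max_le (Real.rpow_le_rpow (le_max_right _ _) (max_le hv (by linarith)) (by norm_num))
        (Real.one_le_rpow (by linarith) (by norm_num))
    calc _ ≤ C * max (max v 0 ^ (1/2 : ℝ)) 1 ^ (13/25 : ℝ) := h _
      _ ≤ C * ((3 * N) ^ (1/2 : ℝ)) ^ (13/25 : ℝ) := by gcongr
      _ = C * (3 * N) ^ (13/50 : ℝ) := by rw [← Real.rpow_mul (by linarith)]; norm_num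
      _ ≤ C * (3 * N ^ (13/50 : ℝ)) := by
          gcongr; exact three_mul_rpow_le (by linarith) (by norm_num)
      _ ≤ C * (3 * N ^ (1/3 : ℝ)) := by
          have := Real.rpow_le_rpow_of_exponent_le hN (show (13/50:ℝ) ≤ 1/3 by norm_num)
          gcongr
      _ = _ := by ring

lemma rpow_mul_sqrt_le {N H : ℝ} (hN : 1 ≤ N) (hH : 0 ≤ H) :
    N ^ (13/25 : ℝ) * √H ≤ N ^ (3/4 : ℝ) + H * N ^ (1/3 : ℝ) := by
  have hN0 : 0 < N := by linarith
  have h1 : (N ^ (13/50 : ℝ) * √H) * N ^ (13/50 : ℝ) = N ^ (13/25 : ℝ) * √H := by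
    have : N ^ (13/50 : ℝ) * N ^ (13/50 : ℝ) = N ^ (13/25 : ℝ) := by rw [← Real.rpow_add hN0]; norm_num
    linear_combination √H * this
  have h2 : N ^ (3/8 : ℝ) * N ^ (29/200 : ℝ) = N ^ (13/25 : ℝ) := by rw [← Real.rpow_add hN0]; norm_num
  have h3 : N ^ (3/8 : ℝ) * N ^ (3/8 : ℝ) = N ^ (3/4 : ℝ) := by rw [← Real.rpow_add hN0]; norm_num
  have h4 : N ^ (29/200 : ℝ) * N ^ (29/200 : ℝ) ≤ N ^ (1/3 : ℝ) := by
    rw [← Real.rpow_add hN0]; exact Real.rpow_le_rpow_of_exponent_le hN (by norm_num)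
  have h5 := Real.mul_self_sqrt hH
  have h6 := mul_le_mul_of_nonneg_left h4 hH
  have h7 := sq_nonneg (N ^ (3/8 : ℝ) - N ^ (29/200 : ℝ) * √H)
  have h8 : 0 ≤ N ^ (13/25 : ℝ) * √H := by positivity
  have h9 : (N ^ (29/200 : ℝ) * √H)^2 = H * (N ^ (29/200 : ℝ) * N ^ (29/200 : ℝ)) := by
    linear_combination (N ^ (29/200 : ℝ))^2 * h5
  have h10 : N ^ (3/8 : ℝ) * (N ^ (29/200 : ℝ) * √H) = N ^ (13/25 : ℝ) * √H := by rw [← h2]; ring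
  nlinarith

lemma exists_linear_term_le (hRH : RiemannHypothesis) : ∃ C : ℝ, 0 < C ∧ ∀ N H : ℝ, 1 ≤ N → 0 ≤ H → H ≤ N →
    |diff2 (lconv (fun v => Chebyshev.psi (max v 0 ^ (1/2:ℝ))) fun v => max v 0 ^ (1:ℝ)) N H - √N * H| ≤
      H * (H + 1) / √N + C * (H * N ^ (1/3 : ℝ)) := by
  obtain ⟨C, hC, h⟩ := exists_abs_psiErr_local_le hRH
  refine ⟨C, hC, fun N H hN hH hHN => ?_⟩
  have c2 := causal_psiErr (κ := 1/2) (by norm_num)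
  have p2 := causal_max_rpow (κ := 1/2) (by norm_num)
  have e : (fun v : ℝ => Chebyshev.psi (max v 0 ^ (1/2:ℝ))) = fun v => max v 0 ^ (1/2:ℝ) + psiErr (1/2) v := by
    ext v; unfold psiErr; ring
  have c : Causal fun v : ℝ => Chebyshev.psi (max v 0 ^ (1/2:ℝ)) := by
    rw [e]; exact p2.add c2
  have hs : 0 < √N := Real.sqrt_pos.2 (by linarith)
  refine (abs_diff2_lconv_max_sub_le c (A := √N) (B := (H + 1) / √N + C * N ^ (1/3:ℝ)) (by linarith) hH fun v hv => ?_).trans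
    (le_of_eq (by ring))
  have hv0 : 0 ≤ v := by linarith [hv.1]
  have h1 := (h N hN v (by linarith [hv.2])).2
  have h2 : √v - √N ≤ (H + 1) / √N := by
    rw [le_div_iff₀ hs]
    have a1 := Real.mul_self_sqrt (show 0 ≤ N by linarith)
    have a2 := Real.mul_self_sqrt hv0
    have a3 : √N ≤ √v := Real.sqrt_le_sqrt hv.1
    nlinarith [hv.2]
  have h3 : √N ≤ √v := Real.sqrt_le_sqrt hv.1
  have h4 : Chebyshev.psi (max v 0 ^ (1/2:ℝ)) = √v + psiErr (1/2) v := by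
    unfold psiErr; rw [max_eq_left hv0, Real.sqrt_eq_rpow]; ring
  rw [h4]
  rw [abs_le] at h1 ⊢
  have : 0 ≤ (H + 1) / √N := by positivity
  constructor <;> linarith [h1.1, h1.2]

lemma exists_mixed_term_le (hRH : RiemannHypothesis) : ∃ C : ℝ, 0 < C ∧ ∀ N H : ℝ, 1 ≤ N → 0 ≤ H → H ≤ N →
    |diff2 (lconv (psiErr 1) fun v => max v 0 ^ (1/2:ℝ)) N H| ≤ C * (N ^ (3/4 : ℝ) + H * N ^ (1/3 : ℝ)) := by
  obtain ⟨C, hC, h⟩ := exists_abs_psiErr_local_le hRH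
  refine ⟨C * 6, by positivity, fun N H hN hH hHN => ?_⟩
  have c1 := causal_psiErr (κ := 1) one_pos
  have p2 := causal_max_rpow (κ := 1/2) (by norm_num)
  rw [diff2_lconv_eq_intervalIntegral c1 p2 (by linarith) hH]
  refine (abs_intervalIntegral_mul_le (c1.1.comp_sub N) (p2.1.diff2 H) (B := C * N ^ (13/25:ℝ)) (by linarith) fun w hw => ?_).trans ?_
  · exact (h N hN _ (by linarith [hw.1])).1
  have h1 := rpow_mul_sqrt_le hN hH
  have h2 : N ^ (13/25:ℝ) ≤ N ^ (3/4:ℝ) := Real.rpow_le_rpow_of_exponent_le hN (by norm_num)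
  have h3 : √(H + 1) ≤ √H + 1 := by
    have := Real.sqrt_nonneg H
    rw [Real.sqrt_le_left (by positivity)]
    nlinarith [Real.mul_self_sqrt hH]
  have h4 : 0 ≤ H * N ^ (1/3:ℝ) := by positivity
  calc _ ≤ C * N ^ (13/25:ℝ) * (3 * √(H + 1)) := by
        gcongr; exact integral_abs_diff2_sqrt_le hH (by linarith)
    _ ≤ C * N ^ (13/25:ℝ) * (3 * (√H + 1)) := by gcongr
    _ = 3 * C * (N ^ (13/25:ℝ) * √H + N ^ (13/25:ℝ)) := by ring
    _ ≤ 3 * C * (2 * (N ^ (3/4:ℝ) + H * N ^ (1/3 : ℝ))) := by gcongr; linarith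
    _ = _ := by ring

lemma exists_error_term_le (hRH : RiemannHypothesis) : ∃ C : ℝ, 0 < C ∧ ∀ N : ℕ, ∀ M : ℝ, 16 ≤ N → 0 ≤ M → M ≤ 2 * N →
    |lconv (psiErr 1) (psiErr (1/2)) (M + 1) - lconv (psiErr 1) (psiErr (1/2)) M| ≤ C * ((N : ℝ) ^ (3/4 : ℝ) * Real.log N ^ 3) := by
  obtain ⟨C, hC, h⟩ := exists_lconv_psiErr_diff_le hRH
  refine ⟨C * 5 * 8 * 4, by positivity, fun N M hN hM hMN => ?_⟩
  have hN' : (16:ℝ) ≤ N := by exact_mod_cast hN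
  have hL1 : 1 ≤ Real.log N := by
    rw [Real.le_log_iff_exp_le (by linarith)]
    linarith [Real.exp_one_lt_d9]
  have k1 : (N : ℝ) < 2 ^ (Nat.log 2 N + 1) := by exact_mod_cast Nat.lt_pow_succ_log_self (by norm_num) N
  have k2 : (2:ℝ) ^ Nat.log 2 N ≤ N := by exact_mod_cast Nat.pow_log_le_self 2 (by omega)
  set k := Nat.log 2 N with hk
  have k3 : (k : ℝ) ≤ 2 * Real.log N := by
    have := Real.log_le_log (by positivity) k2
    rw [Real.log_pow] at this
    nlinarith [Real.log_two_gt_d9, (Nat.cast_nonneg k : (0:ℝ) ≤ k)]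
  have key := h (k + 2) M hM (by rw [show k + 2 = (k + 1) + 1 by ring, pow_succ]; linarith)
  have e : (2:ℝ) ^ (k + 2 + 1) = 8 * 2 ^ k := by ring
  rw [e] at key
  have l1 : Real.log (8 * 2 ^ k + 5) ≤ 2 * Real.log N := by
    have : 2 * Real.log N = Real.log ((N:ℝ)^2) := by rw [Real.log_pow]; norm_num
    rw [this]
    exact Real.log_le_log (by positivity) (by nlinarith)
  have l0 : 0 ≤ Real.log (8 * 2 ^ k + 5) := Real.log_nonneg (by
    have : (0:ℝ) < 2 ^ k := by positivity
    linarith)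
  have l2 : ((8:ℝ) * 2 ^ k) ^ (3/4 : ℝ) ≤ 8 * (N:ℝ) ^ (3/4 : ℝ) := by
    rw [Real.mul_rpow (by norm_num) (by positivity)]
    gcongr
    calc (8:ℝ) ^ (3/4 : ℝ) ≤ 8 ^ (1:ℝ) := Real.rpow_le_rpow_of_exponent_le (by norm_num) (by norm_num)
      _ = 8 := Real.rpow_one 8
  refine key.trans ?_
  push_cast
  calc _ ≤ C * (5 * Real.log N) * (8 * (N:ℝ) ^ (3/4 : ℝ)) * (2 * Real.log N)^2 := by
        gcongr; linarith
    _ = _ := by ring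

/-- The asymptotic formula for the second difference of `ψ ⋆ ψ(√·)`. -/
lemma exists_diff2_lconv_psi_le (hRH : RiemannHypothesis) : ∃ C : ℝ, 0 < C ∧ ∀ N H : ℕ, 16 ≤ N → H ≤ N →
    |diff2 (lconv (fun v => Chebyshev.psi (max v 0 ^ (1:ℝ))) (fun v => Chebyshev.psi (max v 0 ^ (1/2:ℝ)))) N H - √N * H| ≤
      C * ((H:ℝ)^2 / √N + (N:ℝ) ^ (3/4 : ℝ) * Real.log N ^ 3 + H * (N:ℝ) ^ (1/3 : ℝ) * Real.log N ^ 2) := by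
  obtain ⟨C₁, hC₁, h₁⟩ := exists_linear_term_le hRH
  obtain ⟨C₂, hC₂, h₂⟩ := exists_mixed_term_le hRH
  obtain ⟨C₃, hC₃, h₃⟩ := exists_error_term_le hRH
  refine ⟨2 + C₁ + C₂ + 2 * C₃, by positivity, fun N H hN hHN => ?_⟩
  have hN' : (16:ℝ) ≤ N := by exact_mod_cast hN
  have hHN' : (H:ℝ) ≤ N := by exact_mod_cast hHN
  have hH0 : (0:ℝ) ≤ H := by positivity
  have hL1 : 1 ≤ Real.log N := by
    rw [Real.le_log_iff_exp_le (by linarith)]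
    linarith [Real.exp_one_lt_d9]
  have a1 := h₁ N H (by linarith) hH0 hHN'
  have a2 := h₂ N H (by linarith) hH0 hHN'
  have a3 := h₃ N (N + H) hN (by positivity) (by linarith)
  have a4 := h₃ N N hN (by positivity) (by linarith)
  have hHH : (H:ℝ) * (H + 1) / √N ≤ 2 * ((H:ℝ)^2 / √N) := by
    rw [← mul_div_assoc]
    refine div_le_div_of_nonneg_right ?_ (Real.sqrt_nonneg _)
    have : (H:ℝ) ≤ H^2 := by exact_mod_cast Nat.le_self_pow (by norm_num) H
    nlinarith
  have b1 : (H:ℝ) * (N:ℝ) ^ (1/3 : ℝ) ≤ H * (N:ℝ) ^ (1/3 : ℝ) * Real.log N ^ 2 :=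
    le_mul_of_one_le_right (by positivity) (one_le_pow₀ hL1)
  have b2 : (N:ℝ) ^ (3/4 : ℝ) ≤ (N:ℝ) ^ (3/4 : ℝ) * Real.log N ^ 3 :=
    le_mul_of_one_le_right (by positivity) (one_le_pow₀ hL1)
  have p1 : 0 ≤ (H:ℝ)^2 / √N := by positivity
  have p2 : 0 ≤ (N:ℝ) ^ (3/4 : ℝ) * Real.log N ^ 3 := by positivity
  have p3 : 0 ≤ H * (N:ℝ) ^ (1/3 : ℝ) * Real.log N ^ 2 := by positivity
  have e : diff2 (lconv (fun v => Chebyshev.psi (max v 0 ^ (1:ℝ))) (fun v => Chebyshev.psi (max v 0 ^ (1/2:ℝ)))) N H =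
      diff2 (lconv (fun v => Chebyshev.psi (max v 0 ^ (1/2:ℝ))) fun v => max v 0 ^ (1:ℝ)) N H
      + diff2 (lconv (psiErr 1) fun v => max v 0 ^ (1/2:ℝ)) N H
      + ((lconv (psiErr 1) (psiErr (1/2)) (N + H + 1) - lconv (psiErr 1) (psiErr (1/2)) (N + H))
      - (lconv (psiErr 1) (psiErr (1/2)) (N + 1) - lconv (psiErr 1) (psiErr (1/2)) N)) := by
    unfold diff2
    simp only [lconv_psi_decomp]
    ring
  rw [e]
  generalize (H:ℝ)^2 / √N = X at *
  generalize (N:ℝ) ^ (3/4 : ℝ) * Real.log N ^ 3 = Y at *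
  generalize H * (N:ℝ) ^ (1/3 : ℝ) * Real.log N ^ 2 = Z at *
  have c1 := mul_le_mul_of_nonneg_left b1 hC₁.le
  have c2 := mul_le_mul_of_nonneg_left (add_le_add b2 b1) hC₂.le
  rw [abs_le] at *
  have := mul_nonneg hC₁.le p1; have := mul_nonneg hC₁.le p2
  have := mul_nonneg hC₂.le p1
  have := mul_nonneg hC₃.le p1; have := mul_nonneg hC₃.le p3
  constructor <;> linarith [a1.1, a2.1, a3.1, a4.1, a1.2, a2.2, a3.2, a4.2]

lemma psi_eq_sum_range_ite {x : ℝ} {B : ℕ} (hx : 0 ≤ x) (hB : x ≤ B) :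
    Chebyshev.psi x = ∑ m ∈ range (B + 1), ArithmeticFunction.vonMangoldt m * if (m : ℝ) ≤ x then 1 else 0 := by
  have e : Icc 0 ⌊x⌋₊ = (range (B + 1)).filter fun m : ℕ => (m : ℝ) ≤ x := by
    ext m
    simp only [mem_Icc, zero_le, true_and, mem_filter, mem_range, Order.lt_add_one_iff, Nat.le_floor_iff hx]
    exact ⟨fun h => ⟨by exact_mod_cast h.trans hB, h⟩, fun h => h.2⟩
  rw [Chebyshev.psi_eq_sum_Icc, e, sum_filter]
  simp only [mul_ite, mul_one, mul_zero]

open MeasureTheory in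
lemma integral_indicator_Icc_of_subset {a b X : ℝ} (ha : 0 ≤ a) (hb : b ≤ X) (hX : 0 ≤ X) :
    ∫ u in (0:ℝ)..X, (Set.Icc a b).indicator (fun _ => (1:ℝ)) u = max (b - a) 0 := by
  rw [← integral_eq_intervalIntegral_of_support hX fun v hv => Set.indicator_of_notMem (fun h => hv ⟨ha.trans h.1, h.2.trans hb⟩) _]
  rw [integral_indicator_const _ measurableSet_Icc, Real.volume_real_Icc]
  simp

open MeasureTheory in
lemma lconv_psi_eq_sum {X : ℝ} {B : ℕ} (hX : 0 ≤ X) (hB : X ≤ B) :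
    lconv (fun v => Chebyshev.psi (max v 0 ^ (1:ℝ))) (fun v => Chebyshev.psi (max v 0 ^ (1/2:ℝ))) X =
      ∑ m ∈ range (B + 1), ∑ n ∈ range (B + 1), ArithmeticFunction.vonMangoldt m * ArithmeticFunction.vonMangoldt n *
        max (X - m - (n:ℝ)^2) 0 := by
  have h0 : ∀ κ : ℝ, 0 < κ → ∀ v : ℝ, v ≤ 0 → Chebyshev.psi (max v 0 ^ κ) = 0 := fun κ hκ v hv => by
    rw [max_eq_right hv, Real.zero_rpow hκ.ne', Chebyshev.psi_eq_zero_of_lt_two (by norm_num)]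
  have e1 : lconv (fun v => Chebyshev.psi (max v 0 ^ (1:ℝ))) (fun v => Chebyshev.psi (max v 0 ^ (1/2:ℝ))) X =
      ∫ u in (0:ℝ)..X, Chebyshev.psi (max u 0 ^ (1:ℝ)) * Chebyshev.psi (max (X - u) 0 ^ (1/2:ℝ)) := by
    refine integral_eq_intervalIntegral_of_support hX fun v hv => ?_
    beta_reduce
    by_cases h : v ≤ 0
    · rw [h0 1 one_pos v h, zero_mul]
    · rw [h0 (1/2) (by norm_num) _ (by by_contra h2; exact hv ⟨by linarith, by linarith⟩), mul_zero]
  have e2 : ∀ u ∈ Set.uIcc 0 X, Chebyshev.psi (max u 0 ^ (1:ℝ)) * Chebyshev.psi (max (X - u) 0 ^ (1/2:ℝ)) =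
      ∑ m ∈ range (B + 1), ∑ n ∈ range (B + 1), ArithmeticFunction.vonMangoldt m * ArithmeticFunction.vonMangoldt n *
        (Set.Icc (m:ℝ) (X - (n:ℝ)^2)).indicator (fun _ => (1:ℝ)) u := by
    intro u hu
    rw [Set.uIcc_of_le hX] at hu
    have hXu : 0 ≤ X - u := by linarith [hu.2]
    rw [max_eq_left hu.1, max_eq_left hXu, Real.rpow_one, ← Real.sqrt_eq_rpow,
      psi_eq_sum_range_ite hu.1 (hu.2.trans hB), psi_eq_sum_range_ite (B := B) (Real.sqrt_nonneg _) ?_, sum_mul_sum]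
    · refine sum_congr rfl fun m _ => sum_congr rfl fun n _ => ?_
      rw [mul_mul_mul_comm]
      congr 1
      have hsq : (n:ℝ) ≤ √(X - u) ↔ (n:ℝ)^2 ≤ X - u := Real.le_sqrt (Nat.cast_nonneg n) hXu
      simp only [Set.indicator_apply, Set.mem_Icc, hsq]
      by_cases h1 : (m:ℝ) ≤ u <;> by_cases h2 : (n:ℝ)^2 ≤ X - u
      · simp [h1, h2, show u ≤ X - (n:ℝ)^2 by linarith]
      · simp [h1, h2, show ¬ u ≤ X - (n:ℝ)^2 by intro h; exact h2 (by linarith)]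
      · simp [h1]
      · simp [h1]
    · rw [Real.sqrt_le_left (Nat.cast_nonneg B)]
      have : (B:ℝ) ≤ (B:ℝ)^2 := by exact_mod_cast Nat.le_self_pow (by norm_num) B
      linarith [hu.1]
  have ii : ∀ a b : ℝ, IntervalIntegrable ((Set.Icc a b).indicator fun _ => (1:ℝ)) volume 0 X := fun a b =>
    ((integrable_indicator_iff measurableSet_Icc).2 (by simp)).intervalIntegrable
  have ij : ∀ m : ℕ, IntervalIntegrable (fun u => ∑ n ∈ range (B + 1), ArithmeticFunction.vonMangoldt m *
      ArithmeticFunction.vonMangoldt n * (Set.Icc (m:ℝ) (X - (n:ℝ)^2)).indicator (fun _ => (1:ℝ)) u) volume 0 X := fun m => by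
    have e : (fun u => ∑ n ∈ range (B + 1), ArithmeticFunction.vonMangoldt m *
        ArithmeticFunction.vonMangoldt n * (Set.Icc (m:ℝ) (X - (n:ℝ)^2)).indicator (fun _ => (1:ℝ)) u) =
        ∑ n ∈ range (B + 1), fun u => ArithmeticFunction.vonMangoldt m *
        ArithmeticFunction.vonMangoldt n * (Set.Icc (m:ℝ) (X - (n:ℝ)^2)).indicator (fun _ => (1:ℝ)) u := by
      ext u; rw [Finset.sum_apply]
    rw [e]
    exact IntervalIntegrable.sum _ fun n _ => (ii _ _).const_mul _
  rw [e1, intervalIntegral.integral_congr e2, intervalIntegral.integral_finsetSum fun m _ => ij m]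
  refine sum_congr rfl fun m _ => ?_
  rw [intervalIntegral.integral_finsetSum fun n _ => (ii _ _).const_mul _]
  refine sum_congr rfl fun n _ => ?_
  rw [intervalIntegral.integral_const_mul, integral_indicator_Icc_of_subset (Nat.cast_nonneg m) (by nlinarith [sq_nonneg (n:ℝ)]) hX]
  congr 2; ring

/-- The indicator of `N < m + n² ≤ N + H`. -/
noncomputable def shortInd (N H m n : ℕ) : ℝ := if N < m + n ^ 2 ∧ m + n ^ 2 ≤ N + H then 1 else 0

lemma diff2_max_sub (N H m n : ℕ) :
    diff2 (fun X => max (X - m - (n:ℝ)^2) 0) N H = shortInd N H m n := by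
  unfold diff2 shortInd
  have e : ∀ X : ℝ, X - m - (n:ℝ)^2 = X - ((m + n^2 : ℕ) : ℝ) := fun X => by push_cast; ring
  simp only [e]
  generalize m + n^2 = k
  split_ifs with h
  · have h1 : (N:ℝ) + 1 ≤ k := by exact_mod_cast h.1
    have h2 : (k:ℝ) ≤ N + H := by exact_mod_cast h.2
    rw [max_eq_left, max_eq_left, max_eq_right, max_eq_right] <;> linarith
  · rcases Nat.lt_or_ge N k with h1 | h1
    · have h2 : (N:ℝ) + H + 1 ≤ k := by
        have : N + H < k := by by_contra h3; exact h ⟨h1, by omega⟩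
        exact_mod_cast this
      have := Nat.cast_nonneg (α := ℝ) H
      rw [max_eq_right, max_eq_right, max_eq_right, max_eq_right] <;> linarith
    · have h2 : (k:ℝ) ≤ N := by exact_mod_cast h1
      have := Nat.cast_nonneg (α := ℝ) H
      rw [max_eq_left, max_eq_left, max_eq_left, max_eq_left] <;> linarith

lemma diff2_lconv_psi_eq_sum (N H : ℕ) :
    diff2 (lconv (fun v => Chebyshev.psi (max v 0 ^ (1:ℝ))) (fun v => Chebyshev.psi (max v 0 ^ (1/2:ℝ)))) N H =
      ∑ m ∈ range (N + H + 1 + 1), ∑ n ∈ range (N + H + 1 + 1),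
        ArithmeticFunction.vonMangoldt m * ArithmeticFunction.vonMangoldt n * shortInd N H m n := by
  have hN := Nat.cast_nonneg (α := ℝ) N
  have hH := Nat.cast_nonneg (α := ℝ) H
  have e : ∀ X : ℝ, 0 ≤ X → X ≤ N + H + 1 → _ := fun X h1 h2 =>
    lconv_psi_eq_sum (X := X) (B := N + H + 1) h1 (by push_cast; exact h2)
  rw [diff2, e _ (by positivity) le_rfl, e _ (by positivity) (by linarith), e _ (by positivity) (by linarith), e _ hN (by linarith)]
  simp only [← sum_sub_distrib, ← sum_add_distrib]
  refine sum_congr rfl fun m _ => sum_congr rfl fun n _ => ?_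
  rw [← diff2_max_sub, diff2]
  ring

/-- The prime indicator weighted by `log`. -/
noncomputable def primeLog (m : ℕ) : ℝ := if m.Prime then Real.log m else 0

lemma primeLog_nonneg (m : ℕ) : 0 ≤ primeLog m := by
  unfold primeLog; split_ifs
  · exact Real.log_natCast_nonneg m
  · exact le_rfl

lemma primeLog_le_vonMangoldt (m : ℕ) : primeLog m ≤ ArithmeticFunction.vonMangoldt m := by
  unfold primeLog; split_ifs with h
  · rw [ArithmeticFunction.vonMangoldt_apply_prime h]
  · exact ArithmeticFunction.vonMangoldt_nonneg

lemma vonMangoldt_le_log_of_le {m B : ℕ} (h : m ≤ B) : ArithmeticFunction.vonMangoldt m ≤ Real.log B := by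
  rcases Nat.eq_zero_or_pos m with rfl | hm
  · simp [Real.log_natCast_nonneg]
  · exact ArithmeticFunction.vonMangoldt_le_log.trans (Real.log_le_log (by exact_mod_cast hm) (by exact_mod_cast h))

lemma sum_vonMangoldt_sub_primeLog (B : ℕ) :
    ∑ m ∈ range (B + 1), (ArithmeticFunction.vonMangoldt m - primeLog m) = Chebyshev.psi B - Chebyshev.theta B := by
  have e : Icc 0 B = range (B + 1) := by ext m; simp
  rw [Chebyshev.psi_eq_sum_Icc, Chebyshev.theta_eq_sum_Icc, Nat.floor_natCast, sum_filter, e, ← sum_sub_distrib]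
  rfl

lemma shortInd_nonneg (N H m n : ℕ) : 0 ≤ shortInd N H m n := by
  unfold shortInd; split_ifs <;> norm_num

lemma sum_r12_eq (N H : ℕ) : ∑ k ∈ Ioc N (N + H), r12 k =
    ∑ m ∈ range (N + H + 1 + 1), ∑ n ∈ range (N + H + 1 + 1), primeLog m * primeLog n * shortInd N H m n := by
  have e : ∀ k ∈ Ioc N (N + H), r12 k = ∑ m ∈ range (N + H + 1 + 1), ∑ n ∈ range (N + H + 1 + 1),
      if m + n ^ 2 = k then primeLog m * primeLog n else 0 := by
    intro k hk
    rw [mem_Ioc] at hk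
    have hsub : range (k + 1) ⊆ range (N + H + 1 + 1) := range_subset_range.2 (by omega)
    have hsq : ∀ n : ℕ, n ≤ n^2 := fun n => Nat.le_self_pow (by norm_num) n
    unfold r12
    rw [sum_subset hsub]
    · refine sum_congr rfl fun m _ => ?_
      rw [sum_subset hsub]
      · refine sum_congr rfl fun n _ => ?_
        unfold primeLog
        by_cases h1 : m.Prime <;> by_cases h2 : n.Prime <;> simp [h1, h2]
      · intro n _ hn
        rw [mem_range] at hn
        have := hsq n
        rw [if_neg]; rintro ⟨-, -, h⟩; omega
    · intro m _ hm
      rw [mem_range] at hm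
      refine sum_eq_zero fun n _ => ?_
      rw [if_neg]; rintro ⟨-, -, h⟩; omega
  rw [sum_congr rfl e, sum_comm]
  refine sum_congr rfl fun m _ => ?_
  rw [sum_comm]
  refine sum_congr rfl fun n _ => ?_
  rw [sum_ite_eq]
  simp only [mem_Ioc, shortInd, mul_ite, mul_one, mul_zero]

lemma sum_shortInd_right_le (N H m : ℕ) (s : Finset ℕ) : ∑ n ∈ s, shortInd N H m n ≤ Nat.sqrt H + 1 := by
  unfold shortInd
  rw [sum_boole]
  set t := s.filter fun n => N < m + n ^ 2 ∧ m + n ^ 2 ≤ N + H with ht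
  suffices t.card ≤ Nat.sqrt H + 1 by exact_mod_cast this
  rcases t.eq_empty_or_nonempty with h | h
  · simp [h]
  have hsub : t ⊆ Icc (t.min' h) (t.min' h + Nat.sqrt H) := by
    intro n hn
    have h1 := t.min'_le n hn
    have h2 := (mem_filter.1 (t.min'_mem h)).2
    have h3 := (mem_filter.1 hn).2
    rw [mem_Icc]
    refine ⟨h1, ?_⟩
    obtain ⟨d, hd⟩ := Nat.exists_eq_add_of_le h1
    generalize t.min' h = a at *
    have : d ≤ Nat.sqrt H := by
      rw [Nat.le_sqrt']
      subst hd
      nlinarith [h2.1, h3.2]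
    omega
  refine (card_le_card hsub).trans ?_
  rw [Nat.card_Icc]; omega

lemma sum_shortInd_left_le (N H n : ℕ) (s : Finset ℕ) : ∑ m ∈ s, shortInd N H m n ≤ H := by
  unfold shortInd
  rw [sum_boole]
  suffices (s.filter fun m => N < m + n ^ 2 ∧ m + n ^ 2 ≤ N + H).card ≤ H by exact_mod_cast this
  have hsub : (s.filter fun m => N < m + n ^ 2 ∧ m + n ^ 2 ≤ N + H) ⊆ Ico (N + 1 - n^2) (N + 1 - n^2 + H) := by
    intro m hm
    have h := (mem_filter.1 hm).2
    rw [mem_Ico]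
    omega
  refine (card_le_card hsub).trans ?_
  rw [Nat.card_Ico]; omega

/-- The contribution of proper prime powers. -/
lemma exists_prime_power_removal : ∃ C : ℝ, 0 < C ∧ ∀ N H B : ℕ, B = N + H + 1 →
    |∑ k ∈ Ioc N (N + H), r12 k - ∑ m ∈ range (B + 1), ∑ n ∈ range (B + 1),
        ArithmeticFunction.vonMangoldt m * ArithmeticFunction.vonMangoldt n * shortInd N H m n| ≤
      C * (√B * Real.log B * (√H + 1) + √√B * Real.log B * H) := by
  obtain ⟨C, hC⟩ := Chebyshev.psi_sub_theta_le_mul_sqrt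
  refine ⟨max C 1, by positivity, fun N H B hB => ?_⟩
  have hL := Real.log_natCast_nonneg B
  have hdiff : ∀ m : ℕ, 0 ≤ ArithmeticFunction.vonMangoldt m - primeLog m := fun m =>
    sub_nonneg.2 (primeLog_le_vonMangoldt m)
  have hpp : ∀ B : ℕ, ∑ m ∈ range (B + 1), (ArithmeticFunction.vonMangoldt m - primeLog m) ≤ max C 1 * √B := fun B => by
    rw [sum_vonMangoldt_sub_primeLog]
    exact (hC B).trans (by gcongr; exact le_max_left _ _)
  set T₁ := ∑ m ∈ range (B + 1), ∑ n ∈ range (B + 1),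
    (ArithmeticFunction.vonMangoldt m - primeLog m) * ArithmeticFunction.vonMangoldt n * shortInd N H m n with hT₁
  set T₂ := ∑ m ∈ range (B + 1), ∑ n ∈ range (B + 1),
    primeLog m * (ArithmeticFunction.vonMangoldt n - primeLog n) * shortInd N H m n with hT₂
  have e : ∑ k ∈ Ioc N (N + H), r12 k - ∑ m ∈ range (B + 1), ∑ n ∈ range (B + 1),
        ArithmeticFunction.vonMangoldt m * ArithmeticFunction.vonMangoldt n * shortInd N H m n = -(T₁ + T₂) := by
    rw [sum_r12_eq, ← hB, hT₁, hT₂, ← sum_sub_distrib, ← sum_add_distrib, ← sum_neg_distrib]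
    refine sum_congr rfl fun m _ => ?_
    rw [← sum_sub_distrib, ← sum_add_distrib, ← sum_neg_distrib]
    refine sum_congr rfl fun n _ => by ring
  have h₁ : 0 ≤ T₁ := sum_nonneg fun m _ => sum_nonneg fun n _ =>
    mul_nonneg (mul_nonneg (hdiff m) ArithmeticFunction.vonMangoldt_nonneg) (shortInd_nonneg _ _ _ _)
  have h₂ : 0 ≤ T₂ := sum_nonneg fun m _ => sum_nonneg fun n _ =>
    mul_nonneg (mul_nonneg (primeLog_nonneg m) (hdiff n)) (shortInd_nonneg _ _ _ _)
  have hsqrtH : (Nat.sqrt H : ℝ) ≤ √H := Real.nat_sqrt_le_real_sqrt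
  have b₁ : T₁ ≤ max C 1 * √B * (Real.log B * (√H + 1)) := by
    calc T₁ ≤ ∑ m ∈ range (B + 1), (ArithmeticFunction.vonMangoldt m - primeLog m) * (Real.log B * (√H + 1)) := by
          refine sum_le_sum fun m _ => ?_
          calc _ ≤ ∑ n ∈ range (B + 1), (ArithmeticFunction.vonMangoldt m - primeLog m) * Real.log B * shortInd N H m n :=
                sum_le_sum fun n hn => by
                  refine mul_le_mul_of_nonneg_right ?_ (shortInd_nonneg _ _ _ _)
                  exact mul_le_mul_of_nonneg_left (vonMangoldt_le_log_of_le (by rw [mem_range] at hn; omega)) (hdiff m)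
            _ = (ArithmeticFunction.vonMangoldt m - primeLog m) * (Real.log B * ∑ n ∈ range (B + 1), shortInd N H m n) := by
                rw [← mul_sum]; ring
            _ ≤ _ := by
                refine mul_le_mul_of_nonneg_left (mul_le_mul_of_nonneg_left ?_ hL) (hdiff m)
                exact (sum_shortInd_right_le N H m _).trans (by linarith)
      _ = (∑ m ∈ range (B + 1), (ArithmeticFunction.vonMangoldt m - primeLog m)) * (Real.log B * (√H + 1)) := by
          rw [sum_mul]
      _ ≤ _ := mul_le_mul_of_nonneg_right (hpp B) (by positivity)
  have b₂ : T₂ ≤ max C 1 * √√B * (Real.log B * H) := by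
    have hsqB : (Nat.sqrt B : ℝ) ≤ √B := Real.nat_sqrt_le_real_sqrt
    rw [hT₂, sum_comm]
    calc _ ≤ ∑ n ∈ range (B + 1), if n < Nat.sqrt B + 1 then (ArithmeticFunction.vonMangoldt n - primeLog n) * (Real.log B * H) else 0 := by
          refine sum_le_sum fun n _ => ?_
          split_ifs with hn
          · calc _ ≤ ∑ m ∈ range (B + 1), (ArithmeticFunction.vonMangoldt n - primeLog n) * Real.log B * shortInd N H m n :=
                  sum_le_sum fun m hm => by
                    refine mul_le_mul_of_nonneg_right ?_ (shortInd_nonneg _ _ _ _)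
                    rw [mul_comm]
                    refine mul_le_mul_of_nonneg_left ?_ (hdiff n)
                    exact (primeLog_le_vonMangoldt m).trans (vonMangoldt_le_log_of_le (by rw [mem_range] at hm; omega))
              _ = (ArithmeticFunction.vonMangoldt n - primeLog n) * (Real.log B * ∑ m ∈ range (B + 1), shortInd N H m n) := by
                  rw [← mul_sum]; ring
              _ ≤ _ := mul_le_mul_of_nonneg_left (mul_le_mul_of_nonneg_left (sum_shortInd_left_le N H n _) hL) (hdiff n)
          · refine le_of_eq (sum_eq_zero fun m _ => ?_)
            have : B < n ^ 2 := by rw [← Nat.sqrt_lt']; omega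
            unfold shortInd
            rw [if_neg (by omega), mul_zero]
      _ = ∑ n ∈ range (Nat.sqrt B + 1), (ArithmeticFunction.vonMangoldt n - primeLog n) * (Real.log B * H) := by
          rw [← sum_filter]
          refine sum_congr ?_ fun _ _ => rfl
          ext n
          have := Nat.sqrt_le_self B
          simp only [mem_filter, mem_range]; omega
      _ = (∑ n ∈ range (Nat.sqrt B + 1), (ArithmeticFunction.vonMangoldt n - primeLog n)) * (Real.log B * H) := by
          rw [sum_mul]
      _ ≤ max C 1 * √(Nat.sqrt B) * (Real.log B * H) := mul_le_mul_of_nonneg_right (hpp _) (by positivity)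
      _ ≤ _ := by gcongr
  rw [e, abs_neg, abs_of_nonneg (by positivity)]
  linarith

lemma sqrt_mul_sqrt_le {N H : ℝ} (hN : 1 ≤ N) (hH : 0 ≤ H) :
    √N * √H ≤ N ^ (3/4 : ℝ) + H * N ^ (1/3 : ℝ) := by
  refine le_trans ?_ (rpow_mul_sqrt_le hN hH)
  rw [Real.sqrt_eq_rpow N]
  exact mul_le_mul_of_nonneg_right (Real.rpow_le_rpow_of_exponent_le hN (by norm_num))
    (Real.sqrt_nonneg H)

lemma exists_prime_power_removal_le : ∃ C : ℝ, 0 < C ∧ ∀ N H : ℕ, 16 ≤ N → H ≤ N →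
    |∑ k ∈ Ioc N (N + H), r12 k - diff2 (lconv (fun v => Chebyshev.psi (max v 0 ^ (1:ℝ))) (fun v => Chebyshev.psi (max v 0 ^ (1/2:ℝ)))) N H| ≤
      C * ((H:ℝ)^2 / √N + (N:ℝ) ^ (3/4 : ℝ) * Real.log N ^ 3 + H * (N:ℝ) ^ (1/3 : ℝ) * Real.log N ^ 2) := by
  obtain ⟨C, hC, h⟩ := exists_prime_power_removal
  refine ⟨C * 12, by positivity, fun N H hN hHN => ?_⟩
  rw [diff2_lconv_psi_eq_sum]
  refine (h N H (N + H + 1) rfl).trans ?_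
  have hN' : (16:ℝ) ≤ N := by exact_mod_cast hN
  have hHN' : (H:ℝ) ≤ N := by exact_mod_cast hHN
  have hH0 : (0:ℝ) ≤ H := by positivity
  have hL1 : 1 ≤ Real.log N := by
    rw [Real.le_log_iff_exp_le (by linarith)]
    linarith [Real.exp_one_lt_d9]
  set B : ℝ := ((N + H + 1 : ℕ) : ℝ) with hB
  have hB1 : 1 ≤ B := by rw [hB]; push_cast; linarith
  have hB4 : B ≤ 4 * N := by rw [hB]; push_cast; linarith
  have s1 : √B ≤ 2 * √N := by
    rw [Real.sqrt_le_left (by positivity), mul_pow, Real.sq_sqrt (by positivity)]; linarith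
  have s2 : √√B ≤ 2 * (N:ℝ) ^ (1/3 : ℝ) := by
    have e : √√(N:ℝ) = (N:ℝ) ^ (1/4 : ℝ) := by
      rw [Real.sqrt_eq_rpow, Real.sqrt_eq_rpow, ← Real.rpow_mul (by positivity)]; norm_num
    have h1 : √√B ≤ 2 * √√(N:ℝ) := by
      rw [Real.sqrt_le_left (by positivity), mul_pow, Real.sq_sqrt (by positivity)]
      linarith [Real.sqrt_nonneg (N:ℝ)]
    have h2 : (N:ℝ) ^ (1/4 : ℝ) ≤ (N:ℝ) ^ (1/3 : ℝ) := Real.rpow_le_rpow_of_exponent_le (by linarith) (by norm_num)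
    linarith [e ▸ h1]
  have l0 : 0 ≤ Real.log B := Real.log_nonneg hB1
  have l1 : Real.log B ≤ 2 * Real.log N := by
    have : 2 * Real.log N = Real.log ((N:ℝ)^2) := by rw [Real.log_pow]; norm_num
    rw [this]
    exact Real.log_le_log (by linarith) (by nlinarith)
  have m1 := sqrt_mul_sqrt_le (N := (N:ℝ)) (by linarith) hH0
  have m2 : √(N:ℝ) ≤ (N:ℝ) ^ (3/4 : ℝ) := by
    rw [Real.sqrt_eq_rpow]; exact Real.rpow_le_rpow_of_exponent_le (by linarith) (by norm_num)
  have L2 : Real.log N ≤ Real.log N ^ 2 := le_self_pow₀ hL1 (by norm_num)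
  have L3 : Real.log N ≤ Real.log N ^ 3 := le_self_pow₀ hL1 (by norm_num)
  have p1 : 0 ≤ (H:ℝ)^2 / √N := by positivity
  have Y0 : 0 ≤ (N:ℝ) ^ (3/4 : ℝ) := by positivity
  have Z0 : 0 ≤ H * (N:ℝ) ^ (1/3 : ℝ) := by positivity
  have q1 := mul_le_mul_of_nonneg_left L3 Y0
  have q2 := mul_le_mul_of_nonneg_left L2 Z0
  calc C * (√B * Real.log B * (√H + 1) + √√B * Real.log B * H)
      ≤ C * (2 * √N * (2 * Real.log N) * (√H + 1) + 2 * (N:ℝ) ^ (1/3 : ℝ) * (2 * Real.log N) * H) := by gcongr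
    _ = C * (4 * ((√N * √H + √N) * Real.log N) + 4 * ((H * (N:ℝ) ^ (1/3 : ℝ)) * Real.log N)) := by ring
    _ ≤ C * (4 * ((((N:ℝ) ^ (3/4 : ℝ) + H * (N:ℝ) ^ (1/3 : ℝ)) + (N:ℝ) ^ (3/4 : ℝ)) * Real.log N)
          + 4 * ((H * (N:ℝ) ^ (1/3 : ℝ)) * Real.log N)) := by gcongr
    _ = C * (8 * ((N:ℝ) ^ (3/4 : ℝ) * Real.log N) + 8 * ((H * (N:ℝ) ^ (1/3 : ℝ)) * Real.log N)) := by ring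
    _ ≤ C * (12 * ((H:ℝ)^2 / √N + (N:ℝ) ^ (3/4 : ℝ) * Real.log N ^ 3 + H * (N:ℝ) ^ (1/3 : ℝ) * Real.log N ^ 2)) := by
        refine mul_le_mul_of_nonneg_left ?_ hC.le
        have := mul_nonneg Y0 (zero_le_one.trans hL1)
        have := mul_nonneg Z0 (zero_le_one.trans hL1)
        linarith
    _ = _ := by ring

/-- Assuming RH, `∑_{n=N+1}^{N+H} r''_{1,2}(n) = H N^{1/2}`
`+ O(H²/N^{1/2} + N^{3/4} log³N + H N^{1/3} log²N)` as `N → ∞`, uniformly for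
`N^{1/4} (log N)³ = o(H)` and `H = o(N)`. -/
theorem prime_plus_prime_square_short_intervals
    (hRH : RiemannHypothesis) (H : ℕ → ℕ)
    (hlow : Tendsto (fun N : ℕ => (N : ℝ) ^ ((1 : ℝ) / 4) * Real.log N ^ 3 / H N) atTop (nhds 0))
    (hupp : Tendsto (fun N : ℕ => (H N : ℝ) / N) atTop (nhds 0)) :
    (fun N : ℕ => (∑ n ∈ Finset.Ioc N (N + H N), r12 n) - H N * (N : ℝ) ^ ((1 : ℝ) / 2))
      =O[atTop]
    (fun N : ℕ => (H N : ℝ) ^ 2 / (N : ℝ) ^ ((1 : ℝ) / 2) +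
      (N : ℝ) ^ ((3 : ℝ) / 4) * Real.log N ^ 3 +
      (H N : ℝ) * (N : ℝ) ^ ((1 : ℝ) / 3) * Real.log N ^ 2) := by
  obtain ⟨C₁, hC₁, h₁⟩ := exists_diff2_lconv_psi_le hRH
  obtain ⟨C₂, hC₂, h₂⟩ := exists_prime_power_removal_le
  refine IsBigO.of_bound (C₁ + C₂) ?_
  filter_upwards [eventually_ge_atTop 16, hupp.eventually (gt_mem_nhds one_pos)] with N hN hHN
  have hN0 : (0:ℝ) < N := by exact_mod_cast (by omega : 0 < N)
  rw [div_lt_one hN0] at hHN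
  have hle : H N ≤ N := by exact_mod_cast hHN.le
  have a1 := h₁ N (H N) hN hle
  have a2 := h₂ N (H N) hN hle
  simp only [← Real.sqrt_eq_rpow]
  rw [Real.norm_eq_abs, Real.norm_eq_abs, add_mul]
  refine le_trans ?_ ((add_le_add a1 a2).trans ?_)
  · rw [mul_comm (H N : ℝ), add_comm]
    refine le_trans (le_of_eq ?_) (abs_add_le _ _)
    congr 1; ring
  · exact add_le_add (mul_le_mul_of_nonneg_left (le_abs_self _) hC₁.le) (mul_le_mul_of_nonneg_left (le_abs_self _) hC₂.le)
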